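/- There exists a Polish space Y ⊂ 2^ω × [0,1]² such that F₀(Y) is Game Σ⁰₂-hard. In particular F₀(Y) is not in the smallest nontrivial pointclass closed under complementation and the Souslin operation A. -/

import Mathlib

open Set Filter Topology TopologicalSpace

/-- `DimLE X n` : the topological (covering) dimension of `X` is at most `n`, i.e. every
finite open cover of `X` admits an open shrinking (refinement) of order at most `n + 1`. -/
def DimLE (X : Type*) [TopologicalSpace X] (n : ℕ) : Prop :=
  ∀ (k : ℕ) (U : Fin k → Set X), (∀ i, IsOpen (U i)) → (⋃ i, U i) = Set.univ →
    ∃ V : Fin k → Set X, (∀ i, IsOpen (V i)) ∧ (∀ i, V i ⊆ U i) ∧ (⋃ i, V i) = Set.univ ∧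
      ∀ x : X, ({i | x ∈ V i}).ncard ≤ n + 1

/-- The collection `F(X)` of closed subsets of `X`. -/
abbrev Cl (X : Type*) [TopologicalSpace X] : Type _ := {F : Set X // IsClosed F}

/-- `F₀(X)` : the set of all closed zero-dimensional subsets of `X`. -/
def F0 (X : Type*) [TopologicalSpace X] : Set (Cl X) := {F | DimLE (↥F.1) 0}

/-- The Vietoris topology on subsets of `Y`. -/
def vietoris (Y : Type*) [TopologicalSpace Y] : TopologicalSpace (Set Y) :=
  TopologicalSpace.generateFrom
    ({S | ∃ U : Set Y, IsOpen U ∧ S = {A : Set Y | A ⊆ U}} ∪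
     {S | ∃ U : Set Y, IsOpen U ∧ S = {A : Set Y | (A ∩ U).Nonempty}})

/-- A topology `τ` on `F(X)` is admissible if it is induced, via `F ↦ closure (e '' F)`,
by the Vietoris topology on some metrizable compactification `Y` of `X` (with embedding `e`). -/
def IsAdmissible (X : Type*) [tX : TopologicalSpace X] (τ : TopologicalSpace (Cl X)) : Prop :=
  ∃ (Y : Type) (tY : TopologicalSpace Y) (_ : @CompactSpace Y tY)
    (_ : @TopologicalSpace.MetrizableSpace Y tY) (e : X → Y),
      @Topology.IsEmbedding X Y tX tY e ∧
      τ = (@vietoris Y tY).induced (fun F : Cl X => @closure Y tY (e '' F.1))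

/-- An analytic space: a separable metrizable space which is empty or a continuous image
of the Baire space `ℕ → ℕ`. -/
def IsAnalyticSpace (X : Type*) [TopologicalSpace X] : Prop :=
  TopologicalSpace.MetrizableSpace X ∧ TopologicalSpace.SeparableSpace X ∧
    (IsEmpty X ∨ ∃ f : (ℕ → ℕ) → X, Continuous f ∧ Function.Surjective f)

/-- `Σ¹₂` subsets of a topological space: projections of co-analytic sets. -/
def IsSigma12 {W : Type*} [TopologicalSpace W] (s : Set W) : Prop :=
  ∃ B : Set (W × (ℕ → ℕ)), MeasureTheory.AnalyticSet Bᶜ ∧ s = {w | ∃ y, (w, y) ∈ B}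

/-- `Σ¹₂`-hardness (with Cantor space `2^ω = ℕ → Bool` as source). -/
def Sigma12Hard {W : Type*} [TopologicalSpace W] (A : Set W) : Prop :=
  ∀ A' : Set (ℕ → Bool), IsSigma12 A' →
    ∃ φ : (ℕ → Bool) → W, Continuous φ ∧ A' = φ ⁻¹' A

/-- `Π¹₁`-hardness. -/
def Pi11Hard {W : Type*} [TopologicalSpace W] (A : Set W) : Prop :=
  ∀ A' : Set (ℕ → Bool), MeasureTheory.AnalyticSet A'ᶜ →
    ∃ φ : (ℕ → Bool) → W, Continuous φ ∧ A' = φ ⁻¹' A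

/-- The additive Borel classes `Σ⁰ξ` : `Σ⁰₁` consists of the open sets, and for `ξ > 1`,
`Σ⁰ξ` consists of countable unions of sets whose complements are in some `Σ⁰η`, `η < ξ`. -/
inductive SigmaOrd {W : Type*} [TopologicalSpace W] : Ordinal.{0} → Set W → Prop
  | basic (s : Set W) : IsOpen s → SigmaOrd 1 s
  | union (ξ : Ordinal.{0}) (η : ℕ → Ordinal.{0}) (f : ℕ → Set W) (hξ : 1 < ξ)
      (hη : ∀ n, η n < ξ) (h : ∀ n, SigmaOrd (η n) (f n)ᶜ) : SigmaOrd ξ (⋃ n, f n)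

/-- The run produced when player I follows the strategy `σ` and player II plays `β`. -/
def playI (σ : List ℕ → ℕ) (β : ℕ → ℕ) : ℕ → ℕ := fun n =>
  if n % 2 = 0 then σ (List.ofFn fun i : Fin (n / 2) => β i) else β (n / 2)

/-- Player I has a winning strategy in the game `G_A`. -/
def PlayerIWins (A : Set (ℕ → ℕ)) : Prop :=
  ∃ σ : List ℕ → ℕ, ∀ β : ℕ → ℕ, playI σ β ∈ A

/-- The game operator `Game B` applied to `B ⊆ W × ω^ω`. -/
def GameOp {W : Type*} (B : Set (W × (ℕ → ℕ))) : Set W :=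
  {w | PlayerIWins {γ | (w, γ) ∈ B}}

/-- `Game Σ⁰ξ`-hardness. -/
def GameSigmaHard (ξ : Ordinal.{0}) {W : Type*} [TopologicalSpace W] (A : Set W) : Prop :=
  ∀ A' : Set (ℕ → Bool),
    (∃ B : Set ((ℕ → Bool) × (ℕ → ℕ)), SigmaOrd ξ B ∧ A' = GameOp B) →
    ∃ φ : (ℕ → Bool) → W, Continuous φ ∧ A' = φ ⁻¹' A

/-- The Souslin operation `A` applied to a family of sets indexed by finite sequences. -/
def souslinOp {W : Type*} (s : List ℕ → Set W) : Set W :=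
  ⋃ x : ℕ → ℕ, ⋂ n : ℕ, s (List.ofFn fun i : Fin n => x i)

/-- The `C`-sets of a topological space: the smallest (nontrivial) pointclass containing
the open sets and closed under complementation and the Souslin operation `A`. -/
inductive CSet {W : Type*} [TopologicalSpace W] : Set W → Prop
  | of_open (s : Set W) : IsOpen s → CSet s
  | compl (s : Set W) : CSet s → CSet sᶜ
  | souslin (s : List ℕ → Set W) : (∀ l, CSet (s l)) → CSet (souslinOp s)

namespace GapGame

/-- The finite prefix of length `k` of a sequence. -/
def pre {α : Type*} (f : ℕ → α) (k : ℕ) : List α := List.ofFn fun i : Fin k => f i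

section Pre
variable {α β : Type*}

@[simp] theorem length_pre (f : ℕ → α) (k : ℕ) : (pre f k).length = k := by simp [pre]

@[simp] theorem pre_zero (f : ℕ → α) : pre f 0 = [] := by simp [pre]

theorem pre_succ (f : ℕ → α) (k : ℕ) : pre f (k + 1) = pre f k ++ [f k] := by
  rw [pre, List.ofFn_succ_last]; rfl

@[simp] theorem getElem_pre (f : ℕ → α) (k i : ℕ) (h : i < (pre f k).length) :
    (pre f k)[i] = f i := by simp [pre]

theorem getElem?_pre (f : ℕ → α) {k i : ℕ} (h : i < k) : (pre f k)[i]? = some (f i) := by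
  rw [List.getElem?_eq_getElem (by simpa using h)]; simp

theorem pre_eq_iff {f g : ℕ → α} {k : ℕ} : pre f k = pre g k ↔ ∀ i < k, f i = g i := by
  constructor
  · intro h i hi
    have := congrArg (fun l => l[i]?) h
    simpa [getElem?_pre _ hi] using this
  · intro h
    apply List.ext_getElem (by simp)
    intro i h1 h2
    simpa using h i (by simpa using h1)

theorem pre_map (f : ℕ → α) (g : α → β) (k : ℕ) : pre (fun i => g (f i)) k = (pre f k).map g := by
  apply List.ext_getElem (by simp)
  intro i h1 h2
  simp

theorem take_pre (f : ℕ → α) {j k : ℕ} (h : j ≤ k) : (pre f k).take j = pre f j := by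
  apply List.ext_getElem (by simp [h])
  intro i h1 h2
  simp

theorem eq_pre_iff {f : ℕ → α} {s : List α} {k : ℕ} :
    s = pre f k ↔ s.length = k ∧ ∀ (i : ℕ) (h : i < s.length), s[i] = f i := by
  constructor
  · rintro rfl; simp
  · rintro ⟨rfl, h⟩
    apply List.ext_getElem (by simp)
    intro i h1 h2
    simpa using h i h1

/-- The sequence `s` followed by `f`. -/
def app (s : List α) (f : ℕ → α) : ℕ → α := fun i =>
  if h : i < s.length then s[i] else f (i - s.length)

theorem app_lt (s : List α) (f : ℕ → α) {i : ℕ} (h : i < s.length) : app s f i = s[i] := by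
  simp [app, h]

@[simp] theorem app_add (s : List α) (f : ℕ → α) (i : ℕ) : app s f (s.length + i) = f i := by
  simp [app]

theorem app_add' (s : List α) (f : ℕ → α) (i n : ℕ) (h : s.length = n) :
    app s f (n + i) = f i := by
  subst h; simp

theorem pre_app_of_le (s : List α) (f : ℕ → α) {k : ℕ} (h : k ≤ s.length) :
    pre (app s f) k = s.take k := by
  apply List.ext_getElem (by simp [h])
  intro i h1 h2
  simp only [length_pre] at h1
  simp [app_lt s f (h1.trans_le h)]

theorem pre_app_add (s : List α) (f : ℕ → α) (k : ℕ) :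
    pre (app s f) (s.length + k) = s ++ pre f k := by
  induction k with
  | zero => simpa using pre_app_of_le s f le_rfl
  | succ k ih => rw [← add_assoc, pre_succ, ih, pre_succ, app_add, List.append_assoc]

@[simp] theorem pre_app_length (s : List α) (f : ℕ → α) : pre (app s f) s.length = s := by
  simpa using pre_app_add s f 0

theorem app_pre_shift (f : ℕ → α) (k : ℕ) : app (pre f k) (fun i => f (k + i)) = f := by
  funext i
  by_cases h : i < k
  · simp [app, h]
  · simp [app, h, Nat.add_sub_cancel' (not_lt.1 h)]

theorem isOpen_eq_pre [TopologicalSpace α] [DiscreteTopology α] (f : ℕ → α) (k : ℕ) :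
    IsOpen {g : ℕ → α | ∀ i < k, g i = f i} := by
  have : {g : ℕ → α | ∀ i < k, g i = f i} = ⋂ i ∈ Finset.range k, {g | g i = f i} := by
    ext; simp
  rw [this]
  refine isOpen_biInter_finset fun i _ => ?_
  exact (isOpen_discrete {f i}).preimage (f := fun g : ℕ → α => g i) (continuous_apply i)

theorem cyl_mem_nhds [TopologicalSpace α] [DiscreteTopology α] (f : ℕ → α) (k : ℕ) :
    {g : ℕ → α | ∀ i < k, g i = f i} ∈ 𝓝 f :=
  (isOpen_eq_pre f k).mem_nhds (by simp)

theorem continuous_of_pre [TopologicalSpace α] [DiscreteTopology α] [TopologicalSpace β]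
    {F : (ℕ → α) → β} (N : ℕ) (h : ∀ f g : ℕ → α, (∀ i < N, f i = g i) → F f = F g) :
    Continuous F := by
  rw [continuous_iff_continuousAt]
  intro f
  refine ContinuousAt.congr (f := fun _ => F f) continuousAt_const ?_
  filter_upwards [cyl_mem_nhds f N] with g hg using h f g fun i hi => (hg i hi).symm

theorem isClopen_of_pre [TopologicalSpace α] [DiscreteTopology α]
    {P : (ℕ → α) → Prop} (N : ℕ) (h : ∀ f g : ℕ → α, (∀ i < N, f i = g i) → P f → P g) :
    IsClopen {f | P f} := by
  have hc : Continuous P := continuous_of_pre (β := Prop) N (by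
    intro f g hfg
    exact propext ⟨h f g hfg, h g f fun i hi => (hfg i hi).symm⟩)
  constructor
  · have : IsOpen {f | ¬ P f} := by
      rw [isOpen_iff_mem_nhds]
      intro f hf
      filter_upwards [cyl_mem_nhds f N] with g hg hP using hf (h g f hg hP)
    exact ⟨this⟩
  · exact continuous_Prop.1 hc

theorem tendsto_of_pre [TopologicalSpace α] [DiscreteTopology α] {f : ℕ → α}
    {g : ℕ → ℕ → α} (h : ∀ k, pre (g k) k = pre f k) : Tendsto g atTop (𝓝 f) := by
  rw [tendsto_pi_nhds]
  intro i
  refine tendsto_const_nhds.congr' ?_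
  filter_upwards [eventually_gt_atTop i] with k hk
  exact (pre_eq_iff.1 (h k) i hk).symm

theorem mem_of_forall_pre [TopologicalSpace α] [DiscreteTopology α] [TopologicalSpace β]
    [DiscreteTopology β] {F : Set ((ℕ → α) × (ℕ → β))} (hF : IsClosed F) {f : ℕ → α} {g : ℕ → β}
    (h : ∀ k, ∃ p ∈ F, pre p.1 k = pre f k ∧ pre p.2 k = pre g k) : (f, g) ∈ F := by
  choose p hp h1 h2 using h
  refine hF.mem_of_tendsto (b := atTop) (f := p) ?_ (Eventually.of_forall hp)
  exact (tendsto_of_pre (g := fun k => (p k).1) h1).prodMk_nhds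
    (tendsto_of_pre (g := fun k => (p k).2) h2)

end Pre

/-- The run, written as a sequence of pairs, in which player I follows `σ`. -/
def run (σ : List ℕ → ℕ) (β : ℕ → ℕ) : ℕ → ℕ × ℕ := fun i => (σ (pre β i), β i)

/-- The set of parameters at which player I wins the game with rounds coded by pairs. -/
def gameP {X : Type*} (B : Set (X × (ℕ → ℕ × ℕ))) : Set X :=
  {x | ∃ σ : List ℕ → ℕ, ∀ β, (x, run σ β) ∈ B}

/-- Countable unions of closed sets. -/
def IsFsig {X : Type*} [TopologicalSpace X] (B : Set X) : Prop :=
  ∃ f : ℕ → Set X, (∀ n, IsClosed (f n)) ∧ B = ⋃ n, f n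

section Fsig
variable {X Z : Type*} [TopologicalSpace X] [TopologicalSpace Z]

theorem _root_.SigmaOrd.one_le {ξ : Ordinal.{0}} {B : Set X} (h : SigmaOrd ξ B) :
    1 ≤ ξ ∧ (ξ = 1 → IsOpen B) := by
  cases h with
  | basic _ h => exact ⟨le_rfl, fun _ => h⟩
  | union _ η f h1 _ _ => exact ⟨h1.le, fun h => absurd h h1.ne'⟩

theorem isFsig_iff_sigmaOrd {B : Set X} : SigmaOrd 2 B ↔ IsFsig B := by
  constructor
  · generalize hξ : (2 : Ordinal.{0}) = ξ
    intro h
    cases h with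
    | basic _ _ =>
      exfalso
      have h12 : (1 : Ordinal.{0}) < 2 := one_lt_two
      exact h12.ne' hξ
    | union _ η f h1 hη h =>
      refine ⟨f, fun n => ?_, rfl⟩
      have h2 : η n < 2 := hξ ▸ hη n
      have h3 := (h n).one_le
      have : η n < Order.succ 1 := by simpa [one_add_one_eq_two] using h2
      exact ⟨h3.2 (le_antisymm (Order.lt_succ_iff.1 this) h3.1)⟩
  · rintro ⟨f, hf, rfl⟩
    exact SigmaOrd.union 2 (fun _ => 1) f one_lt_two (fun _ => one_lt_two)
      fun n => SigmaOrd.basic _ (hf n).isOpen_compl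

theorem _root_.IsClosed.isFsig {B : Set X} (h : IsClosed B) : IsFsig B :=
  ⟨fun _ => B, fun _ => h, by simp [iUnion_const]⟩

theorem isFsig_iUnion {ι : Type*} [Countable ι] {B : ι → Set X} (h : ∀ i, IsFsig (B i)) :
    IsFsig (⋃ i, B i) := by
  choose f hf hB using h
  rcases isEmpty_or_nonempty ι with he | he
  · simpa using (isClosed_empty (X := X)).isFsig
  obtain ⟨e, he⟩ := exists_surjective_nat (ι × ℕ)
  refine ⟨fun n => f (e n).1 (e n).2, fun n => hf _ _, ?_⟩
  ext x
  simp only [hB, mem_iUnion]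
  constructor
  · rintro ⟨i, j, hx⟩
    obtain ⟨n, hn⟩ := he (i, j)
    exact ⟨n, by simpa [hn] using hx⟩
  · rintro ⟨n, hx⟩
    exact ⟨_, _, hx⟩

theorem IsFsig.inter_isClosed {B C : Set X} (hB : IsFsig B) (hC : IsClosed C) :
    IsFsig (C ∩ B) := by
  obtain ⟨f, hf, rfl⟩ := hB
  exact ⟨fun n => C ∩ f n, fun n => hC.inter (hf n), by rw [inter_iUnion]⟩

theorem IsFsig.union {B C : Set X} (hB : IsFsig B) (hC : IsFsig C) : IsFsig (B ∪ C) := by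
  rw [union_eq_iUnion]
  exact isFsig_iUnion fun b => by cases b <;> assumption

theorem IsFsig.preimage {B : Set Z} (hB : IsFsig B) {g : X → Z} (hg : Continuous g) :
    IsFsig (g ⁻¹' B) := by
  obtain ⟨f, hf, rfl⟩ := hB
  exact ⟨fun n => g ⁻¹' f n, fun n => (hf n).preimage hg, by rw [preimage_iUnion]⟩

theorem _root_.IsOpen.isFsig [PseudoMetrizableSpace X] {B : Set X} (h : IsOpen B) : IsFsig B := by
  let := pseudoMetrizableSpacePseudoMetric X
  obtain ⟨f, hf, -, hU, -⟩ := h.exists_iUnion_isClosed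
  exact ⟨f, hf, hU.symm⟩

end Fsig

/-- Sets arising by the game operator from countable unions of closed sets. -/
def IsGame (A : Set (ℕ → Bool)) : Prop :=
  ∃ B : Set ((ℕ → Bool) × (ℕ → ℕ × ℕ)), IsFsig B ∧ A = gameP B

theorem isGame_iff {A : Set (ℕ → Bool)} :
    IsGame A ↔ ∃ B : Set ((ℕ → Bool) × (ℕ → ℕ)), SigmaOrd 2 B ∧ A = GameOp B := by
  constructor
  · rintro ⟨B, hB, rfl⟩
    refine ⟨(fun p => (p.1, fun i => (p.2 (2 * i), p.2 (2 * i + 1)))) ⁻¹' B,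
      isFsig_iff_sigmaOrd.2 (hB.preimage (by fun_prop)), ?_⟩
    ext x
    have key : ∀ σ β, (fun i => (playI σ β (2 * i), playI σ β (2 * i + 1))) = run σ β := by
      intro σ β
      funext i
      have h1 : 2 * i % 2 = 0 := by omega
      have h2 : (2 * i + 1) % 2 = 1 := by omega
      have h3 : (2 * i) / 2 = i := by omega
      have h4 : (2 * i + 1) / 2 = i := by omega
      simp [playI, run, h1, h2, h3, h4, pre]
    simp only [gameP, GameOp, PlayerIWins, mem_ofPred_eq, mem_preimage, key]
  · rintro ⟨B, hB, rfl⟩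
    refine ⟨(fun p => (p.1, fun n => if n % 2 = 0 then (p.2 (n / 2)).1 else (p.2 (n / 2)).2)) ⁻¹' B,
      (isFsig_iff_sigmaOrd.1 hB).preimage ?_, ?_⟩
    · refine continuous_fst.prodMk (continuous_pi fun n => ?_)
      split_ifs <;> fun_prop
    · ext x
      rfl

/-- The winning condition of the universal game with parameter `x`. -/
def UWin (x : ℕ → Bool) (γ : ℕ → ℕ × ℕ) : Prop :=
  ∃ n : ℕ, ∀ k, x (Encodable.encode (n, pre γ k)) = true

/-- The universal set for the game operator. -/
def univGame : Set (ℕ → Bool) :=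
  {x | ∃ σ : List ℕ → ℕ, ∀ β, UWin x (run σ β)}

section Coding
variable {α β : Type*} [TopologicalSpace α] [DiscreteTopology α] [TopologicalSpace β]
  [DiscreteTopology β]

/-- The box of the prefixes `s`, `t` meets `F`. -/
def Meets (F : Set ((ℕ → α) × (ℕ → β))) (s : List α) (t : List β) : Prop :=
  ∃ p ∈ F, pre p.1 s.length = s ∧ pre p.2 t.length = t

theorem mem_iff_meets {F : Set ((ℕ → α) × (ℕ → β))} (hF : IsClosed F) (f : ℕ → α) (g : ℕ → β) :
    (f, g) ∈ F ↔ ∀ k, Meets F (pre f k) (pre g k) := by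
  constructor
  · intro h k
    exact ⟨(f, g), h, by simp, by simp⟩
  · intro h
    refine mem_of_forall_pre hF fun k => ?_
    obtain ⟨p, hp, h1, h2⟩ := h k
    exact ⟨p, hp, by simpa using h1, by simpa using h2⟩

end Coding

theorem IsGame.exists_continuous {A : Set (ℕ → Bool)} (hA : IsGame A) :
    ∃ θ : (ℕ → Bool) → (ℕ → Bool), Continuous θ ∧ A = θ ⁻¹' univGame := by
  classical
  obtain ⟨B, ⟨f, hf, rfl⟩, rfl⟩ := hA
  let dc : ℕ → Option (ℕ × List (ℕ × ℕ)) := Encodable.decode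
  let θ : (ℕ → Bool) → (ℕ → Bool) := fun x m =>
    match dc m with
    | none => false
    | some (n, t) => decide (Meets (f n) (pre x t.length) t)
  refine ⟨θ, continuous_pi fun m => ?_, ?_⟩
  · rcases h : dc m with _ | ⟨n, t⟩
    · simpa [θ, h] using continuous_const
    · simp only [θ, h]
      refine continuous_of_pre t.length fun x y hxy => ?_
      rw [pre_eq_iff.2 hxy]
  · ext x
    have key : ∀ γ : ℕ → ℕ × ℕ, (x, γ) ∈ ⋃ n, f n ↔ UWin (θ x) γ := by
      intro γ
      simp only [mem_iUnion, UWin]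
      refine exists_congr fun n => ?_
      rw [mem_iff_meets (hf n)]
      refine forall_congr' fun k => ?_
      have : dc (Encodable.encode (n, pre γ k)) = some (n, pre γ k) := Encodable.encodek _
      simp only [θ, this, length_pre, decide_eq_true_eq]
    simp only [gameP, univGame, mem_ofPred_eq, mem_preimage, key]

theorem exists_isGame_not_isGame_compl : ∃ D : Set (ℕ → Bool), IsGame D ∧ ¬ IsGame Dᶜ := by
  classical
  let cd : ℕ → List Bool → List (ℕ × ℕ) → ℕ := fun n s t => Encodable.encode (n, s, t)
  let f : ℕ → Set ((ℕ → Bool) × (ℕ → ℕ × ℕ)) := fun n =>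
    {p | ∀ k, p.1 (cd n (pre p.1 k) (pre p.2 k)) = true}
  have hf : ∀ n, IsClosed (f n) := by
    intro n
    have : f n = ⋂ k, {p | p.1 (cd n (pre p.1 k) (pre p.2 k)) = true} := by
      ext; simp [f]
    rw [this]
    refine isClosed_iInter fun k => ?_
    have hc : Continuous fun p : (ℕ → Bool) × (ℕ → ℕ × ℕ) =>
        p.1 (cd n (pre p.1 k) (pre p.2 k)) := by

      rw [continuous_iff_continuousAt]
      rintro ⟨x, γ⟩
      have hco : ContinuousAt (fun p : (ℕ → Bool) × (ℕ → ℕ × ℕ) =>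
          p.1 (cd n (pre x k) (pre γ k))) (x, γ) := by fun_prop
      refine hco.congr ?_
      have h1 := (continuous_fst (X := ℕ → Bool) (Y := ℕ → ℕ × ℕ)).continuousAt (x := (x, γ))
        |>.preimage_mem_nhds (cyl_mem_nhds x k)
      have h2 := (continuous_snd (X := ℕ → Bool) (Y := ℕ → ℕ × ℕ)).continuousAt (x := (x, γ))
        |>.preimage_mem_nhds (cyl_mem_nhds γ k)
      filter_upwards [h1, h2] with p hp1 hp2
      rw [pre_eq_iff.2 hp1, pre_eq_iff.2 hp2]
    exact isClosed_eq hc continuous_const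
  refine ⟨gameP (⋃ n, f n), ⟨_, ⟨f, hf, rfl⟩, rfl⟩, ?_⟩
  rintro ⟨B, ⟨F, hF, rfl⟩, hE⟩
  let dc : ℕ → Option (ℕ × List Bool × List (ℕ × ℕ)) := Encodable.decode
  let c : ℕ → Bool := fun m =>
    match dc m with
    | none => false
    | some (n, s, t) => decide (Meets (F n) s t)
  have hc : ∀ n s t, c (cd n s t) = true ↔ Meets (F n) s t := by
    intro n s t
    have : dc (cd n s t) = some (n, s, t) := Encodable.encodek _
    simp [c, this]
  have key : c ∈ gameP (⋃ n, f n) ↔ c ∈ gameP (⋃ n, F n) := by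
    simp only [gameP, mem_ofPred_eq, mem_iUnion, f, hc, mem_iff_meets (hF _)]
  rw [← hE] at key
  exact iff_not_self key

/-- Removing the first `n` rounds of a play. -/
def shift {α : Type*} (n : ℕ) (γ : ℕ → α) : ℕ → α := fun i => γ (n + i)

theorem continuous_shift {α : Type*} [TopologicalSpace α] (n : ℕ) :
    Continuous (shift (α := α) n) := by
  unfold shift; fun_prop

theorem run_app (σ : List ℕ → ℕ) (s : List ℕ) (β : ℕ → ℕ) :
    shift s.length (run σ (app s β)) = run (fun l => σ (s ++ l)) β := by
  funext i
  simp [shift, run, pre_app_add]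

theorem run_app' (σ : List ℕ → ℕ) (s : List ℕ) (β : ℕ → ℕ) (n : ℕ) (h : s.length = n) :
    shift n (run σ (app s β)) = run (fun l => σ (s ++ l)) β := by
  subst h; exact run_app σ s β

theorem IsGame.of_isFsig {A : Set (ℕ → Bool)} (h : IsFsig A) : IsGame A := by
  refine ⟨Prod.fst ⁻¹' A, h.preimage continuous_fst, ?_⟩
  ext x
  simp [gameP]

/-- The first coordinate `i` at which `P` holds is `n`. -/
def FirstAt {α : Type*} (P : α → Prop) (γ : ℕ → α) (n : ℕ) : Prop :=
  P (γ n) ∧ ∀ i < n, ¬ P (γ i)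

theorem FirstAt.unique {α : Type*} {P : α → Prop} {γ : ℕ → α} {m n : ℕ} (hm : FirstAt P γ m)
    (hn : FirstAt P γ n) : m = n := by
  rcases lt_trichotomy m n with h | h | h
  · exact absurd hm.1 (hn.2 m h)
  · exact h
  · exact absurd hn.1 (hm.2 n h)

theorem exists_firstAt {α : Type*} {P : α → Prop} {γ : ℕ → α} (h : ∃ n, P (γ n)) :
    ∃ n, FirstAt P γ n := by
  classical
  exact ⟨Nat.find h, Nat.find_spec h, fun i hi => Nat.find_min h hi⟩

theorem isClosed_firstAt {P : ℕ × ℕ → Prop} (pr : ℕ × ℕ → ℕ) (n : ℕ) (s : List ℕ) :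
    IsClosed {p : (ℕ → Bool) × (ℕ → ℕ × ℕ) |
      FirstAt P p.2 n ∧ pre (fun i => pr (p.2 i)) n = s} := by
  have : IsClopen {γ : ℕ → ℕ × ℕ | FirstAt P γ n ∧ pre (fun i => pr (γ i)) n = s} := by
    refine isClopen_of_pre (n + 1) ?_
    rintro f g h ⟨⟨h1, h2⟩, h3⟩
    refine ⟨⟨h n (by omega) ▸ h1, fun i hi => h i (by omega) ▸ h2 i hi⟩, ?_⟩
    rw [← h3, pre_eq_iff]
    intro i hi
    rw [h i (by omega)]
  exact this.1.preimage continuous_snd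

/-- The union over all stages and positions of the tail conditions `B s`. -/
def tailSet (P : ℕ × ℕ → Prop) (pr : ℕ × ℕ → ℕ) (B : List ℕ → Set ((ℕ → Bool) × (ℕ → ℕ × ℕ))) :
    Set ((ℕ → Bool) × (ℕ → ℕ × ℕ)) :=
  {p | ∃ n, FirstAt P p.2 n ∧ (p.1, shift (n + 1) p.2) ∈ B (pre (fun i => pr (p.2 i)) n)}

theorem isFsig_tailSet {P : ℕ × ℕ → Prop} {pr : ℕ × ℕ → ℕ}
    {B : List ℕ → Set ((ℕ → Bool) × (ℕ → ℕ × ℕ))} (hB : ∀ s, IsFsig (B s)) :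
    IsFsig (tailSet P pr B) := by
  have : tailSet P pr B = ⋃ i : ℕ × List ℕ,
      {p : (ℕ → Bool) × (ℕ → ℕ × ℕ) | FirstAt P p.2 i.1 ∧ pre (fun j => pr (p.2 j)) i.1 = i.2} ∩
        (fun p => (p.1, shift (i.1 + 1) p.2)) ⁻¹' B i.2 := by
    ext p
    simp only [tailSet, mem_ofPred_eq, mem_iUnion, mem_inter_iff, mem_preimage, Prod.exists]
    constructor
    · rintro ⟨n, h1, h2⟩
      exact ⟨n, _, ⟨h1, rfl⟩, h2⟩
    · rintro ⟨n, s, ⟨h1, rfl⟩, h2⟩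
      exact ⟨n, h1, h2⟩
  rw [this]
  refine isFsig_iUnion fun i => IsFsig.inter_isClosed ((hB _).preimage ?_) (isClosed_firstAt pr _ _)
  exact continuous_fst.prodMk ((continuous_shift _).comp continuous_snd)

theorem IsGame.souslin {S : List ℕ → Set (ℕ → Bool)} (hS : ∀ l, IsGame (S l)) :
    IsGame (souslinOp S) := by
  classical
  choose B hB hSB using hS
  let P : ℕ × ℕ → Prop := fun p => p.2 ≠ 0
  have hcl : IsClosed {p : (ℕ → Bool) × (ℕ → ℕ × ℕ) | ∀ n, ¬ P (p.2 n)} := by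
    have : {p : (ℕ → Bool) × (ℕ → ℕ × ℕ) | ∀ n, ¬ P (p.2 n)} = ⋂ n, {p | (p.2 n).2 = 0} := by
      ext; simp [P]
    rw [this]
    exact isClosed_iInter fun n => isClosed_eq (by fun_prop) continuous_const
  refine ⟨_, hcl.isFsig.union (isFsig_tailSet (P := P) (pr := Prod.fst) hB), ?_⟩
  ext x
  simp only [souslinOp, mem_iUnion, mem_iInter]
  constructor
  · rintro ⟨z, hz⟩
    have hz' : ∀ n, ∃ σ : List ℕ → ℕ, ∀ β, (x, run σ β) ∈ B (pre z n) := by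
      intro n
      have := hz n
      rw [hSB] at this
      exact this
    choose τ hτ using hz'
    let σ : List ℕ → ℕ := fun l =>
      if h : ∃ n : ℕ, l[n]?.getD 0 ≠ 0 then τ (Nat.find h) (l.drop (Nat.find h + 1)) else z l.length
    refine ⟨σ, fun β => ?_⟩
    by_cases hβ : ∃ n, P (run σ β n)
    · right
      obtain ⟨n, hn⟩ := exists_firstAt hβ
      have hn1 : β n ≠ 0 := hn.1
      have hn2 : ∀ i < n, β i = 0 := fun i hi => not_not.1 (hn.2 i hi)
      refine ⟨n, hn, ?_⟩
      have e1 : pre (fun i => (run σ β i).1) n = pre z n := by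
        rw [pre_eq_iff]
        intro i hi
        have : ¬ ∃ n : ℕ, (pre β i)[n]?.getD 0 ≠ 0 := by
          push Not
          intro k
          by_cases hk : k < i
          · simp [getElem?_pre _ hk, hn2 k (hk.trans hi)]
          · simp [not_lt.1 hk]
        simp [run, σ, this]
      have e2 : shift (n + 1) (run σ β) = run (τ n) (shift (n + 1) β) := by
        funext i
        have hp : pre β (n + 1 + i) = pre β (n + 1) ++ pre (shift (n + 1) β) i := by
          have := pre_app_add (pre β (n + 1)) (shift (n + 1) β) i
          rw [length_pre] at this
          rw [← this]
          exact congrArg (fun f => pre f (n + 1 + i)) (app_pre_shift β (n + 1)).symm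
        have hex : ∃ k : ℕ, (pre β (n + 1 + i))[k]?.getD 0 ≠ 0 :=
          ⟨n, by rw [getElem?_pre _ (by omega)]; simpa using hn1⟩
        have hfind : Nat.find hex = n := by
          rw [Nat.find_eq_iff]
          refine ⟨by rw [getElem?_pre _ (by omega)]; simpa using hn1, fun k hk => ?_⟩
          rw [getElem?_pre _ (by omega)]
          simpa using hn2 k hk
        simp only [shift, run, σ, hex, dif_pos, hfind]
        rw [hp, List.drop_left' (by simp)]
      rw [e1, e2]
      exact hτ n _
    · left
      intro n hn
      exact hβ ⟨n, hn⟩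
  · rintro ⟨σ, hσ⟩
    refine ⟨fun i => σ (List.replicate i 0), fun n => ?_⟩
    change x ∈ S (pre (fun i => σ (List.replicate i 0)) n)
    rw [hSB]
    refine ⟨fun l => σ ((List.replicate n 0 ++ [1]) ++ l), fun β => ?_⟩
    have h0 : ∀ i < n, app (List.replicate n 0 ++ [1]) β i = 0 := by
      intro i hi
      rw [app_lt _ _ (by simp; omega), List.getElem_append_left (by simpa using hi)]
      simp
    have h1 : app (List.replicate n 0 ++ [1]) β n = 1 := by
      rw [app_lt _ _ (by simp), List.getElem_append_right (by simp)]
      simp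
    have hf : FirstAt P (run σ (app (List.replicate n 0 ++ [1]) β)) n := by
      refine ⟨by simp [P, run, h1], fun i hi => by simp [P, run, h0 i hi]⟩
    rcases hσ (app (List.replicate n 0 ++ [1]) β) with h | ⟨k, hk, h⟩
    · exact absurd hf.1 (h n)
    · obtain rfl := hk.unique hf
      rw [run_app' _ _ _ _ (by simp)] at h
      convert h using 2
      rw [pre_eq_iff]
      intro i hi
      simp only [run]
      congr 1
      rw [pre_app_of_le _ _ (by simp; omega), List.take_append_of_le_length (by simp; omega)]
      simp [hi.le]

theorem IsGame.souslin_compl {S : List ℕ → Set (ℕ → Bool)} (hS : ∀ l, IsGame (S l)ᶜ) :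
    IsGame (souslinOp S)ᶜ := by
  classical
  choose B hB hSB using hS
  let P : ℕ × ℕ → Prop := fun p => p.1 ≠ 0
  refine ⟨_, isFsig_tailSet (P := P) (pr := Prod.snd) hB, ?_⟩
  ext x
  simp only [souslinOp, mem_iUnion, mem_iInter, mem_compl_iff, not_exists, not_forall]
  constructor
  · intro hx
    have hx' : ∀ s, ∃ σ : List ℕ → ℕ, x ∉ S s → ∀ β, (x, run σ β) ∈ B s := by
      intro s
      by_cases h : x ∈ S s
      · exact ⟨fun _ => 0, fun h' => absurd h h'⟩
      · have h' : x ∈ (S s)ᶜ := h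
        rw [hSB] at h'
        obtain ⟨σ, hσ⟩ := h'
        exact ⟨σ, fun _ => hσ⟩
    choose τ hτ using hx'
    let Q : List ℕ → ℕ → Prop := fun l n => n ≤ l.length ∧ x ∉ S (l.take n)
    let σ : List ℕ → ℕ := fun l =>
      if h : ∃ n, Q l n then
        if Nat.find h = l.length then 1 else τ (l.take (Nat.find h)) (l.drop (Nat.find h + 1))
      else 0
    refine ⟨σ, fun z => ?_⟩
    obtain ⟨n, hn, hmin⟩ : ∃ n, x ∉ S (pre z n) ∧ ∀ i < n, x ∈ S (pre z i) :=
      ⟨Nat.find (hx z), Nat.find_spec (hx z), fun i hi => not_not.1 (Nat.find_min (hx z) hi)⟩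
    have hno : ∀ i < n, ¬ ∃ k, Q (pre z i) k := by
      rintro i hi ⟨k, hk, hk'⟩
      rw [length_pre] at hk
      rw [take_pre _ hk] at hk'
      exact hk' (hmin k (by omega))
    have hex : ∀ i, n ≤ i → ∃ h : ∃ k, Q (pre z i) k, Nat.find h = n := by
      intro i hi
      have hq : Q (pre z i) n := ⟨by simpa using hi, by rwa [take_pre _ hi]⟩
      refine ⟨⟨n, hq⟩, ?_⟩
      rw [Nat.find_eq_iff]
      refine ⟨hq, fun k hk hk' => ?_⟩
      have := hk'.2
      rw [take_pre _ (by omega)] at this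
      exact this (hmin k hk)
    have hfirst : FirstAt P (run σ z) n := by
      constructor
      · obtain ⟨h, hfn⟩ := hex n le_rfl
        simp [P, run, σ, h, hfn]
      · intro i hi
        simp [P, run, σ, hno i hi]
    refine ⟨n, hfirst, ?_⟩
    have e2 : shift (n + 1) (run σ z) = run (τ (pre z n)) (shift (n + 1) z) := by
      funext i
      have hp : pre z (n + 1 + i) = pre z (n + 1) ++ pre (shift (n + 1) z) i := by
        have := pre_app_add (pre z (n + 1)) (shift (n + 1) z) i
        rw [length_pre] at this
        rw [← this]
        exact congrArg (fun f => pre f (n + 1 + i)) (app_pre_shift z (n + 1)).symm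
      obtain ⟨h, hfn⟩ := hex (n + 1 + i) (by omega)
      have hne : n ≠ n + 1 + i := by omega
      simp only [shift, run, σ, h, dif_pos, hfn, length_pre, hne, if_false]
      rw [take_pre _ (by omega), hp, List.drop_left' (by simp)]
    rw [e2]
    exact hτ _ hn _
  · rintro ⟨σ, hσ⟩ z
    by_contra hcon
    push Not at hcon
    obtain ⟨n, hn, -⟩ := hσ z
    have hx : x ∈ S (pre z n) := hcon n
    have hx' : x ∈ (S (pre z n))ᶜ := by
      rw [hSB]
      refine ⟨fun l => σ (pre z (n + 1) ++ l), fun β => ?_⟩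
      have e : ∀ i ≤ n, run σ (app (pre z (n + 1)) β) i = run σ z i := by
        intro i hi
        simp only [run]
        rw [pre_app_of_le _ _ (by simp; omega), take_pre _ (by omega),
          app_lt _ _ (by simp; omega)]
        simp
      obtain ⟨k, hk, h⟩ := hσ (app (pre z (n + 1)) β)
      have hk' : FirstAt P (run σ (app (pre z (n + 1)) β)) n :=
        ⟨by rw [e n le_rfl]; exact hn.1, fun i hi => by rw [e i hi.le]; exact hn.2 i hi⟩
      obtain rfl := hk.unique hk'
      rw [run_app' _ _ _ _ (by simp)] at h
      convert h using 2
      rw [pre_eq_iff]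
      intro i hi
      have := congrArg Prod.snd (e i hi.le)
      exact this.symm
    exact hx' hx

theorem _root_.CSet.isGame {A : Set (ℕ → Bool)} (h : CSet A) : IsGame A ∧ IsGame Aᶜ := by
  induction h with
  | of_open s hs =>
    exact ⟨.of_isFsig hs.isFsig, .of_isFsig hs.isClosed_compl.isFsig⟩
  | compl s _ ih => exact ⟨ih.2, by rw [compl_compl]; exact ih.1⟩
  | souslin s _ ih => exact ⟨.souslin fun l => (ih l).1, .souslin_compl fun l => (ih l).2⟩

theorem _root_.CSet.preimage {X Z : Type*} [TopologicalSpace X] [TopologicalSpace Z] {A : Set Z}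
    (h : CSet A) {f : X → Z} (hf : Continuous f) : CSet (f ⁻¹' A) := by
  induction h with
  | of_open s hs => exact .of_open _ (hs.preimage hf)
  | compl s _ ih => exact .compl _ ih
  | souslin s _ ih =>
    have : f ⁻¹' souslinOp s = souslinOp fun l => f ⁻¹' s l := by
      simp [souslinOp, preimage_iUnion, preimage_iInter]
    rw [this]
    exact .souslin _ ih

/-- A set to which the universal game set reduces is hard for the game operator and is not a
`C`-set. -/
theorem hard_of_univGame {Z : Type*} [TopologicalSpace Z] {A : Set Z} {φ : (ℕ → Bool) → Z}
    (hφ : Continuous φ) (h : ∀ x, φ x ∈ A ↔ x ∈ univGame) : GameSigmaHard 2 A ∧ ¬ CSet A := by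
  have key : ∀ A', IsGame A' → ∃ ψ : (ℕ → Bool) → Z, Continuous ψ ∧ A' = ψ ⁻¹' A := by
    intro A' hA'
    obtain ⟨θ, hθ, rfl⟩ := hA'.exists_continuous
    refine ⟨φ ∘ θ, hφ.comp hθ, ?_⟩
    ext x
    exact (h _).symm
  refine ⟨fun A' hA' => key A' (isGame_iff.2 hA'), fun hC => ?_⟩
  obtain ⟨D, hD, hD'⟩ := exists_isGame_not_isGame_compl
  obtain ⟨ψ, hψ, rfl⟩ := key D hD
  exact hD' (hC.preimage hψ).isGame.2

/-- A stage of the construction: the horizontal interval `[a, b]` with the heights of its two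
endpoints, the base height `h`, the bits played so far, and the game moves made since the last
restart. -/
structure St where
  (a b ya yb h : ℝ)
  ys : List Bool
  pl : List (ℕ × ℕ)

/-- A move: the gap entered, player II's answer, and a bit of the parameter. -/
abbrev Move := ℕ × ℕ × Bool

namespace St

/-- The number of moves made. -/
def m (S : St) : ℕ := S.ys.length
/-- Half of the height of the box of `S`. -/
noncomputable def rho (S : St) : ℝ := (1 / 2) ^ (S.m + 1)
/-- The abscissa of the accumulation point. -/
noncomputable def p (S : St) : ℝ := S.a + (S.b - S.a) / 3
/-- The abscissas converging to `p`. -/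
noncomputable def r (S : St) (j : ℕ) : ℝ := S.p + (S.b - S.a) / 3 * (1 / 2) ^ j
def apt (S : St) : ℝ × ℝ := (S.a, S.ya)
def bpt (S : St) : ℝ × ℝ := (S.b, S.yb)
noncomputable def ppt (S : St) : ℝ × ℝ := (S.p, S.h)
noncomputable def rpt (S : St) (j : ℕ) : ℝ × ℝ := (S.r j, S.h)
/-- The points put into the space at the stage `S`. -/
def Pts (S : St) : Set (ℝ × ℝ) := {v | v = S.apt ∨ v = S.bpt ∨ v = S.ppt ∨ ∃ j, v = S.rpt j}
/-- The left endpoint of a gap; the gaps `0` and `1` are the leftmost and the rightmost one. -/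
noncomputable def lo (S : St) : ℕ → ℝ × ℝ
  | 0 => S.apt
  | 1 => S.rpt 0
  | j + 2 => S.rpt (j + 1)
/-- The right endpoint of a gap. -/
noncomputable def hi (S : St) : ℕ → ℝ × ℝ
  | 0 => S.ppt
  | 1 => S.bpt
  | j + 2 => S.rpt j
/-- The rectangle containing everything that happens after the stage `S`. -/
def Box (S : St) : Set (ℝ × ℝ) := Icc S.a S.b ×ˢ Icc (S.h - S.rho) (S.h + S.rho)

/-- The stage after the move `(g, b, y)`. -/
noncomputable def move (S : St) (g b : ℕ) (y : Bool) : St where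
  a := (S.lo g).1
  ya := (S.lo g).2
  b := (S.hi g).1
  yb := (S.hi g).2
  h := ((S.lo g).2 + (S.hi g).2) / 2 + if 2 ≤ g then (1 / 2) ^ (S.m + 2) else 0
  ys := S.ys ++ [y]
  pl := if 3 ≤ g then S.pl ++ [(g - 3, b)] else []

/-- The stage after an optional move. -/
noncomputable def step (S : St) : Option Move → St
  | none => S
  | some (g, b, y) => S.move g b y

/-- The invariants of the construction. -/
structure Inv (S : St) : Prop where
  lt : S.a < S.b
  len : S.b - S.a ≤ (1 / 3) ^ S.m
  ha : |S.ya - S.h| ≤ S.rho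
  hb : |S.yb - S.h| ≤ S.rho
  a_nonneg : 0 ≤ S.a
  b_le : S.b ≤ 1
  bot_nonneg : 0 ≤ S.h - S.rho
  top_le : S.h + S.rho ≤ 1

section Geometry
variable {S : St}

theorem rho_pos (S : St) : 0 < S.rho := by unfold rho; positivity

@[simp] theorem m_move (S : St) (g b : ℕ) (y : Bool) : (S.move g b y).m = S.m + 1 := by
  simp [m, move]

theorem rho_move (S : St) (g b : ℕ) (y : Bool) : (S.move g b y).rho = S.rho / 2 := by
  simp only [rho, m_move]; ring

@[simp] theorem apt_move (S : St) (g b : ℕ) (y : Bool) : (S.move g b y).apt = S.lo g := rfl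
@[simp] theorem bpt_move (S : St) (g b : ℕ) (y : Bool) : (S.move g b y).bpt = S.hi g := rfl
@[simp] theorem a_move (S : St) (g b : ℕ) (y : Bool) : (S.move g b y).a = (S.lo g).1 := rfl
@[simp] theorem b_move (S : St) (g b : ℕ) (y : Bool) : (S.move g b y).b = (S.hi g).1 := rfl
@[simp] theorem apt_fst (S : St) : S.apt.1 = S.a := rfl
@[simp] theorem bpt_fst (S : St) : S.bpt.1 = S.b := rfl
@[simp] theorem apt_snd (S : St) : S.apt.2 = S.ya := rfl
@[simp] theorem bpt_snd (S : St) : S.bpt.2 = S.yb := rfl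
@[simp] theorem ppt_fst (S : St) : S.ppt.1 = S.p := rfl
@[simp] theorem ppt_snd (S : St) : S.ppt.2 = S.h := rfl
@[simp] theorem rpt_fst (S : St) (j : ℕ) : (S.rpt j).1 = S.r j := rfl
@[simp] theorem rpt_snd (S : St) (j : ℕ) : (S.rpt j).2 = S.h := rfl

theorem apt_mem (S : St) : S.apt ∈ S.Pts := Or.inl rfl
theorem bpt_mem (S : St) : S.bpt ∈ S.Pts := Or.inr (Or.inl rfl)
theorem ppt_mem (S : St) : S.ppt ∈ S.Pts := Or.inr (Or.inr (Or.inl rfl))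
theorem rpt_mem (S : St) (j : ℕ) : S.rpt j ∈ S.Pts := Or.inr (Or.inr (Or.inr ⟨j, rfl⟩))

theorem lo_mem (S : St) : ∀ g, S.lo g ∈ S.Pts
  | 0 => S.apt_mem
  | 1 => S.rpt_mem 0
  | j + 2 => S.rpt_mem (j + 1)

theorem hi_mem (S : St) : ∀ g, S.hi g ∈ S.Pts
  | 0 => S.ppt_mem
  | 1 => S.bpt_mem
  | j + 2 => S.rpt_mem j

theorem r_zero (S : St) : S.r 0 = S.b - (S.b - S.a) / 3 := by simp [r, p]; ring

theorem Inv.a_lt_p (hS : S.Inv) : S.a < S.p := by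
  have := hS.lt; unfold p; linarith

theorem Inv.p_lt_r (hS : S.Inv) (j : ℕ) : S.p < S.r j := by
  have h1 : 0 < (S.b - S.a) / 3 := by linarith [hS.lt]
  have h2 : 0 < (1 / 2 : ℝ) ^ j := by positivity
  unfold r; nlinarith [mul_pos h1 h2]

theorem Inv.r_lt_r (hS : S.Inv) {i j : ℕ} (h : i < j) : S.r j < S.r i := by
  have h1 : 0 < (S.b - S.a) / 3 := by linarith [hS.lt]
  have h2 : (1 / 2 : ℝ) ^ j < (1 / 2) ^ i :=
    pow_lt_pow_right_of_lt_one₀ (by norm_num) (by norm_num) h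
  unfold r; nlinarith [mul_lt_mul_of_pos_left h2 h1]

theorem Inv.r_le_r (hS : S.Inv) {i j : ℕ} (h : i ≤ j) : S.r j ≤ S.r i := by
  rcases h.lt_or_eq with h | rfl
  · exact (hS.r_lt_r h).le
  · exact le_rfl

theorem Inv.r_lt_b (hS : S.Inv) (j : ℕ) : S.r j < S.b := by
  have h0 := hS.r_le_r (Nat.zero_le j)
  have := r_zero S
  linarith [hS.lt]

theorem r_sub_p (S : St) (j : ℕ) : S.r j - S.p = 2 * (S.r (j + 1) - S.p) := by
  simp only [r, pow_succ]; ring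

theorem tendsto_r (S : St) : Tendsto S.r atTop (𝓝 S.p) := by
  have h := tendsto_pow_atTop_nhds_zero_of_lt_one (r := (1 / 2 : ℝ)) (by norm_num) (by norm_num)
  have h' := (h.const_mul ((S.b - S.a) / 3)).const_add S.p
  rwa [mul_zero, add_zero] at h'

theorem Inv.lo_lt_hi (hS : S.Inv) : ∀ g, (S.lo g).1 < (S.hi g).1
  | 0 => hS.a_lt_p
  | 1 => hS.r_lt_b 0
  | _ + 2 => hS.r_lt_r (Nat.lt_succ_self _)

theorem Inv.mem_Icc (hS : S.Inv) {v : ℝ × ℝ} (hv : v ∈ S.Pts) : v.1 ∈ Icc S.a S.b := by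
  have h1 := hS.lt
  have h2 := hS.a_lt_p
  have h3 := hS.p_lt_r
  have h4 := hS.r_lt_b
  rcases hv with rfl | rfl | rfl | ⟨j, rfl⟩
  · exact ⟨le_rfl, h1.le⟩
  · exact ⟨h1.le, le_rfl⟩
  · exact ⟨h2.le, ((h3 0).trans (h4 0)).le⟩
  · exact ⟨(h2.trans (h3 j)).le, (h4 j).le⟩

theorem Inv.a_le_lo (hS : S.Inv) (g : ℕ) : S.a ≤ (S.lo g).1 := (hS.mem_Icc (S.lo_mem g)).1
theorem Inv.hi_le_b (hS : S.Inv) (g : ℕ) : (S.hi g).1 ≤ S.b := (hS.mem_Icc (S.hi_mem g)).2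

/-- The construction points do not lie inside the gaps. -/
theorem Inv.not_mem_gap (hS : S.Inv) {v : ℝ × ℝ} (hv : v ∈ S.Pts) (g : ℕ)
    (h1 : (S.lo g).1 < v.1) (h2 : v.1 < (S.hi g).1) : False := by
  have h1' := hS.lt
  have h2' := hS.a_lt_p
  have h3 := hS.p_lt_r
  have h4 := hS.r_lt_b
  match g with
  | 0 =>
    simp only [lo, hi, apt_fst, ppt_fst] at h1 h2
    rcases hv with rfl | rfl | rfl | ⟨j, rfl⟩ <;> simp at h1 h2
    · linarith [h3 0, h4 0]
    · linarith [h3 j]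
  | 1 =>
    simp only [lo, hi, bpt_fst, rpt_fst] at h1 h2
    rcases hv with rfl | rfl | rfl | ⟨j, rfl⟩ <;> simp at h1 h2
    · linarith [h3 0, h4 0]
    · linarith [h3 0]
    · linarith [hS.r_le_r (Nat.zero_le j)]
  | i + 2 =>
    simp only [lo, hi, rpt_fst] at h1 h2
    rcases hv with rfl | rfl | rfl | ⟨j, rfl⟩ <;> simp at h1 h2
    · linarith [h3 (i + 1)]
    · linarith [h4 i]
    · linarith [h3 (i + 1)]
    · rcases Nat.lt_or_ge i j with h | h
      · linarith [hS.r_le_r (show i + 1 ≤ j from h)]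
      · linarith [hS.r_le_r h]

theorem Inv.pts_unique (hS : S.Inv) {v v' : ℝ × ℝ} (hv : v ∈ S.Pts) (hv' : v' ∈ S.Pts)
    (h : v.1 = v'.1) : v = v' := by
  have h1' := hS.lt
  have h2' := hS.a_lt_p
  have h3 := hS.p_lt_r
  have h4 := hS.r_lt_b
  rcases hv with rfl | rfl | rfl | ⟨j, rfl⟩ <;> rcases hv' with rfl | rfl | rfl | ⟨i, rfl⟩ <;>
    simp at h
  · rfl
  · linarith
  · linarith
  · linarith [h3 i]
  · linarith
  · rfl
  · linarith [h3 0, h4 0]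
  · linarith [h4 i]
  · linarith
  · linarith [h3 0, h4 0]
  · rfl
  · linarith [h3 i]
  · linarith [h3 j]
  · linarith [h4 j]
  · linarith [h3 j]
  · exact Prod.ext h rfl

theorem exists_gap {x : ℝ} (h1 : S.a ≤ x) (h2 : x ≤ S.b) :
    (∃ v ∈ S.Pts, v.1 = x) ∨ ∃ g, (S.lo g).1 < x ∧ x < (S.hi g).1 := by
  rcases h1.eq_or_lt with rfl | h1
  · exact Or.inl ⟨_, S.apt_mem, rfl⟩
  rcases h2.eq_or_lt with rfl | h2
  · exact Or.inl ⟨_, S.bpt_mem, rfl⟩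
  rcases lt_trichotomy x S.p with h | rfl | h
  · exact Or.inr ⟨0, h1, h⟩
  · exact Or.inl ⟨_, S.ppt_mem, rfl⟩
  rcases lt_trichotomy x (S.r 0) with h' | rfl | h'
  · have hD : 0 < (S.b - S.a) / 3 := by linarith
    have hr0 : S.r 0 = S.p + (S.b - S.a) / 3 := by simp [r]
    obtain ⟨n, hn1, hn2⟩ := exists_nat_pow_near_of_lt_one (x := (x - S.p) / ((S.b - S.a) / 3))
      (y := (1 / 2 : ℝ)) (div_pos (by linarith) hD)
      ((div_le_one hD).2 (by linarith)) (by norm_num) (by norm_num)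
    rw [lt_div_iff₀ hD] at hn1
    rw [div_le_iff₀ hD] at hn2
    have e1 : S.r (n + 1) < x := by simp only [r]; linarith
    have e2 : x ≤ S.r n := by simp only [r]; linarith
    rcases e2.eq_or_lt with rfl | e2
    · exact Or.inl ⟨_, S.rpt_mem n, rfl⟩
    · exact Or.inr ⟨n + 2, e1, e2⟩
  · exact Or.inl ⟨_, S.rpt_mem 0, rfl⟩
  · exact Or.inr ⟨1, h', h2⟩

/-- Distinct gaps are disjoint. -/
theorem Inv.gap_unique (hS : S.Inv) {g g' : ℕ} {x : ℝ} (h1 : (S.lo g).1 < x)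
    (h2 : x < (S.hi g).1) (h1' : (S.lo g').1 ≤ x) (h2' : x ≤ (S.hi g').1) : g = g' := by
  have key : ∀ g g' : ℕ, g < g' → (S.hi g).1 ≤ (S.lo g').1 ∨ (S.hi g').1 ≤ (S.lo g).1 := by
    intro g g' h
    match g, g' with
    | 0, 0 => omega
    | 0, 1 => exact Or.inl (hS.p_lt_r 0).le
    | 0, j + 2 => exact Or.inl (hS.p_lt_r _).le
    | 1, j + 2 => exact Or.inr (hS.r_le_r (Nat.zero_le j))
    | i + 2, j + 2 => exact Or.inr (hS.r_le_r (by omega))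
    | 1, 0 => omega
    | 1, 1 => omega
    | i + 2, 0 => omega
    | i + 2, 1 => omega
  rcases lt_trichotomy g g' with h | h | h
  · rcases key _ _ h with h | h <;> linarith
  · exact h
  · rcases key _ _ h with h | h <;> linarith

theorem Inv.snd_mem (hS : S.Inv) {v : ℝ × ℝ} (hv : v ∈ S.Pts) : |v.2 - S.h| ≤ S.rho := by
  have := (rho_pos S).le
  rcases hv with rfl | rfl | rfl | ⟨j, rfl⟩
  · exact hS.ha
  · exact hS.hb
  · simpa using this
  · simpa using this

theorem Inv.pts_subset_box (hS : S.Inv) : S.Pts ⊆ S.Box := by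
  intro v hv
  have := abs_le.1 (hS.snd_mem hv)
  exact ⟨hS.mem_Icc hv, by linarith, by linarith⟩

theorem h_move_main (S : St) (j b : ℕ) (y : Bool) :
    (S.move (j + 2) b y).h = S.h + S.rho / 2 := by
  simp [move, lo, hi, rho, pow_succ]; ring

theorem Inv.move_height (hS : S.Inv) (g b : ℕ) (y : Bool) :
    |(S.lo g).2 - (S.move g b y).h| ≤ S.rho / 2 ∧ |(S.hi g).2 - (S.move g b y).h| ≤ S.rho / 2 ∧
      |(S.move g b y).h - S.h| ≤ S.rho / 2 := by
  have hp := rho_pos S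
  have ha := abs_le.1 hS.ha
  have hb := abs_le.1 hS.hb
  match g with
  | 0 =>
    simp only [move, lo, hi, abs_le, apt_snd, ppt_snd]
    norm_num
    refine ⟨⟨?_, ?_⟩, ⟨?_, ?_⟩, ?_, ?_⟩ <;> linarith
  | 1 =>
    simp only [move, lo, hi, abs_le, bpt_snd, rpt_snd]
    norm_num
    refine ⟨⟨?_, ?_⟩, ⟨?_, ?_⟩, ?_, ?_⟩ <;> linarith
  | j + 2 =>
    rw [h_move_main]
    simp only [lo, hi, abs_le, rpt_snd]
    refine ⟨⟨?_, ?_⟩, ⟨?_, ?_⟩, ?_, ?_⟩ <;> linarith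

theorem Inv.gap_len (hS : S.Inv) (g : ℕ) : (S.hi g).1 - (S.lo g).1 ≤ (S.b - S.a) / 3 := by
  have hD := hS.lt
  match g with
  | 0 => simp [lo, hi, p]
  | 1 => simp [lo, hi, r_zero]
  | j + 2 =>
    have h2 : (1 / 2 : ℝ) ^ j ≤ 1 := pow_le_one₀ (by norm_num) (by norm_num)
    have h3 : (0 : ℝ) < (1 / 2 : ℝ) ^ j := by positivity
    simp only [lo, hi, r, rpt_fst, pow_succ]
    nlinarith

theorem Inv.move_box (hS : S.Inv) (g b : ℕ) (y : Bool) : (S.move g b y).Box ⊆ S.Box := by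
  rintro v ⟨⟨h1, h2⟩, h3, h4⟩
  have hh := abs_le.1 (hS.move_height g b y).2.2
  rw [rho_move] at h3 h4
  exact ⟨⟨(hS.a_le_lo g).trans h1, h2.trans (hS.hi_le_b g)⟩, by linarith, by linarith⟩

theorem Inv.move (hS : S.Inv) (g b : ℕ) (y : Bool) : (S.move g b y).Inv := by
  have hh := hS.move_height g b y
  have hh' := abs_le.1 hh.2.2
  refine ⟨hS.lo_lt_hi g, ?_, ?_, ?_, hS.a_nonneg.trans (hS.a_le_lo g),
    (hS.hi_le_b g).trans hS.b_le, ?_, ?_⟩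
  · have := hS.gap_len g
    have := hS.len
    rw [m_move, pow_succ, a_move, b_move]
    linarith
  · rw [rho_move]; exact hh.1
  · rw [rho_move]; exact hh.2.1
  · rw [rho_move]; linarith [hS.bot_nonneg]
  · rw [rho_move]; linarith [hS.top_le]

theorem Inv.step (hS : S.Inv) : ∀ o, (S.step o).Inv
  | none => hS
  | some (g, b, y) => hS.move g b y

theorem Inv.step_box (hS : S.Inv) : ∀ o, (S.step o).Box ⊆ S.Box
  | none => subset_rfl
  | some (g, b, y) => hS.move_box g b y

theorem isClosed_box (S : St) : IsClosed S.Box := isClosed_Icc.prod isClosed_Icc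

theorem isCompact_box (S : St) : IsCompact S.Box := isCompact_Icc.prod isCompact_Icc

theorem Inv.dist_box (hS : S.Inv) {v v' : ℝ × ℝ} (h : v ∈ S.Box) (h' : v' ∈ S.Box) :
    dist v v' ≤ (1 / 2) ^ S.m := by
  obtain ⟨⟨h1, h2⟩, h3, h4⟩ := h
  obtain ⟨⟨h1', h2'⟩, h3', h4'⟩ := h'
  have hl := hS.len
  have h13 : (1 / 3 : ℝ) ^ S.m ≤ (1 / 2) ^ S.m :=
    pow_le_pow_left₀ (by norm_num) (by norm_num) _
  have hr : S.rho = (1 / 2) ^ S.m / 2 := by simp only [rho, pow_succ]; ring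
  rw [Prod.dist_eq, Real.dist_eq, Real.dist_eq]
  refine max_le ?_ ?_ <;> rw [abs_le] <;> constructor <;> linarith

theorem isCompact_pts (S : St) : IsCompact S.Pts := by
  have h1 : Tendsto S.rpt atTop (𝓝 S.ppt) := (tendsto_r S).prodMk_nhds tendsto_const_nhds
  have h2 := h1.isCompact_insert_range
  have : S.Pts = {S.apt, S.bpt} ∪ insert S.ppt (range S.rpt) := by
    ext v
    simp only [Pts, mem_ofPred_eq, mem_union, mem_insert_iff, mem_singleton_iff, mem_range,
      or_assoc, eq_comm (a := v)]
  rw [this]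
  exact (Set.toFinite _).isCompact.union h2

theorem countable_pts (S : St) : S.Pts.Countable := by
  have : S.Pts ⊆ {S.apt, S.bpt, S.ppt} ∪ range S.rpt := by
    rintro v (rfl | rfl | rfl | ⟨j, rfl⟩) <;> simp
  exact (((Set.toFinite _).countable).union (countable_range _)).mono this

/-- A construction point of `S` either survives a move or leaves the interval. -/
theorem Inv.pts_step (hS : S.Inv) {v : ℝ × ℝ} (hv : v ∈ S.Pts) :
    ∀ o, v ∈ (S.step o).Pts ∨ v.1 ∉ Icc (S.step o).a (S.step o).b
  | none => Or.inl hv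
  | some (g, b, y) => by
    by_contra! hcon
    obtain ⟨h1, h2, h3⟩ := hcon
    change (S.lo g).1 ≤ v.1 at h2
    change v.1 ≤ (S.hi g).1 at h3
    rcases h2.eq_or_lt with h2 | h2
    · exact h1 (hS.pts_unique (S.lo_mem g) hv h2 ▸ (S.move g b y).apt_mem)
    rcases h3.eq_or_lt with h3 | h3
    · exact h1 (hS.pts_unique (S.hi_mem g) hv h3.symm ▸ (S.move g b y).bpt_mem)
    exact hS.not_mem_gap hv g h2 h3

end Geometry
end St

/-- Decoding of optional moves; `0` means waiting. -/
def dec : ℕ → Option Move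
  | 0 => none
  | n + 1 => some ((Encodable.decode n).getD (0, 0, false))

/-- The code of a move. -/
def enc (mv : Move) : ℕ := Encodable.encode mv + 1

@[simp] theorem dec_zero : dec 0 = none := rfl
@[simp] theorem dec_enc (mv : Move) : dec (enc mv) = some mv := by
  simp only [dec, enc, Encodable.encodek, Option.getD_some]

theorem dec_eq_none {n : ℕ} : dec n = none ↔ n = 0 := by
  cases n <;> simp [dec]

/-- The initial stage. -/
noncomputable def start : St := ⟨0, 1, 0, 0, 1 / 2, [], []⟩

/-- The stage reached after the first `k` letters of `w`. -/
noncomputable def st (w : ℕ → ℕ) : ℕ → St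
  | 0 => start
  | k + 1 => (st w k).step (dec (w k))

theorem start_inv : start.Inv := by
  refine ⟨?_, ?_, ?_, ?_, ?_, ?_, ?_, ?_⟩ <;> norm_num [start, St.rho, St.m, abs_le]

theorem st_inv (w : ℕ → ℕ) : ∀ k, (st w k).Inv
  | 0 => start_inv
  | k + 1 => (st_inv w k).step _

theorem st_congr {w w' : ℕ → ℕ} : ∀ {k : ℕ}, (∀ i < k, w i = w' i) → st w k = st w' k
  | 0, _ => rfl
  | k + 1, h => by
    rw [st, st, st_congr fun i hi => h i (hi.trans k.lt_succ_self), h k k.lt_succ_self]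

theorem st_box_anti (w : ℕ → ℕ) : Antitone fun k => (st w k).Box :=
  antitone_nat_of_succ_le fun k => (st_inv w k).step_box _

theorem st_succ_none {w : ℕ → ℕ} {k : ℕ} (h : dec (w k) = none) : st w (k + 1) = st w k := by
  rw [st, h]; rfl

theorem st_succ_some {w : ℕ → ℕ} {k g b : ℕ} {y : Bool} (h : dec (w k) = some (g, b, y)) :
    st w (k + 1) = (st w k).move g b y := by
  rw [st, h]; rfl

theorem st_waits {w : ℕ → ℕ} {k n : ℕ} (hkn : k ≤ n) (h : ∀ i, k ≤ i → i < n → dec (w i) = none) :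
    st w n = st w k := by
  induction n, hkn using Nat.le_induction with
  | base => rfl
  | succ n hkn ih =>
    rw [st_succ_none (h n hkn n.lt_succ_self), ih fun i h1 h2 => h i h1 (h2.trans n.lt_succ_self)]

theorem st_Icc_subset (w : ℕ → ℕ) {i k : ℕ} (h : i ≤ k) :
    Icc (st w k).a (st w k).b ⊆ Icc (st w i).a (st w i).b := by
  induction k, h using Nat.le_induction with
  | base => exact subset_rfl
  | succ k _ ih =>
    refine subset_trans ?_ ih
    rcases hd : dec (w k) with _ | ⟨g, b, y⟩
    · rw [st_succ_none hd]
    · rw [st_succ_some hd]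
      exact Icc_subset_Icc ((st_inv w k).a_le_lo g) ((st_inv w k).hi_le_b g)

theorem pts_later {w : ℕ → ℕ} {i k : ℕ} (h : i ≤ k) {v : ℝ × ℝ} (hv : v ∈ (st w i).Pts) :
    v ∈ (st w k).Pts ∨ v.1 ∉ Icc (st w k).a (st w k).b := by
  induction k, h using Nat.le_induction with
  | base => exact Or.inl hv
  | succ k _ ih =>
    rcases ih with h | h
    · exact (st_inv w k).pts_step h _
    · exact Or.inr fun h' => h (st_Icc_subset w k.le_succ h')

theorem m_mono (w : ℕ → ℕ) : Monotone fun k => (st w k).m :=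
  monotone_nat_of_le_succ fun k => by
    rcases hd : dec (w k) with _ | ⟨g, b, y⟩
    · rw [st_succ_none hd]
    · rw [st_succ_some hd, St.m_move]; exact Nat.le_succ _

theorem ys_prefix (w : ℕ → ℕ) {i k : ℕ} (h : i ≤ k) : (st w i).ys <+: (st w k).ys := by
  induction k, h using Nat.le_induction with
  | base => exact List.prefix_rfl
  | succ k _ ih =>
    rcases hd : dec (w k) with _ | ⟨g, b, y⟩
    · rwa [st_succ_none hd]
    · rw [st_succ_some hd]; exact ih.trans (List.prefix_append _ _)

/-- The bits of `S` do not contradict that the play of `S` is won with witness `n`. -/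
def St.Ok (S : St) (n : ℕ) : Prop :=
  ∀ t, t <+: S.pl → S.ys[(Encodable.encode (n, t) : ℕ)]? ≠ some false

/-- No restart happens after time `k₀`, and from then on the play is consistent with witness `n`. -/
def GoodAt (k₀ n : ℕ) (w : ℕ → ℕ) : Prop :=
  ∀ k ≥ k₀, (∀ g b y, dec (w k) = some (g, b, y) → 3 ≤ g) ∧ (st w k).Ok n

/-- The play of `w` is eventually won. -/
def Good (w : ℕ → ℕ) : Prop := ∃ k₀ n, GoodAt k₀ n w

/-- The fibre of the space over `w`. -/
def Fib (w : ℕ → ℕ) : Set (ℝ × ℝ) :=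
  {v | (∃ k, v ∈ (st w k).Pts) ∨
    ((∀ k, ∃ i ≥ k, dec (w i) ≠ none) ∧ ¬ Good w ∧ ∀ k, v ∈ (st w k).Box)}

/-- The space, as a subset of the product of the Baire space with the plane. -/
def Y0 : Set ((ℕ → ℕ) × (ℝ × ℝ)) := {q | q.2 ∈ Fib q.1}

theorem m_unbounded {w : ℕ → ℕ} (h : ∀ k, ∃ i ≥ k, dec (w i) ≠ none) :
    ∀ n, ∃ k, n ≤ (st w k).m := by
  intro n
  induction n with
  | zero => exact ⟨0, Nat.zero_le _⟩
  | succ n ih =>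
    obtain ⟨k, hk⟩ := ih
    obtain ⟨i, hi, hd⟩ := h k
    rcases hd' : dec (w i) with _ | ⟨g, b, y⟩
    · exact absurd hd' hd
    · refine ⟨i + 1, ?_⟩
      rw [st_succ_some hd', St.m_move]
      have := m_mono w hi
      simp only at this
      omega

theorem box_unique {w : ℕ → ℕ} (h : ∀ n, ∃ k, n ≤ (st w k).m) {v v' : ℝ × ℝ}
    (hv : ∀ k, v ∈ (st w k).Box) (hv' : ∀ k, v' ∈ (st w k).Box) : v = v' := by
  refine eq_of_forall_dist_le fun ε hε => ?_
  obtain ⟨n, hn⟩ := exists_pow_lt_of_lt_one hε (show (1 / 2 : ℝ) < 1 by norm_num)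
  obtain ⟨k, hk⟩ := h n
  refine ((st_inv w k).dist_box (hv k) (hv' k)).trans (le_trans ?_ hn.le)
  exact pow_le_pow_of_le_one (by norm_num) (by norm_num) hk

theorem box_of_later {w : ℕ → ℕ} {i : ℕ} {v : ℝ × ℝ} (h : ∀ k ≥ i, v ∈ (st w k).Box) (k : ℕ) :
    v ∈ (st w k).Box := by
  rcases le_total i k with h' | h'
  · exact h k h'
  · exact st_box_anti w h' (h i le_rfl)

theorem fib_box {w : ℕ → ℕ} {v : ℝ × ℝ} (hv : v ∈ Fib w) {k : ℕ}
    (hx : v.1 ∈ Icc (st w k).a (st w k).b) : v ∈ (st w k).Box := by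
  rcases hv with ⟨i, hi⟩ | ⟨-, -, h⟩
  · rcases le_total i k with h | h
    · rcases pts_later h hi with h | h
      · exact (st_inv w k).pts_subset_box h
      · exact absurd hx h
    · exact st_box_anti w h ((st_inv w i).pts_subset_box hi)
  · exact h k

theorem fib_unique {w : ℕ → ℕ} {v v' : ℝ × ℝ} (hv : v ∈ Fib w) {k : ℕ}
    (hv' : v' ∈ (st w k).Pts) (hx : v.1 = v'.1) : v = v' := by
  rcases hv with ⟨i, hi⟩ | ⟨h1, -, h2⟩
  · have e1 : v ∈ (st w (max i k)).Pts ∧ v' ∈ (st w (max i k)).Pts := by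
      have hI := pts_later (le_max_left i k) hi
      have hI' := pts_later (le_max_right i k) hv'
      have hor : v ∈ (st w (max i k)).Pts ∨ v' ∈ (st w (max i k)).Pts := by
        rcases le_total i k with h | h
        · rw [max_eq_right h]; exact Or.inr hv'
        · rw [max_eq_left h]; exact Or.inl hi
      rcases hor with h | h
      · exact ⟨h, hI'.resolve_right fun h' => h' (hx ▸ (st_inv w _).mem_Icc h)⟩
      · exact ⟨hI.resolve_right fun h' => h' (hx ▸ (st_inv w _).mem_Icc h), h⟩
    exact (st_inv w _).pts_unique e1.1 e1.2 hx
  · refine box_unique (m_unbounded h1) h2 (box_of_later (i := k) fun i hi => ?_)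
    refine (st_inv w i).pts_subset_box ((pts_later hi hv').resolve_right fun h => h ?_)
    exact hx ▸ (h2 i).1

/-- A point of the space inside a gap is there because the gap was entered later. -/
theorem exists_move_of_gap {w : ℕ → ℕ} {v : ℝ × ℝ} (hv : v ∈ Fib w) {k g : ℕ}
    (h1 : ((st w k).lo g).1 < v.1) (h2 : v.1 < ((st w k).hi g).1) :
    ∃ n ≥ k, (∀ i, k ≤ i → i < n → dec (w i) = none) ∧ ∃ b y, dec (w n) = some (g, b, y) := by
  classical
  have hK := st_inv w k
  have hnot : v ∉ (st w k).Pts := fun h => hK.not_mem_gap h g h1 h2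
  have hIcc : v.1 ∈ Icc (st w k).a (st w k).b :=
    ⟨(hK.a_le_lo g).trans h1.le, h2.le.trans (hK.hi_le_b g)⟩
  have hle : ∀ i ≤ k, v ∉ (st w i).Pts := fun i hi h =>
    (pts_later hi h).elim hnot fun h => h hIcc
  have hex : ∃ n, k ≤ n ∧ dec (w n) ≠ none := by
    by_contra! hcon
    rcases hv with ⟨i, hi⟩ | ⟨h, -, -⟩
    · rcases le_total i k with h | h
      · exact hle i h hi
      · rw [st_waits h fun j hj _ => hcon j hj] at hi
        exact hnot hi
    · obtain ⟨i, hi, hd⟩ := h k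
      exact hd (hcon i hi)
  let n := Nat.find hex
  have hn : k ≤ n ∧ dec (w n) ≠ none := Nat.find_spec hex
  have hw : ∀ i, k ≤ i → i < n → dec (w i) = none := fun i hi hin => by
    have := Nat.find_min hex hin
    push Not at this
    exact this hi
  refine ⟨n, hn.1, hw, ?_⟩
  have hst : st w n = st w k := st_waits hn.1 hw
  rcases hd : dec (w n) with _ | ⟨g', b, y⟩
  · exact absurd hd hn.2
  have hs := st_succ_some hd
  rw [hst] at hs
  have hbox : v ∈ (st w (n + 1)).Box := by
    rcases hv with ⟨i, hi⟩ | ⟨-, -, h⟩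
    · rcases le_or_gt i k with h | h
      · exact absurd hi (hle i h)
      · rcases le_or_gt i n with h' | h'
        · rw [st_waits h.le fun j hj hj' => hw j hj (hj'.trans_le h')] at hi
          exact absurd hi hnot
        · exact st_box_anti w h' ((st_inv w i).pts_subset_box hi)
    · exact h _
  rw [hs] at hbox
  obtain rfl := hK.gap_unique h1 h2 hbox.1.1 hbox.1.2
  exact ⟨b, y, rfl⟩

theorem _root_.IsGδ.polishSpace_coe {X : Type*} [TopologicalSpace X] [PolishSpace X] {s : Set X}
    (hs : IsGδ s) : PolishSpace s := by
  obtain ⟨O, hO, rfl⟩ := isGδ_iff_eq_iInter_nat.1 hs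
  have : ∀ n, PolishSpace (O n) := fun n => (hO n).polishSpace
  let F : (⋂ n, O n : Set X) → ∀ n, O n := fun x n => ⟨x, mem_iInter.1 x.2 n⟩
  have hF : Continuous F := continuous_pi fun n => continuous_subtype_val.subtype_mk _
  have hg : Continuous fun f : ∀ n, O n => (f 0 : X) :=
    continuous_subtype_val.comp (continuous_apply 0)
  have hemb : IsEmbedding F :=
    IsEmbedding.of_comp hF hg (by exact IsEmbedding.subtypeVal)
  have hr : range F = ⋂ n, {f | (f n : X) = f 0} := by
    ext f
    simp only [mem_range, mem_iInter, mem_ofPred_eq]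
    constructor
    · rintro ⟨x, rfl⟩ n
      rfl
    · intro h
      refine ⟨⟨f 0, mem_iInter.2 fun n => h n ▸ (f n).2⟩, ?_⟩
      funext n
      exact Subtype.ext (h n).symm
  have hcl : IsClosedEmbedding F := ⟨hemb, by
    rw [hr]
    exact isClosed_iInter fun n =>
      isClosed_eq (continuous_subtype_val.comp (continuous_apply n)) hg⟩
  exact hcl.polishSpace

theorem isClosed_of_pre_fibre {α β : Type*} [TopologicalSpace α] [DiscreteTopology α]
    [TopologicalSpace β] {F : (ℕ → α) → Set β} (N : ℕ) (hF : ∀ w, IsClosed (F w))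
    (h : ∀ f g : ℕ → α, (∀ i < N, f i = g i) → F f = F g) :
    IsClosed {q : (ℕ → α) × β | q.2 ∈ F q.1} := by
  rw [← isOpen_compl_iff, isOpen_iff_mem_nhds]
  rintro ⟨w, v⟩ hq
  have h1 : Prod.fst ⁻¹' {f : ℕ → α | ∀ i < N, f i = w i} ∈ 𝓝 (w, v) :=
    continuous_fst.continuousAt.preimage_mem_nhds (cyl_mem_nhds w N)
  have h2 : Prod.snd ⁻¹' (F w)ᶜ ∈ 𝓝 (w, v) :=
    continuous_snd.continuousAt.preimage_mem_nhds ((hF w).isOpen_compl.mem_nhds hq)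
  filter_upwards [h1, h2] with q hq1 hq2 hq3
  exact hq2 (h _ _ hq1 ▸ hq3)

/-- The sequence `s` followed by waiting forever. -/
def wt (s : List ℕ) : ℕ → ℕ := app s fun _ => 0

theorem wt_ge {s : List ℕ} {i : ℕ} (h : s.length ≤ i) : wt s i = 0 := by
  simp [wt, app, not_lt.2 h]

theorem wt_pre {w : ℕ → ℕ} {k i : ℕ} (h : i < k) : wt (pre w k) i = w i := by
  simp [wt, app, h]

theorem st_wt_pre (w : ℕ → ℕ) {i k : ℕ} (h : i ≤ k) : st (wt (pre w k)) i = st w i :=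
  st_congr fun _ hj => wt_pre (hj.trans_le h)

theorem st_wt_ge {s : List ℕ} {k : ℕ} (h : s.length ≤ k) : st (wt s) k = st (wt s) s.length :=
  st_waits h fun i hi _ => by rw [wt_ge hi]; rfl

/-- If all moves from `k₀` on are main moves, the top of the box is constant. -/
theorem top_eq {w : ℕ → ℕ} {k₀ n : ℕ} (hw : GoodAt k₀ n w) {k : ℕ} (hk : k₀ ≤ k) :
    (st w k).h + (st w k).rho = (st w k₀).h + (st w k₀).rho := by
  induction k, hk using Nat.le_induction with
  | base => rfl
  | succ k hk ih =>
    rcases hd : dec (w k) with _ | ⟨g, b, y⟩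
    · rwa [st_succ_none hd]
    · have hg := (hw k hk).1 g b y hd
      obtain ⟨j, rfl⟩ : ∃ j, g = j + 2 := ⟨g - 2, by omega⟩
      rw [st_succ_some hd, St.h_move_main, St.rho_move, ← ih]
      ring

/-- The points that have to be removed from the limit set because of a won play. -/
def Bad (k₀ n : ℕ) : Set ((ℕ → ℕ) × (ℝ × ℝ)) :=
  {q | GoodAt k₀ n q.1 ∧ q.2.2 = (st q.1 k₀).h + (st q.1 k₀).rho ∧
    q.2.1 ∈ Icc (st q.1 k₀).p ((st q.1 k₀).r 0)}

theorem disjoint_bad (k₀ n : ℕ) : Disjoint Y0 (Bad k₀ n) := by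
  rw [Set.disjoint_left]
  rintro ⟨w, v⟩ hq ⟨hG, htop, hx⟩
  simp only at hG htop hx
  have hI := st_inv w k₀
  rcases hq with ⟨i, hi⟩ | ⟨-, hn, -⟩
  swap
  · exact hn ⟨_, _, hG⟩
  simp only at hi
  have hxI : v.1 ∈ Icc (st w k₀).a (st w k₀).b :=
    ⟨hI.a_lt_p.le.trans hx.1, hx.2.trans (hI.r_lt_b 0).le⟩
  have base : v ∈ (st w k₀).Pts → v.2 < (st w k₀).h + (st w k₀).rho := by
    have hr := St.rho_pos (st w k₀)
    rintro (rfl | rfl | rfl | ⟨j, rfl⟩)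
    · exact absurd hx.1 (not_le.2 hI.a_lt_p)
    · exact absurd hx.2 (not_le.2 (hI.r_lt_b 0))
    · simpa using hr
    · simpa using hr
  have later : ∀ k ≥ k₀, v ∈ (st w k).Pts → v.2 < (st w k).h + (st w k).rho := by
    intro k hk
    induction k, hk using Nat.le_induction with
    | base => exact base
    | succ k hk ih =>
      rcases hd : dec (w k) with _ | ⟨g, b, y⟩
      · rwa [st_succ_none hd]
      · have hg := (hG k hk).1 g b y hd
        obtain ⟨j, rfl⟩ : ∃ j, g = j + 2 := ⟨g - 2, by omega⟩
        rw [st_succ_some hd]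
        have hr := St.rho_pos ((st w k).move (j + 2) b y)
        have hr' := St.rho_pos (st w k)
        rintro (rfl | rfl | rfl | ⟨j, rfl⟩)
        · rw [St.h_move_main, St.rho_move]; simp [St.lo]; linarith
        · rw [St.h_move_main, St.rho_move]; simp [St.hi]; linarith
        · simpa using hr
        · simpa using hr
  rcases le_total i k₀ with h | h
  · exact (base ((pts_later h hi).resolve_right fun h' => h' hxI)).ne htop
  · exact (later i h hi).ne (htop.trans (top_eq hG h).symm)

theorem isClosed_goodAt (k₀ n : ℕ) : IsClosed {w | GoodAt k₀ n w} := by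
  have : {w | GoodAt k₀ n w} = ⋂ k, {w | k ≥ k₀ →
      (∀ g b y, dec (w k) = some (g, b, y) → 3 ≤ g) ∧ (st w k).Ok n} := by
    ext; simp [GoodAt]
  rw [this]
  refine isClosed_iInter fun k => (isClopen_of_pre (k + 1) ?_).1
  intro f g hfg h hk
  rw [← hfg k k.lt_succ_self, ← st_congr fun i hi => hfg i (hi.trans k.lt_succ_self)]
  exact h hk

theorem isClosed_bad (k₀ n : ℕ) : IsClosed (Bad k₀ n) := by
  have : Bad k₀ n = Prod.fst ⁻¹' {w | GoodAt k₀ n w} ∩ {q : (ℕ → ℕ) × (ℝ × ℝ) | q.2 ∈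
      Icc (st q.1 k₀).p ((st q.1 k₀).r 0) ×ˢ {(st q.1 k₀).h + (st q.1 k₀).rho}} := by
    ext q
    simp only [Bad, mem_ofPred_eq, mem_inter_iff, mem_preimage, mem_prod, mem_singleton_iff]
    tauto
  rw [this]
  refine ((isClosed_goodAt k₀ n).preimage continuous_fst).inter
    (isClosed_of_pre_fibre k₀ (F := fun w => Icc (st w k₀).p ((st w k₀).r 0) ×ˢ
      {(st w k₀).h + (st w k₀).rho}) (fun w => isClosed_Icc.prod isClosed_singleton) ?_)
  intro f g h
  simp only [st_congr h]

theorem isClosed_pts_or_box (k : ℕ) : IsClosed {q : (ℕ → ℕ) × (ℝ × ℝ) |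
    q.2 ∈ (⋃ i ∈ Finset.range (k + 1), (st q.1 i).Pts) ∪ (st q.1 k).Box} := by
  refine isClosed_of_pre_fibre (F := fun w =>
    (⋃ i ∈ Finset.range (k + 1), (st w i).Pts) ∪ (st w k).Box) k (fun w => ?_) ?_
  · exact ((Finset.range (k + 1)).finite_toSet.isClosed_biUnion fun i _ =>
      (St.isCompact_pts _).isClosed).union (St.isClosed_box _)
  · intro f g h
    have h1 : ∀ i ∈ Finset.range (k + 1), st f i = st g i := by
      intro i hi
      rw [Finset.mem_range] at hi
      exact st_congr fun j hj => h j (by omega)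
    simp only [h1 k (by simp)]
    congr 1
    exact iUnion₂_congr fun i hi => by rw [h1 i hi]

theorem isGδ_Y0 : IsGδ Y0 := by
  have key : Y0 = ((⋂ k, {q : (ℕ → ℕ) × (ℝ × ℝ) |
      q.2 ∈ (⋃ i ∈ Finset.range (k + 1), (st q.1 i).Pts) ∪ (st q.1 k).Box}) ∩
      ⋂ s : List ℕ, ((Prod.fst ⁻¹' {wt s}ᶜ) ∪
        Prod.snd ⁻¹' ⋃ i ∈ Finset.range (s.length + 1), (st (wt s) i).Pts)) ∩
      ⋂ k : ℕ × ℕ, (Bad k.1 k.2)ᶜ := by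
    ext ⟨w, v⟩
    simp only [mem_inter_iff, mem_iInter, mem_ofPred_eq, mem_union, mem_preimage, mem_compl_iff,
      mem_iUnion, mem_singleton_iff, exists_prop, Finset.mem_range]
    constructor
    · intro hq
      refine ⟨⟨fun k => ?_, fun s => ?_⟩, fun k hk => Set.disjoint_left.1 (disjoint_bad _ _) hq hk⟩
      · rcases hq with ⟨i, hi⟩ | ⟨-, -, h⟩
        · rcases le_total i k with h | h
          · exact Or.inl ⟨i, by omega, hi⟩
          · exact Or.inr (st_box_anti w h ((st_inv w i).pts_subset_box hi))
        · exact Or.inr (h k)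
      · by_cases hw : w = wt s
        · right
          subst hw
          rcases hq with ⟨i, hi⟩ | ⟨h, -, -⟩
          · rcases le_total i s.length with h | h
            · exact ⟨i, by omega, hi⟩
            · exact ⟨s.length, by omega, st_wt_ge h ▸ hi⟩
          · obtain ⟨i, hi, hd⟩ := h s.length
            exact absurd (by simp only [wt_ge hi, dec_zero]) hd
        · exact Or.inl hw
    · rintro ⟨⟨h1, h2⟩, h3⟩
      by_cases hP : ∃ i, v ∈ (st w i).Pts
      · exact Or.inl hP
      have hbox : ∀ k, v ∈ (st w k).Box := fun k =>
        (h1 k).resolve_left fun ⟨i, _, hi⟩ => hP ⟨i, hi⟩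
      have hinf : ∀ k, ∃ i ≥ k, dec (w i) ≠ none := by
        by_contra! hcon
        obtain ⟨k, hk⟩ := hcon
        have hw : w = wt (pre w k) := by
          funext i
          rcases lt_or_ge i k with h | h
          · rw [wt_pre h]
          · rw [wt_ge (by simpa using h), dec_eq_none.1 (hk i h)]
        rcases h2 (pre w k) with h | ⟨i, -, hi⟩
        · exact h hw
        · exact hP ⟨i, by rwa [← hw] at hi⟩
      refine Or.inr ⟨hinf, ?_, hbox⟩
      rintro ⟨k₀, n, hG⟩
      refine h3 (k₀, n) ⟨hG, ?_, ?_⟩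
      · refine eq_of_forall_dist_le fun ε hε => ?_
        obtain ⟨N, hN⟩ := exists_pow_lt_of_lt_one hε (show (1 / 2 : ℝ) < 1 by norm_num)
        obtain ⟨k, hk⟩ := m_unbounded hinf N
        have hk' : N ≤ (st w (max k k₀)).m := hk.trans (m_mono w (le_max_left _ _))
        have hb := (hbox (max k k₀)).2
        have htop := top_eq hG (le_max_right k k₀)
        have hr : 2 * (st w (max k k₀)).rho ≤ (1 / 2) ^ N := by
          refine le_trans (le_of_eq ?_) (pow_le_pow_of_le_one (by norm_num) (by norm_num) hk')
          simp only [St.rho, pow_succ]; ring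
        rw [Real.dist_eq, abs_le]
        constructor <;> linarith [hb.1, hb.2]
      · classical
        have hex : ∃ i, k₀ ≤ i ∧ dec (w i) ≠ none := hinf k₀
        obtain ⟨h4, h5⟩ := Nat.find_spec hex
        rcases hd : dec (w (Nat.find hex)) with _ | ⟨g, b, y⟩
        · exact absurd hd h5
        have hg := (hG _ h4).1 g b y hd
        obtain ⟨j, rfl⟩ : ∃ j, g = j + 2 := ⟨g - 2, by omega⟩
        have hs := st_succ_some hd
        rw [st_waits h4 fun i hi hin => by
          by_contra hne
          exact Nat.find_min hex hin ⟨hi, hne⟩] at hs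
        have hb := (hbox (Nat.find hex + 1)).1
        rw [hs] at hb
        have hI := st_inv w k₀
        exact ⟨(hI.p_lt_r (j + 1)).le.trans hb.1, hb.2.trans (hI.r_le_r (Nat.zero_le j))⟩
  rw [key]
  refine ((IsGδ.iInter fun k => (isClosed_pts_or_box k).isGδ).inter
    (.iInter fun s => IsGδ.union ?_ ?_)).inter
      (.iInter fun k => (isClosed_bad _ _).isOpen_compl.isGδ)
  · exact (isOpen_compl_singleton.preimage continuous_fst).isGδ
  · exact (IsClosed.preimage continuous_snd ((Finset.finite_toSet _).isClosed_biUnion fun i _ =>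
      (St.isCompact_pts _).isClosed)).isGδ

/-- The bits of `S` are those of the parameter `x`. -/
def St.Cmp (S : St) (x : ℕ → Bool) : Prop := S.ys = pre x S.m

/-- All bits played in `w` are those of `x`. -/
def Compat (x : ℕ → Bool) (w : ℕ → ℕ) : Prop := ∀ k, (st w k).Cmp x

/-- The bits played before the last letter of `s` are those of `x`. -/
def Active (x : ℕ → Bool) (s : List ℕ) : Prop := ∀ k < s.length, (st (wt s) k).Cmp x

theorem cmp_of_le {x : ℕ → Bool} {w : ℕ → ℕ} {i k : ℕ} (h : i ≤ k) (hk : (st w k).Cmp x) :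
    (st w i).Cmp x := by
  have hm := m_mono w h
  have h1 : (st w i).ys = (st w k).ys.take (st w i).m := List.prefix_iff_eq_take.1 (ys_prefix w h)
  have h2 : (st w i).ys = pre x (st w i).m := by
    rw [h1, show (st w k).ys = _ from hk, take_pre _ hm]
  exact h2

theorem cmp_congr {S : St} {x x' : ℕ → Bool} {N : ℕ} (h : ∀ i < N, x i = x' i) (hS : S.Cmp x)
    (hN : S.m ≤ N) : S.Cmp x' := by
  unfold St.Cmp at *
  rw [hS]
  exact pre_eq_iff.2 fun i hi => h i (hi.trans_le (by simpa [hS.symm] using hN))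

/-- A system of finite sets of points, each contained in the corresponding cylinder. -/
structure IsNet (Net : List ℕ → Set Y0) : Prop where
  finite : ∀ s, (Net s).Finite
  pre_eq : ∀ s, ∀ q ∈ Net s, pre q.1.1 s.length = s

/-- The closed set assigned to the parameter `x`. -/
def FF (Net : List ℕ → Set Y0) (x : ℕ → Bool) : Set Y0 :=
  {q | Compat x q.1.1 ∨ ∃ s, Active x s ∧ q ∈ Net s}

section
variable {Net : List ℕ → Set Y0} {x : ℕ → Bool}

theorem IsNet.finite_inter (hN : IsNet Net) {w : ℕ → ℕ} (hw : ¬ Compat x w) :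
    ∃ k, (FF Net x ∩ {q | ∀ i < k, q.1.1 i = w i}).Finite := by
  simp only [Compat, not_forall] at hw
  obtain ⟨k, hk⟩ := hw
  refine ⟨k, ((Finset.range (k + 1)).finite_toSet.biUnion fun i _ =>
    hN.finite (pre w i)).subset ?_⟩
  rintro q ⟨hq | ⟨s, hs, hq⟩, hqw⟩
  · exact absurd (st_congr hqw ▸ hq k) hk
  · have hpre := hN.pre_eq s q hq
    rcases le_or_gt s.length k with h | h
    · refine mem_iUnion₂.2 ⟨s.length, by simpa using Nat.lt_succ_of_le h, ?_⟩
      rwa [← pre_eq_iff.2 fun i hi => hqw i (hi.trans_le h), hpre]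
    · have := hs k h
      rw [← hpre, st_wt_pre _ h.le, st_congr hqw] at this
      exact absurd this hk

theorem continuous_word : Continuous fun q : Y0 => q.1.1 :=
  continuous_fst.comp continuous_subtype_val

theorem cyl_mem_nhds_Y0 (q : Y0) (k : ℕ) : {q' : Y0 | ∀ i < k, q'.1.1 i = q.1.1 i} ∈ 𝓝 q :=
  continuous_word.continuousAt.preimage_mem_nhds (cyl_mem_nhds q.1.1 k)

theorem IsNet.isClosed_FF (hN : IsNet Net) : IsClosed (FF Net x) := by
  rw [← isOpen_compl_iff, isOpen_iff_mem_nhds]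
  intro q hq
  obtain ⟨k, hk⟩ := hN.finite_inter (x := x) (w := q.1.1) fun h => hq (Or.inl h)
  filter_upwards [cyl_mem_nhds_Y0 q k, hk.isClosed.isOpen_compl.mem_nhds fun h => hq h.1]
    with q' h1 h2 h3
  exact h2 ⟨h3, h1⟩

theorem IsNet.isolated (hN : IsNet Net) {q : Y0} (hq : ¬ Compat x q.1.1) :
    ∀ᶠ q' in 𝓝 q, q' ∈ FF Net x → q' = q := by
  obtain ⟨k, hk⟩ := hN.finite_inter hq
  have hf := hk.subset (sdiff_subset (t := {q}))
  filter_upwards [cyl_mem_nhds_Y0 q k, hf.isClosed.isOpen_compl.mem_nhds fun h => h.2 rfl]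
    with q' h1 h2 h3
  by_contra hne
  exact h2 ⟨⟨h3, h1⟩, hne⟩

section Metric
variable {Z : Type*} [MetricSpace Z]

theorem exists_net [CompactSpace Z] (e : Y0 → Z) : ∃ Net : List ℕ → Set Y0, IsNet Net ∧
    ∀ s (q : Y0), pre q.1.1 s.length = s →
      ∃ q' ∈ Net s, dist (e q) (e q') ≤ (1 / 2) ^ (st (wt s) s.length).m := by
  have key : ∀ s : List ℕ, ∃ t : Set Y0, t.Finite ∧ (∀ q ∈ t, pre q.1.1 s.length = s) ∧
      ∀ (q : Y0), pre q.1.1 s.length = s →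
      ∃ q' ∈ t, dist (e q) (e q') ≤ (1 / 2) ^ (st (wt s) s.length).m := by
    intro s
    let A : Set Y0 := {q | pre q.1.1 s.length = s}
    have htb : TotallyBounded (e '' A) :=
      (isCompact_univ (X := Z)).totallyBounded.subset (subset_univ _)
    have hpos : (0 : ℝ) < (1 / 2) ^ (st (wt s) s.length).m := by positivity
    obtain ⟨t, htA, htf, ht⟩ := htb.exists_subset (Metric.dist_mem_uniformity hpos)
    obtain ⟨t', ht'A, ht'f, rfl⟩ := htf.exists_subset_finite_image_eq htA
    refine ⟨t', ht'f, fun q hq => ht'A hq, fun q hq => ?_⟩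
    obtain ⟨z, ⟨q', hq', rfl⟩, hd⟩ := mem_iUnion₂.1 (ht ⟨q, hq, rfl⟩) |>.imp fun _ h => h.imp
      fun h1 h2 => h2
    exact ⟨q', hq', le_of_lt hd⟩
  choose Net h1 h2 h3 using key
  exact ⟨Net, ⟨h1, h2⟩, h3⟩

theorem FF_close {e : Y0 → Z} (hN : IsNet Net)
    (he : ∀ s (q : Y0), pre q.1.1 s.length = s →
      ∃ q' ∈ Net s, dist (e q) (e q') ≤ (1 / 2) ^ (st (wt s) s.length).m)
    {x' : ℕ → Bool} {N : ℕ} (hx : ∀ i < N, x i = x' i) {q : Y0} (hq : q ∈ FF Net x) :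
    ∃ q' ∈ FF Net x', dist (e q) (e q') ≤ (1 / 2) ^ N := by
  classical
  by_cases hq' : q ∈ FF Net x'
  · exact ⟨q, hq', by rw [dist_self]; positivity⟩
  have hw : ∃ k, ¬ (st q.1.1 k).Cmp x' := by
    by_contra! h
    exact hq' (Or.inl h)
  let k := Nat.find hw
  have hk : ¬ (st q.1.1 k).Cmp x' := Nat.find_spec hw
  have hlt : ∀ i < k, (st q.1.1 i).Cmp x' := fun i hi => not_not.1 (Nat.find_min hw hi)
  have hx' : (st q.1.1 k).Cmp x := by
    rcases hq with hq | ⟨s, hs, hqs⟩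
    · exact hq k
    · have hpre := hN.pre_eq s q hqs
      rcases le_or_gt s.length k with h | h
      · refine absurd (Or.inr ⟨s, fun i hi => ?_, hqs⟩) hq'
        rw [← hpre, st_wt_pre _ hi.le]
        exact hlt i (hi.trans_le h)
      · have := hs k h
        rwa [← hpre, st_wt_pre _ h.le] at this
  have hm : N ≤ (st q.1.1 k).m := by
    by_contra h
    exact hk (cmp_congr hx hx' (not_le.1 h).le)
  obtain ⟨q', hq1, hd⟩ := he (pre q.1.1 k) q (by simp)
  refine ⟨q', Or.inr ⟨_, fun i hi => ?_, hq1⟩, hd.trans ?_⟩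
  · rw [length_pre] at hi
    rw [st_wt_pre _ hi.le]
    exact hlt i hi
  · rw [length_pre, st_wt_pre _ le_rfl]
    exact pow_le_pow_of_le_one (by norm_num) (by norm_num) hm

theorem continuous_FF [CompactSpace Z] {e : Y0 → Z} (hN : IsNet Net)
    (he : ∀ s (q : Y0), pre q.1.1 s.length = s →
      ∃ q' ∈ Net s, dist (e q) (e q') ≤ (1 / 2) ^ (st (wt s) s.length).m) :
    @Continuous _ _ _ (vietoris Z) fun x => closure (e '' FF Net x) := by
  refine continuous_generateFrom_iff.2 ?_
  rintro _ (⟨U, hU, rfl⟩ | ⟨U, hU, rfl⟩)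
  · rw [isOpen_iff_mem_nhds]
    intro x hx
    obtain ⟨δ, hδ, hsub⟩ :=
      (isClosed_closure (s := e '' FF Net x)).isCompact.exists_cthickening_subset_open hU hx
    obtain ⟨N, hN'⟩ := exists_pow_lt_of_lt_one hδ (show (1 / 2 : ℝ) < 1 by norm_num)
    filter_upwards [cyl_mem_nhds x N] with x' hx'
    refine subset_trans ?_ hsub
    refine closure_minimal ?_ Metric.isClosed_cthickening
    rintro _ ⟨q, hq, rfl⟩
    obtain ⟨q', hq', hd⟩ := FF_close hN he hx' hq
    exact Metric.mem_cthickening_of_dist_le _ (e q') _ _ (subset_closure ⟨q', hq', rfl⟩)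
      (hd.trans hN'.le)
  · rw [isOpen_iff_mem_nhds]
    rintro x ⟨z, hz, hzU⟩
    obtain ⟨_, hz', q, hq, rfl⟩ := mem_closure_iff.1 hz U hU hzU
    obtain ⟨δ, hδ, hsub⟩ := Metric.isOpen_iff.1 hU _ hz'
    obtain ⟨N, hN'⟩ := exists_pow_lt_of_lt_one hδ (show (1 / 2 : ℝ) < 1 by norm_num)
    filter_upwards [cyl_mem_nhds x N] with x' hx'
    obtain ⟨q', hq', hd⟩ := FF_close hN he (fun i hi => (hx' i hi).symm) hq
    refine ⟨e q', subset_closure ⟨q', hq', rfl⟩, hsub ?_⟩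
    rw [Metric.mem_ball, dist_comm]
    exact hd.trans_lt hN'

end Metric
end

section Dimension

theorem _root_.DimLE.of_homeomorph {X Z : Type*} [TopologicalSpace X] [TopologicalSpace Z] {n : ℕ}
    (e : X ≃ₜ Z) (h : DimLE X n) : DimLE Z n := by
  intro k U hU hcov
  obtain ⟨V, hV, hVU, hVc, hord⟩ := h k (fun i => e ⁻¹' U i) (fun i => (hU i).preimage e.continuous)
    (by rw [← preimage_iUnion, hcov, preimage_univ])
  refine ⟨fun i => e.symm ⁻¹' V i, fun i => (hV i).preimage e.symm.continuous, fun i z hz => ?_,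
    by rw [← preimage_iUnion, hVc, preimage_univ], fun z => hord (e.symm z)⟩
  have := hVU i hz
  simpa using this

theorem dimLE_zero_of_clopen_basis {X : Type*} [TopologicalSpace X] [SecondCountableTopology X]
    (h : ∀ (x : X) (U : Set X), IsOpen U → x ∈ U → ∃ D, IsClopen D ∧ x ∈ D ∧ D ⊆ U) :
    DimLE X 0 := by
  intro k U hU hcov
  rcases isEmpty_or_nonempty X with hX | hX
  · exact ⟨U, hU, fun _ => subset_rfl, hcov, fun x => (hX.false x).elim⟩
  have hx : ∀ x, ∃ i, x ∈ U i := fun x => mem_iUnion.1 (hcov ▸ mem_univ x)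
  choose ix hix using hx
  choose D hD hxD hDU using fun x => h x (U (ix x)) (hU _) (hix x)
  obtain ⟨s, hs, hsU⟩ := TopologicalSpace.countable_cover_nhds fun x => (hD x).2.mem_nhds (hxD x)
  have hsne : s.Nonempty := by
    by_contra hne
    rw [not_nonempty_iff_eq_empty] at hne
    subst hne
    obtain ⟨x⟩ := hX
    have := hsU.symm ▸ mem_univ x
    simp at this
  obtain ⟨e, rfl⟩ := hs.exists_eq_range hsne
  let E : ℕ → Set X := disjointed fun n => D (e n)
  have hE : ∀ n, IsOpen (E n) := by
    intro n
    simp only [E, disjointed_eq_inter_compl]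
    refine (hD _).2.inter ?_
    exact (Set.finite_lt_nat n).isOpen_biInter fun m _ => (hD (e m)).compl.2
  have hED : ∀ n, E n ⊆ D (e n) := fun n => disjointed_subset _ n
  have hEcov : ⋃ n, E n = univ := by
    rw [iUnion_disjointed, ← hsU]
    simp
  have hEdis : Pairwise (Function.onFun Disjoint E) := disjoint_disjointed _
  refine ⟨fun i => ⋃ n ∈ {n | ix (e n) = i}, E n, fun i => isOpen_biUnion fun n _ => hE n,
    fun i => iUnion₂_subset fun n hn => ?_, ?_, fun x => ?_⟩
  · exact (hED n).trans ((hDU _).trans (by rw [show ix (e n) = i from hn]))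
  · rw [eq_univ_iff_forall]
    intro x
    obtain ⟨n, hn⟩ := mem_iUnion.1 (hEcov ▸ mem_univ x)
    exact mem_iUnion.2 ⟨ix (e n), mem_iUnion₂.2 ⟨n, rfl, hn⟩⟩
  · rw [zero_add, Set.ncard_le_one (Set.toFinite _)]
    intro i hi j hj
    obtain ⟨n, hn, hxn⟩ := mem_iUnion₂.1 hi
    obtain ⟨m, hm, hxm⟩ := mem_iUnion₂.1 hj
    have : n = m := by
      by_contra hne
      exact Set.disjoint_left.1 (hEdis hne) hxn hxm
    subst this
    exact hn.symm.trans hm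

theorem _root_.DimLE.exists_isClopen {X : Type*} [TopologicalSpace X] (h : DimLE X 0) {A B : Set X}
    (hA : IsClosed A) (hB : IsClosed B) (hAB : Disjoint A B) :
    ∃ C, IsClopen C ∧ A ⊆ C ∧ Disjoint C B := by
  obtain ⟨V, hV, hVU, hVc, hord⟩ := h 2 ![Bᶜ, Aᶜ]
    (by intro i; fin_cases i; exacts [hB.isOpen_compl, hA.isOpen_compl])
    (by
      rw [eq_univ_iff_forall]
      intro x
      by_cases hx : x ∈ B
      · exact mem_iUnion.2 ⟨1, fun hxA => Set.disjoint_left.1 hAB hxA hx⟩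
      · exact mem_iUnion.2 ⟨0, hx⟩)
  have hcov : ∀ x, x ∈ V 0 ∨ x ∈ V 1 := by
    intro x
    obtain ⟨i, hi⟩ := mem_iUnion.1 (hVc ▸ mem_univ x)
    fin_cases i
    exacts [Or.inl hi, Or.inr hi]
  have hdis : ∀ x, x ∈ V 0 → x ∉ V 1 := by
    intro x h0 h1
    have hc : ({i | x ∈ V i}).ncard ≤ 1 := hord x
    have := (Set.ncard_le_one (Set.toFinite _)).1 hc 0 h0 1 h1
    simp at this
  have hcompl : (V 0)ᶜ = V 1 := by
    ext x
    exact ⟨fun hx => (hcov x).resolve_left hx, fun hx h0 => hdis x h0 hx⟩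
  refine ⟨V 0, ⟨⟨hcompl ▸ hV 1⟩, hV 0⟩, fun x hx => ?_, ?_⟩
  · exact (hcov x).resolve_right fun h1 => hVU 1 h1 hx
  · rw [Set.disjoint_left]
    exact fun x hx hxB => hVU 0 hx hxB

end Dimension

/-- An increasing chain of finite lists consists of prefixes of a single sequence. -/
theorem exists_limit {α : Type*} [Inhabited α] {l : ℕ → List α}
    (h : ∀ i j, i ≤ j → l i <+: l j) : ∃ f : ℕ → α, ∀ k, l k = pre f (l k).length := by
  classical
  refine ⟨fun i => if hi : ∃ k, i < (l k).length then (l (Nat.find hi))[i]'(Nat.find_spec hi)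
    else default, fun k => eq_pre_iff.2 ⟨rfl, fun i hi => ?_⟩⟩
  have hex : ∃ k, i < (l k).length := ⟨k, hi⟩
  simp only [hex, dif_pos]
  have hp := h _ _ (Nat.find_min' hex hi)
  exact (hp.getElem (Nat.find_spec hex)).symm

theorem dec_none_of_m_eq {w : ℕ → ℕ} {i k : ℕ} (h : (st w i).m = (st w k).m) {j : ℕ} (hij : i ≤ j)
    (hjk : j < k) : dec (w j) = none := by
  rcases hd : dec (w j) with _ | ⟨g, b, y⟩
  · rfl
  · have h1 := m_mono w hij
    have h2 := m_mono w (Nat.succ_le_of_lt hjk)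
    have h3 : (st w (j + 1)).m = (st w j).m + 1 := by rw [st_succ_some hd, St.m_move]
    simp only [Nat.succ_eq_add_one] at h1 h2
    omega

theorem st_eq_of_m_eq {w : ℕ → ℕ} {i k : ℕ} (h : (st w i).m = (st w k).m) : st w i = st w k := by
  rcases le_total i k with hik | hik
  · exact (st_waits hik fun j h1 h2 => dec_none_of_m_eq h h1 h2).symm
  · exact st_waits hik fun j h1 h2 => dec_none_of_m_eq h.symm h1 h2

theorem exists_stage {w : ℕ → ℕ} {M : ℕ} : ∀ {k : ℕ}, M ≤ (st w k).m → ∃ i, (st w i).m = M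
  | 0, h => ⟨0, le_antisymm (Nat.zero_le _) h⟩
  | k + 1, h => by
    rcases h.eq_or_lt with h | h
    · exact ⟨_, h.symm⟩
    · refine exists_stage (k := k) ?_
      rcases hd : dec (w k) with _ | ⟨g, b, y⟩
      · rw [st_succ_none hd] at h; exact h.le
      · rw [st_succ_some hd, St.m_move] at h; exact Nat.lt_succ_iff.1 h

theorem not_mem_Ioo_of_pts {w : ℕ → ℕ} {v : ℝ × ℝ} {i k : ℕ} (hv : v ∈ (st w i).Pts)
    (hm : (st w i).m < (st w k).m) : v.1 ∉ Ioo (st w k).a (st w k).b := by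
  have hik : i ≤ k := by
    by_contra! h
    exact absurd (m_mono w h.le) (not_le.2 hm)
  obtain ⟨j, hij, hjk, hd⟩ : ∃ j, i ≤ j ∧ j < k ∧ dec (w j) ≠ none := by
    by_contra! hcon
    rw [st_waits hik hcon] at hm
    exact lt_irrefl _ hm
  rcases hd' : dec (w j) with _ | ⟨g, b, y⟩
  · exact absurd hd' hd
  rintro ⟨h1, h2⟩
  have hj := st_Icc_subset w (Nat.succ_le_of_lt hjk)
  have hab := (st_inv w k).lt.le
  have ha := (hj (left_mem_Icc.2 hab)).1
  have hb := (hj (right_mem_Icc.2 hab)).2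
  rw [Nat.succ_eq_add_one, st_succ_some hd'] at ha hb
  simp only [St.a_move, St.b_move] at ha hb
  have hI := st_inv w j
  have hp : v ∈ (st w j).Pts := (pts_later hij hv).resolve_right fun h =>
    h ⟨(hI.a_le_lo g).trans (ha.trans h1.le), h2.le.trans (hb.trans (hI.hi_le_b g))⟩
  exact hI.not_mem_gap hp g (ha.trans_lt h1) (h2.trans_le hb)

section Strategy
variable {σ : List ℕ → ℕ} {M : ℕ} {w : ℕ → ℕ} {v : ℝ × ℝ}

/-- The moves of player I recorded in `S` follow the strategy `σ`. -/
def Cons (σ : List ℕ → ℕ) (S : St) : Prop :=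
  ∀ i (h : i < S.pl.length), (S.pl[i]).1 = σ ((S.pl.take i).map Prod.snd)

open Classical in
/-- The gap indicated by the strategy `σ`. -/
noncomputable def tgt (σ : List ℕ → ℕ) (S : St) : ℕ :=
  if Cons σ S then σ (S.pl.map Prod.snd) + 3 else 2

theorem two_le_tgt (σ : List ℕ → ℕ) (S : St) : 2 ≤ tgt σ S := by
  unfold tgt; split_ifs <;> omega

theorem cons_move {S : St} (h : Cons σ S) (b : ℕ) (y : Bool) :
    Cons σ (S.move (σ (S.pl.map Prod.snd) + 3) b y) := by
  intro i hi
  simp only [St.move, show 3 ≤ σ (S.pl.map Prod.snd) + 3 by omega, if_true] at hi ⊢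
  simp only [List.length_append, List.length_singleton] at hi
  rcases Nat.lt_succ_iff_lt_or_eq.1 hi with h' | rfl
  · rw [List.getElem_append_left h', List.take_append_of_le_length h'.le]
    exact h i h'
  · simp

theorem cons_nil {S : St} (h : S.pl = []) : Cons σ S := by
  intro i hi
  simp [h] at hi

/-- All moves before time `k`, made after the first `M` moves, follow the strategy `σ`. -/
def OnTrack (σ : List ℕ → ℕ) (M : ℕ) (w : ℕ → ℕ) (k : ℕ) : Prop :=
  ∀ i < k, M ≤ (st w i).m → ∀ g b y, dec (w i) = some (g, b, y) → g = tgt σ (st w i)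

theorem OnTrack.mono {k k' : ℕ} (h : OnTrack σ M w k') (hk : k ≤ k') : OnTrack σ M w k :=
  fun i hi => h i (hi.trans_le hk)

theorem onTrack_of_m_eq {k : ℕ} (h : (st w k).m = M) : OnTrack σ M w k := by
  intro i hi hm g b y hd
  have : (st w i).m = (st w k).m := le_antisymm (m_mono w hi.le) (h ▸ hm)
  rw [dec_none_of_m_eq this le_rfl hi] at hd
  exact absurd hd (by simp)

theorem onTrack_congr {k : ℕ} {w' : ℕ → ℕ} (hw : ∀ i < k, w' i = w i) (h : OnTrack σ M w k) :
    OnTrack σ M w' k := by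
  intro i hi hm g b y hd
  have hst : st w' i = st w i := st_congr fun j hj => hw j (hj.trans hi)
  rw [hst] at hm ⊢
  rw [hw i hi] at hd
  exact h i hi hm g b y hd

theorem OnTrack.move {k n b : ℕ} {y : Bool} (h : OnTrack σ M w k) (hkn : k ≤ n)
    (hw : ∀ i, k ≤ i → i < n → dec (w i) = none)
    (hd : dec (w n) = some (tgt σ (st w k), b, y)) : OnTrack σ M w (n + 1) := by
  intro i hi hm g b' y' hd'
  rcases lt_or_ge i k with h1 | h1
  · exact h i h1 hm g b' y' hd'
  rcases Nat.lt_succ_iff_lt_or_eq.1 hi with h2 | rfl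
  · rw [hw i h1 h2] at hd'
    exact absurd hd' (by simp)
  · rw [st_waits h1 hw]
    rw [hd] at hd'
    simp only [Option.some.injEq, Prod.mk.injEq] at hd'
    exact hd'.1.symm

/-- The left endpoint of the gap indicated by `σ`. -/
noncomputable def Lt (σ : List ℕ → ℕ) (S : St) : ℝ := (S.lo (tgt σ S)).1
/-- The right endpoint of the gap indicated by `σ`. -/
noncomputable def Rt (σ : List ℕ → ℕ) (S : St) : ℝ := (S.hi (tgt σ S)).1

theorem St.Inv.p_lt_lo {S : St} (hS : S.Inv) {g : ℕ} (hg : 2 ≤ g) : S.p < (S.lo g).1 := by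
  obtain ⟨j, rfl⟩ := Nat.exists_eq_add_of_le' hg
  exact hS.p_lt_r _

theorem St.Inv.hi_le_r {S : St} (hS : S.Inv) {g : ℕ} (hg : 2 ≤ g) : (S.hi g).1 ≤ S.r 0 := by
  obtain ⟨j, rfl⟩ := Nat.exists_eq_add_of_le' hg
  exact hS.r_le_r (Nat.zero_le _)

theorem Lt_lt_Rt (w : ℕ → ℕ) (k : ℕ) : Lt σ (st w k) < Rt σ (st w k) := (st_inv w k).lo_lt_hi _

theorem OnTrack.nested {k k' : ℕ} (hkk : k ≤ k') (hM : M ≤ (st w k).m) (h : OnTrack σ M w k') :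
    Lt σ (st w k) ≤ Lt σ (st w k') ∧ Rt σ (st w k') ≤ Rt σ (st w k) := by
  induction k', hkk using Nat.le_induction with
  | base => exact ⟨le_rfl, le_rfl⟩
  | succ n hkn ih =>
    obtain ⟨h1, h2⟩ := ih (h.mono n.le_succ)
    rcases hd : dec (w n) with _ | ⟨g, b, y⟩
    · rw [st_succ_none hd]; exact ⟨h1, h2⟩
    · have hg := h n n.lt_succ_self (hM.trans (m_mono w hkn)) g b y hd
      have hI := st_inv w (n + 1)
      have ha := hI.a_le_lo (tgt σ (st w (n + 1)))
      have hb := hI.hi_le_b (tgt σ (st w (n + 1)))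
      have e1 : (st w (n + 1)).a = Lt σ (st w n) := by rw [st_succ_some hd, St.a_move, hg]; rfl
      have e2 : (st w (n + 1)).b = Rt σ (st w n) := by rw [st_succ_some hd, St.b_move, hg]; rfl
      exact ⟨h1.trans (e1 ▸ ha), (e2 ▸ hb).trans h2⟩

/-- `v` leaves the gaps indicated by `σ` to the left. -/
def LeftOf (σ : List ℕ → ℕ) (M : ℕ) (w : ℕ → ℕ) (v : ℝ × ℝ) : Prop :=
  ∃ k, M ≤ (st w k).m ∧ OnTrack σ M w k ∧ v.1 ≤ Lt σ (st w k)

/-- `v` leaves the gaps indicated by `σ` to the right. -/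
def RightOf (σ : List ℕ → ℕ) (M : ℕ) (w : ℕ → ℕ) (v : ℝ × ℝ) : Prop :=
  ∃ k, M ≤ (st w k).m ∧ OnTrack σ M w k ∧ Rt σ (st w k) ≤ v.1

theorem RightOf.not_leftOf (h : RightOf σ M w v) : ¬ LeftOf σ M w v := by
  rintro ⟨k, h1, h2, h3⟩
  obtain ⟨k', h1', h2', h3'⟩ := h
  rcases le_total k k' with hk | hk
  · linarith [(h2'.nested hk h1).1, Lt_lt_Rt (σ := σ) w k']
  · linarith [(h2.nested hk h1').2, Lt_lt_Rt (σ := σ) w k]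

theorem eventually_leftOf {q : Y0} (h : LeftOf σ M q.1.1 q.1.2) :
    ∀ᶠ q' : Y0 in 𝓝 q, LeftOf σ M q'.1.1 q'.1.2 := by
  obtain ⟨k, h1, h2, h3⟩ := h
  have hl := Lt_lt_Rt (σ := σ) q.1.1 k
  have hopen : ∀ᶠ q' : Y0 in 𝓝 q, q'.1.2.1 < Lt σ (st q.1.1 k) +
      (Rt σ (st q.1.1 k) - Lt σ (st q.1.1 k)) / 3 :=
    (show Continuous fun q' : Y0 => q'.1.2.1 by fun_prop).continuousAt.eventually_lt
      continuousAt_const (by linarith)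
  filter_upwards [cyl_mem_nhds_Y0 q k, hopen] with q' hq' hlt
  have hst : st q'.1.1 k = st q.1.1 k := st_congr hq'
  have hon : OnTrack σ M q'.1.1 k := onTrack_congr hq' h2
  rcases le_or_gt q'.1.2.1 (Lt σ (st q.1.1 k)) with hle | hgt
  · exact ⟨k, hst ▸ h1, hon, hst ▸ hle⟩
  · rw [← hst] at hlt hgt hl h1
    obtain ⟨n, hn, hw, b, y, hd⟩ := exists_move_of_gap q'.2 (k := k) hgt (by
      change _ < Rt σ (st q'.1.1 k); linarith)
    refine ⟨n + 1, h1.trans (m_mono _ (hn.trans n.le_succ)), hon.move hn hw hd, ?_⟩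
    have hp := (st_inv q'.1.1 (n + 1)).p_lt_lo (two_le_tgt σ (st q'.1.1 (n + 1)))
    have e : st q'.1.1 (n + 1) = (st q'.1.1 k).move (tgt σ (st q'.1.1 k)) b y := by
      rw [st_succ_some hd, st_waits hn hw]
    refine le_trans ?_ hp.le
    rw [e]
    exact hlt.le

theorem eventually_rightOf {q : Y0} (h : RightOf σ M q.1.1 q.1.2) :
    ∀ᶠ q' : Y0 in 𝓝 q, RightOf σ M q'.1.1 q'.1.2 := by
  obtain ⟨k, h1, h2, h3⟩ := h
  have hl := Lt_lt_Rt (σ := σ) q.1.1 k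
  have hopen : ∀ᶠ q' : Y0 in 𝓝 q, Rt σ (st q.1.1 k) -
      (Rt σ (st q.1.1 k) - Lt σ (st q.1.1 k)) / 3 < q'.1.2.1 :=
    continuousAt_const.eventually_lt
      (show Continuous fun q' : Y0 => q'.1.2.1 by fun_prop).continuousAt (by linarith)
  filter_upwards [cyl_mem_nhds_Y0 q k, hopen] with q' hq' hlt
  have hst : st q'.1.1 k = st q.1.1 k := st_congr hq'
  have hon : OnTrack σ M q'.1.1 k := onTrack_congr hq' h2
  rcases le_or_gt (Rt σ (st q.1.1 k)) q'.1.2.1 with hle | hgt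
  · exact ⟨k, hst ▸ h1, hon, hst ▸ hle⟩
  · rw [← hst] at hlt hgt hl h1
    obtain ⟨n, hn, hw, b, y, hd⟩ := exists_move_of_gap q'.2 (k := k) (g := tgt σ (st q'.1.1 k)) (by
      change Lt σ (st q'.1.1 k) < _; linarith) hgt
    refine ⟨n + 1, h1.trans (m_mono _ (hn.trans n.le_succ)), hon.move hn hw hd, ?_⟩
    have hp := (st_inv q'.1.1 (n + 1)).hi_le_r (two_le_tgt σ (st q'.1.1 (n + 1)))
    have e : st q'.1.1 (n + 1) = (st q'.1.1 k).move (tgt σ (st q'.1.1 k)) b y := by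
      rw [st_succ_some hd, st_waits hn hw]
    refine le_trans hp ?_
    rw [e, St.r_zero]
    exact hlt.le

/-- If `σ` wins against everything, a play that follows `σ` forever is good. -/
theorem good_of_onTrack {x : ℕ → Bool} (hσ : ∀ β, UWin x (run σ β)) (hc : Compat x w)
    (hon : ∀ k, OnTrack σ M w k) (hm : ∀ n, ∃ k, n ≤ (st w k).m) : Good w := by
  have hmove : ∀ k, ∃ n ≥ k, (∀ i, k ≤ i → i < n → dec (w i) = none) ∧ dec (w n) ≠ none := by
    intro k
    have hex : ∃ n, k ≤ n ∧ dec (w n) ≠ none := by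
      by_contra! hcon
      obtain ⟨i, hi⟩ := hm ((st w k).m + 1)
      rcases le_total i k with h | h
      · have := m_mono w h
        simp only at this
        omega
      · rw [st_waits h fun j hj _ => hcon j hj] at hi
        omega
    classical
    refine ⟨Nat.find hex, (Nat.find_spec hex).1, fun i h1 h2 => ?_, (Nat.find_spec hex).2⟩
    have := Nat.find_min hex h2
    push Not at this
    exact this h1
  obtain ⟨k₁, hk₁⟩ := hm M
  have hstep : ∀ k ≥ k₁, Cons σ (st w k) → Cons σ (st w (k + 1)) ∧
      (st w k).pl <+: (st w (k + 1)).pl ∧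
      (dec (w k) ≠ none → (st w (k + 1)).pl.length = (st w k).pl.length + 1) ∧
      ∀ g b y, dec (w k) = some (g, b, y) → 3 ≤ g := by
    intro k hk hC
    rcases hd : dec (w k) with _ | ⟨g, b, y⟩
    · rw [st_succ_none hd]
      exact ⟨hC, List.prefix_rfl, fun h => absurd rfl h, by simp⟩
    · have hg := hon (k + 1) k k.lt_succ_self (hk₁.trans (m_mono w hk)) g b y hd
      rw [tgt, if_pos hC] at hg
      subst hg
      rw [st_succ_some hd]
      refine ⟨cons_move hC b y, ?_, fun _ => ?_, ?_⟩
      · simp [St.move]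
      · simp [St.move]
      · intro g b y h
        simp only [Option.some.injEq, Prod.mk.injEq] at h
        omega
  obtain ⟨k₂, hk₂, hC₂⟩ : ∃ k ≥ k₁, Cons σ (st w k) := by
    by_cases hC : Cons σ (st w k₁)
    · exact ⟨k₁, le_rfl, hC⟩
    · obtain ⟨n, hn, hw, hd⟩ := hmove k₁
      rcases hd' : dec (w n) with _ | ⟨g, b, y⟩
      · exact absurd hd' hd
      have hg := hon (n + 1) n n.lt_succ_self (hk₁.trans (m_mono w hn)) g b y hd'
      rw [st_waits hn hw, tgt, if_neg hC] at hg
      subst hg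
      refine ⟨n + 1, hn.trans n.le_succ, cons_nil ?_⟩
      rw [st_succ_some hd']
      simp [St.move]
  have hCall : ∀ i, Cons σ (st w (k₂ + i)) := by
    intro i
    induction i with
    | zero => exact hC₂
    | succ i ih => exact (hstep _ (hk₂.trans (Nat.le_add_right _ _)) ih).1
  have hgo : ∀ i, k₁ ≤ k₂ + i := fun i => hk₂.trans (Nat.le_add_right _ _)
  have hpre : ∀ i j, i ≤ j → (st w (k₂ + i)).pl <+: (st w (k₂ + j)).pl := by
    intro i j hij
    induction j, hij using Nat.le_induction with
    | base => exact List.prefix_rfl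
    | succ j _ ih => exact ih.trans (hstep _ (hgo j) (hCall j)).2.1
  obtain ⟨f, hf⟩ := exists_limit hpre
  have hlen : ∀ n, ∃ i, n ≤ (st w (k₂ + i)).pl.length := by
    intro n
    induction n with
    | zero => exact ⟨0, Nat.zero_le _⟩
    | succ n ih =>
      obtain ⟨i, hi⟩ := ih
      obtain ⟨j, hj, -, hd⟩ := hmove (k₂ + i)
      obtain ⟨j, rfl⟩ := Nat.exists_eq_add_of_le (show k₂ ≤ j by omega)
      refine ⟨j + 1, ?_⟩
      have h1 := (hstep _ (hgo j) (hCall j)).2.2.1 hd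
      have h2 := (hpre i j (by omega)).length_le
      rw [← add_assoc]
      omega
  have hrun : f = run σ fun i => (f i).2 := by
    funext i
    obtain ⟨j, hj⟩ := hlen (i + 1)
    have hi : i < (st w (k₂ + j)).pl.length := hj
    have h1 := hCall j i hi
    have h2 : (st w (k₂ + j)).pl = pre f (st w (k₂ + j)).pl.length := hf j
    have h3 : (st w (k₂ + j)).pl[i] = f i := by
      have := (eq_pre_iff.1 h2).2 i hi
      exact this
    have h4 : (st w (k₂ + j)).pl.take i = pre f i := by
      rw [h2, take_pre]
      exact hi.le
    rw [h3, h4, ← pre_map] at h1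
    exact Prod.ext h1 rfl
  obtain ⟨n, hn⟩ := hσ fun i => (f i).2
  rw [← hrun] at hn
  refine ⟨k₂, n, fun k hk => ?_⟩
  obtain ⟨i, rfl⟩ := Nat.exists_eq_add_of_le hk
  refine ⟨(hstep _ (hgo i) (hCall i)).2.2.2, fun t ht => ?_⟩
  have e : t = pre f t.length := by
    have h1 := List.prefix_iff_eq_take.1 ht
    have h2 : (st w (k₂ + i)).pl = pre f (st w (k₂ + i)).pl.length := hf i
    rw [h2, take_pre _ ht.length_le] at h1
    exact h1
  rw [show (st w (k₂ + i)).ys = _ from hc (k₂ + i)]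
  intro hsome
  have hlt : Encodable.encode (n, t) < (st w (k₂ + i)).m := by
    simpa using (List.getElem?_eq_some_iff.1 hsome).1
  rw [getElem?_pre x hlt, e, hn] at hsome
  simp at hsome

/-- If `σ` is winning, every point eventually leaves the gaps indicated by `σ`. -/
theorem leftOf_or_rightOf {x : ℕ → Bool} (hσ : ∀ β, UWin x (run σ β)) (hc : Compat x w)
    (hv : v ∈ Fib w) {k : ℕ} (hk : (st w k).m = M) : LeftOf σ M w v ∨ RightOf σ M w v := by
  by_contra hcon
  rw [not_or] at hcon
  have hgap : ∀ k, M ≤ (st w k).m → OnTrack σ M w k →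
      Lt σ (st w k) < v.1 ∧ v.1 < Rt σ (st w k) := fun k h1 h2 =>
    ⟨lt_of_not_ge fun h => hcon.1 ⟨k, h1, h2, h⟩, lt_of_not_ge fun h => hcon.2 ⟨k, h1, h2, h⟩⟩
  have hinf : ∀ n, ∃ k' ≥ k, OnTrack σ M w k' ∧ n ≤ (st w k').m := by
    intro n
    induction n with
    | zero => exact ⟨k, le_rfl, onTrack_of_m_eq hk, Nat.zero_le _⟩
    | succ n ih =>
      obtain ⟨k', h1, h2, h3⟩ := ih
      have hM : M ≤ (st w k').m := hk ▸ m_mono w h1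
      obtain ⟨g1, g2⟩ := hgap k' hM h2
      obtain ⟨j, hj, hw, b, y, hd⟩ := exists_move_of_gap hv g1 g2
      refine ⟨j + 1, h1.trans (hj.trans j.le_succ), h2.move hj hw hd, ?_⟩
      rw [st_succ_some hd, St.m_move, st_waits hj hw]
      omega
  have hm : ∀ n, ∃ k, n ≤ (st w k).m := fun n => (hinf n).imp fun _ h => h.2.2
  have hon : ∀ i, OnTrack σ M w i := by
    intro i
    obtain ⟨k', -, h2, h3⟩ := hinf ((st w i).m + 1)
    refine h2.mono ?_
    by_contra! hlt
    have := m_mono w hlt.le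
    simp only at this
    omega
  rcases hv with ⟨i, hi⟩ | ⟨-, hg, -⟩
  · obtain ⟨k', -, -, hk'⟩ := hinf (max M ((st w i).m + 1))
    have h1 := hgap k' ((le_max_left _ _).trans hk') (hon k')
    have hI := st_inv w k'
    exact not_mem_Ioo_of_pts hi ((le_max_right _ _).trans hk')
      ⟨(hI.a_le_lo _).trans_lt h1.1, h1.2.trans_le (hI.hi_le_b _)⟩
  · exact hg (good_of_onTrack hσ hc hon hm)

end Strategy

/-- A quantitative convexity estimate for `f` at the new points of `S`. -/
def Cvx (f : ℝ × ℝ → ℝ) (S : St) : Prop :=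
  ∀ v, (v = S.ppt ∨ ∃ j, v = S.rpt j) → ∀ μ D, μ ≤ D → μ ≤ f S.apt → μ ≤ f S.bpt →
    (D ≤ f S.apt ∨ D ≤ f S.bpt) → (2 * μ + D) / 3 ≤ f v

/-- The functions satisfying the convexity estimate after every move. -/
structure Adm (f : ℝ × ℝ → ℝ) : Prop where
  cont : Continuous f
  cvx : ∀ (S : St), S.Inv → ∀ g b y, Cvx f (S.move g b y)

theorem adm_sub (c : ℝ) : Adm fun v => v.1 - c := by
  refine ⟨by fun_prop, fun S hS g b y => ?_⟩
  have hI := hS.move g b y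
  set T := S.move g b y
  have hl := hI.lt
  rintro v (rfl | ⟨j, rfl⟩) μ D h1 h2 h3 h4 <;>
    simp only [St.apt_fst, St.bpt_fst, St.ppt_fst, St.rpt_fst] at *
  · unfold St.p; rcases h4 with h4 | h4 <;> linarith
  · have := hI.p_lt_r j
    unfold St.p at this; rcases h4 with h4 | h4 <;> linarith

theorem adm_sub' (c : ℝ) : Adm fun v => c - v.1 := by
  refine ⟨by fun_prop, fun S hS g b y => ?_⟩
  have hI := hS.move g b y
  set T := S.move g b y
  have hl := hI.lt
  rintro v (rfl | ⟨j, rfl⟩) μ D h1 h2 h3 h4 <;>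
    simp only [St.apt_fst, St.bpt_fst, St.ppt_fst, St.rpt_fst] at *
  · unfold St.p; rcases h4 with h4 | h4 <;> linarith
  · have := hI.r_le_r (Nat.zero_le j)
    rw [St.r_zero] at this
    rcases h4 with h4 | h4 <;> linarith

theorem adm_snd (c : ℝ) : Adm fun v => v.2 - c := by
  refine ⟨by fun_prop, fun S hS g b y => ?_⟩
  have hh : ((S.lo g).2 + (S.hi g).2) / 2 ≤ (S.move g b y).h := by
    simp only [St.move]
    split_ifs
    · linarith [show (0 : ℝ) ≤ (1 / 2) ^ (S.m + 2) by positivity]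
    · linarith
  rintro v (rfl | ⟨j, rfl⟩) μ D h1 h2 h3 h4 <;>
    simp only [St.apt_move, St.bpt_move, St.ppt_snd, St.rpt_snd] at * <;>
    rcases h4 with h4 | h4 <;> linarith

section
variable {f : ℝ × ℝ → ℝ} {w : ℕ → ℕ} {v : ℝ × ℝ} {k : ℕ}

theorem le_of_mem_fib (hf : Adm f) (hk : Cvx f (st w k)) (hv : v ∈ Fib w)
    (hx : v.1 ∈ Icc (st w k).a (st w k).b) {μ : ℝ} (ha : μ ≤ f (st w k).apt)
    (hb : μ ≤ f (st w k).bpt) : μ ≤ f v := by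
  have key : ∀ i ≥ k, ∀ u ∈ (st w i).Pts, μ ≤ f u := by
    have hC : ∀ S : St, Cvx f S → μ ≤ f S.apt → μ ≤ f S.bpt → ∀ u ∈ S.Pts, μ ≤ f u := by
      rintro S hS ha hb u (rfl | rfl | hu)
      · exact ha
      · exact hb
      · have := hS u hu μ μ le_rfl ha hb (Or.inl ha)
        linarith
    intro i hi
    induction i, hi using Nat.le_induction with
    | base => exact hC _ hk ha hb
    | succ i _ ih =>
      rcases hd : dec (w i) with _ | ⟨g, b, y⟩
      · rwa [st_succ_none hd]
      · rw [st_succ_some hd]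
        exact hC _ (hf.cvx _ (st_inv w i) g b y) (ih _ (St.lo_mem _ g)) (ih _ (St.hi_mem _ g))
  rcases hv with ⟨i, hi⟩ | ⟨h1, -, h2⟩
  · rcases le_total i k with h | h
    · exact key k le_rfl v ((pts_later h hi).resolve_right fun h' => h' hx)
    · exact key i h v hi
  · have hm := m_unbounded h1
    have hlim : Tendsto (fun i => (st w i).apt) atTop (𝓝 v) := by
      rw [Metric.tendsto_atTop]
      intro ε hε
      obtain ⟨n, hn⟩ := exists_pow_lt_of_lt_one hε (show (1 / 2 : ℝ) < 1 by norm_num)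
      obtain ⟨i, hi⟩ := hm n
      refine ⟨i, fun j hj => lt_of_le_of_lt ((st_inv w j).dist_box
        ((st_inv w j).pts_subset_box (St.apt_mem _)) (h2 j)) (lt_of_le_of_lt ?_ hn)⟩
      exact pow_le_pow_of_le_one (by norm_num) (by norm_num) (hi.trans (m_mono w hj))
    refine ge_of_tendsto ((hf.cont.tendsto v).comp hlim) ?_
    filter_upwards [eventually_ge_atTop k] with i hi
    exact key i hi _ (St.apt_mem _)

end

section
variable {σ : List ℕ → ℕ} {M : ℕ} {w : ℕ → ℕ} {v : ℝ × ℝ}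

/-- After exactly `M` moves, `v` lies strictly inside the current interval. -/
def Mid (M : ℕ) (w : ℕ → ℕ) (v : ℝ × ℝ) : Prop :=
  ∃ k, (st w k).m = M ∧ v.1 ∈ Ioo (st w k).a (st w k).b

open Classical in
/-- The retraction of the space onto the points present after `M` moves. -/
noncomputable def kap (σ : List ℕ → ℕ) (M : ℕ) (w : ℕ → ℕ) (v : ℝ × ℝ) : ℝ × ℝ :=
  if h : Mid M w v then
    if LeftOf σ M w v then (st w h.choose).apt else (st w h.choose).bpt
  else v

theorem kap_of_not_mid (h : ¬ Mid M w v) : kap σ M w v = v := dif_neg h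

theorem kap_of_left {k : ℕ} (hk : (st w k).m = M) (hv : v.1 ∈ Ioo (st w k).a (st w k).b)
    (hl : LeftOf σ M w v) : kap σ M w v = (st w k).apt := by
  have h : Mid M w v := ⟨k, hk, hv⟩
  rw [kap, dif_pos h, if_pos hl, st_eq_of_m_eq (h.choose_spec.1.trans hk.symm)]

theorem kap_of_not_left {k : ℕ} (hk : (st w k).m = M) (hv : v.1 ∈ Ioo (st w k).a (st w k).b)
    (hl : ¬ LeftOf σ M w v) : kap σ M w v = (st w k).bpt := by
  have h : Mid M w v := ⟨k, hk, hv⟩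
  rw [kap, dif_pos h, if_neg hl, st_eq_of_m_eq (h.choose_spec.1.trans hk.symm)]

theorem kap_of_lt_p {k : ℕ} (hk : (st w k).m = M) (hv : v.1 ∈ Ioo (st w k).a (st w k).b)
    (hp : v.1 < (st w k).p) : kap σ M w v = (st w k).apt :=
  kap_of_left hk hv ⟨k, hk.ge, onTrack_of_m_eq hk,
    hp.le.trans ((st_inv w k).p_lt_lo (two_le_tgt σ _)).le⟩

theorem kap_of_r_lt {k : ℕ} (hk : (st w k).m = M) (hv : v.1 ∈ Ioo (st w k).a (st w k).b)
    (hp : (st w k).r 0 < v.1) : kap σ M w v = (st w k).bpt :=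
  kap_of_not_left hk hv (RightOf.not_leftOf ⟨k, hk.ge, onTrack_of_m_eq hk,
    ((st_inv w k).hi_le_r (two_le_tgt σ _)).trans hp.le⟩)

theorem not_mid_of_not_mem {k : ℕ} (hk : (st w k).m ≤ M)
    (hv : v.1 ∉ Ioo (st w k).a (st w k).b) : ¬ Mid M w v := by
  rintro ⟨i, hi, h1, h2⟩
  have hsub : Icc (st w i).a (st w i).b ⊆ Icc (st w k).a (st w k).b := by
    rcases le_total k i with h | h
    · exact st_Icc_subset w h
    · have := m_mono w h
      rw [st_eq_of_m_eq (show (st w i).m = (st w k).m from le_antisymm this (hi ▸ hk))]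
  have hab := (st_inv w i).lt.le
  exact hv ⟨(hsub (left_mem_Icc.2 hab)).1.trans_lt h1, h2.trans_le (hsub (right_mem_Icc.2 hab)).2⟩

theorem not_mid_of_pts {k : ℕ} (hk : (st w k).m < M) (hv : v ∈ (st w k).Pts) : ¬ Mid M w v := by
  rintro ⟨i, hi, h⟩
  exact not_mem_Ioo_of_pts hv (hi ▸ hk) h

theorem mem_Ioo_of_mid {k : ℕ} (hk : (st w k).m ≤ M) (h : Mid M w v) :
    v.1 ∈ Ioo (st w k).a (st w k).b := by
  by_contra hn
  exact not_mid_of_not_mem hk hn h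

theorem kap_mem_of_mid (h : Mid M w v) : ∃ k, (st w k).m = M ∧ kap σ M w v ∈ (st w k).Pts ∧
    v.1 ∈ Ioo (st w k).a (st w k).b := by
  obtain ⟨k, hk, hv⟩ := h
  refine ⟨k, hk, ?_, hv⟩
  by_cases hl : LeftOf σ M w v
  · rw [kap_of_left hk hv hl]; exact St.apt_mem _
  · rw [kap_of_not_left hk hv hl]; exact St.bpt_mem _

theorem kap_mem_fib (hv : v ∈ Fib w) : kap σ M w v ∈ Fib w := by
  by_cases h : Mid M w v
  · obtain ⟨k, -, h, -⟩ := kap_mem_of_mid (σ := σ) h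
    exact Or.inl ⟨k, h⟩
  · rwa [kap_of_not_mid h]

theorem dist_kap_le (hv : v ∈ Fib w) : dist (kap σ M w v) v ≤ (1 / 2) ^ M := by
  by_cases h : Mid M w v
  · obtain ⟨k, rfl, h, hx⟩ := kap_mem_of_mid (σ := σ) h
    exact (st_inv w k).dist_box ((st_inv w k).pts_subset_box h) (fib_box hv ⟨hx.1.le, hx.2.le⟩)
  · rw [kap_of_not_mid h, dist_self]; positivity

theorem kap_mem_pts (hv : v ∈ Fib w) : ∃ k, kap σ M w v ∈ (st w k).Pts := by
  by_cases h : Mid M w v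
  · obtain ⟨k, -, h, -⟩ := kap_mem_of_mid (σ := σ) h
    exact ⟨k, h⟩
  · rw [kap_of_not_mid h]
    rcases hv with h' | ⟨h1, h2, h3⟩
    · exact h'
    · obtain ⟨i, hi⟩ := m_unbounded h1 M
      obtain ⟨k, hk⟩ := exists_stage hi
      have hx := (h3 k).1
      have hn : v.1 ∉ Ioo (st w k).a (st w k).b := fun h' => h ⟨k, hk, h'⟩
      rcases hx.1.eq_or_lt with ha | ha
      · exact ⟨k, fib_unique (Or.inr ⟨h1, h2, h3⟩) (St.apt_mem _) ha.symm ▸ St.apt_mem _⟩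
      rcases hx.2.eq_or_lt with hb | hb
      · exact ⟨k, fib_unique (Or.inr ⟨h1, h2, h3⟩) (St.bpt_mem _) hb ▸ St.bpt_mem _⟩
      exact absurd ⟨ha, hb⟩ hn

theorem Adm.le_of_move {f : ℝ × ℝ → ℝ} (hf : Adm f) (hv : v ∈ Fib w) {n g b : ℕ} {y : Bool}
    (hd : dec (w n) = some (g, b, y)) {μ : ℝ} (h1 : ((st w n).lo g).1 < v.1)
    (h2 : v.1 < ((st w n).hi g).1) (hl : μ ≤ f ((st w n).lo g)) (hh : μ ≤ f ((st w n).hi g)) :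
    μ ≤ f v := by
  have hs := st_succ_some hd
  refine le_of_mem_fib (k := n + 1) hf (hs ▸ hf.cvx _ (st_inv w n) g b y) hv ?_ ?_ ?_ <;> rw [hs]
  · exact ⟨h1.le, h2.le⟩
  · exact hl
  · exact hh

/-- If `f` vanishes or is large at the endpoints and is large at the new points of a stage, then
`f` is bounded away from zero at `v`, or vanishes at the retraction of `v`. -/
theorem le_or_kap_eq_zero {f : ℝ × ℝ → ℝ} (hf : Adm f) (hv : v ∈ Fib w) (hM : Mid M w v) :
    ∀ (d k : ℕ) (δ : ℝ), 0 < δ → (st w k).m + d = M →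
      (f (st w k).apt = 0 ∨ δ ≤ f (st w k).apt) → (f (st w k).bpt = 0 ∨ δ ≤ f (st w k).bpt) →
      (∀ u, (u = (st w k).ppt ∨ ∃ j, u = (st w k).rpt j) → δ ≤ f u) →
      δ / 3 ^ d ≤ f v ∨ f (kap σ M w v) = 0 := by
  intro d
  induction d with
  | zero =>
    intro k δ hδ hk ha hb hnew
    have hx : v.1 ∈ Ioo (st w k).a (st w k).b := mem_Ioo_of_mid (by omega) hM
    rw [pow_zero, div_one]
    rcases St.exists_gap hx.1.le hx.2.le with ⟨u, hu, hux⟩ | ⟨g, h1, h2⟩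
    · obtain rfl : v = u := fib_unique hv hu hux.symm
      rcases hu with rfl | rfl | hu
      · exact absurd hx.1 (lt_irrefl _)
      · exact absurd hx.2 (lt_irrefl _)
      · exact Or.inl (hnew _ hu)
    · obtain ⟨n, hn, hw, b, y, hd⟩ := exists_move_of_gap hv h1 h2
      have hst : st w n = st w k := st_waits hn hw
      match g with
      | 0 =>
        rcases ha with ha | ha
        · exact Or.inr (by rw [kap_of_lt_p (by omega) hx h2, ha])
        · exact Or.inl (hf.le_of_move hv hd (hst ▸ h1) (hst ▸ h2) (by rw [hst]; exact ha)
            (by rw [hst]; exact hnew _ (Or.inl rfl)))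
      | 1 =>
        rcases hb with hb | hb
        · exact Or.inr (by rw [kap_of_r_lt (by omega) hx h1, hb])
        · exact Or.inl (hf.le_of_move hv hd (hst ▸ h1) (hst ▸ h2)
            (by rw [hst]; exact hnew _ (Or.inr ⟨_, rfl⟩)) (by rw [hst]; exact hb))
      | j + 2 =>
        exact Or.inl (hf.le_of_move hv hd (hst ▸ h1) (hst ▸ h2)
            (by rw [hst]; exact hnew _ (Or.inr ⟨_, rfl⟩))
            (by rw [hst]; exact hnew _ (Or.inr ⟨_, rfl⟩)))
  | succ d ih =>
    intro k δ hδ hk ha hb hnew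
    have hx : v.1 ∈ Ioo (st w k).a (st w k).b := mem_Ioo_of_mid (by omega) hM
    have hle : δ / 3 ^ (d + 1) ≤ δ := div_le_self hδ.le (one_le_pow₀ (by norm_num))
    have e : δ / 3 ^ (d + 1) = δ / 3 / 3 ^ d := by rw [pow_succ]; field_simp
    rcases St.exists_gap hx.1.le hx.2.le with ⟨u, hu, hux⟩ | ⟨g, h1, h2⟩
    · obtain rfl : v = u := fib_unique hv hu hux.symm
      rcases hu with rfl | rfl | hu
      · exact absurd hx.1 (lt_irrefl _)
      · exact absurd hx.2 (lt_irrefl _)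
      · exact Or.inl (hle.trans (hnew _ hu))
    · obtain ⟨n, hn, hw, b, y, hd⟩ := exists_move_of_gap hv h1 h2
      have hst : st w n = st w k := st_waits hn hw
      have hs := st_succ_some hd
      have hcv := hf.cvx _ (st_inv w n) g b y
      rw [hst] at hs hcv
      have hm : (st w (n + 1)).m + d = M := by rw [hs, St.m_move]; omega
      match g with
      | 0 =>
        have hh : δ ≤ f ((st w k).hi 0) := hnew _ (Or.inl rfl)
        rw [e]
        refine ih (n + 1) (δ / 3) (by linarith) hm ?_ ?_ fun u hu => ?_
        · rw [hs, St.apt_move]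
          exact ha.imp id fun h => by change _ ≤ f (st w k).apt; linarith
        · rw [hs, St.bpt_move]; exact Or.inr (by linarith)
        · rw [hs] at hu
          have hl : 0 ≤ f ((st w k).lo 0) := by
            rcases ha with h | h
            exacts [h.ge, hδ.le.trans h]
          have := hcv u hu 0 δ hδ.le hl (hδ.le.trans hh) (Or.inr hh)
          linarith
      | 1 =>
        have hh : δ ≤ f ((st w k).lo 1) := hnew _ (Or.inr ⟨_, rfl⟩)
        rw [e]
        refine ih (n + 1) (δ / 3) (by linarith) hm ?_ ?_ fun u hu => ?_
        · rw [hs, St.apt_move]; exact Or.inr (by linarith)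
        · rw [hs, St.bpt_move]
          exact hb.imp id fun h => by change _ ≤ f (st w k).bpt; linarith
        · rw [hs] at hu
          have hl : 0 ≤ f ((st w k).hi 1) := by
            rcases hb with h | h
            exacts [h.ge, hδ.le.trans h]
          have := hcv u hu 0 δ hδ.le (hδ.le.trans hh) hl (Or.inl hh)
          linarith
      | j + 2 =>
        exact Or.inl (hle.trans (hf.le_of_move hv hd (hst ▸ h1) (hst ▸ h2)
            (by rw [hst]; exact hnew _ (Or.inr ⟨_, rfl⟩))
            (by rw [hst]; exact hnew _ (Or.inr ⟨_, rfl⟩))))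

/-- The estimate of `le_or_kap_eq_zero` inside a gap. -/
theorem le_or_kap_eq_zero_of_gap {f : ℝ × ℝ → ℝ} (hf : Adm f) (hv : v ∈ Fib w) (hM : Mid M w v)
    {k g : ℕ} {δ : ℝ} (hδ : 0 < δ) (hk : (st w k).m < M) (h1 : ((st w k).lo g).1 < v.1)
    (h2 : v.1 < ((st w k).hi g).1)
    (hl : f ((st w k).lo g) = 0 ∨ δ ≤ f ((st w k).lo g))
    (hh : f ((st w k).hi g) = 0 ∨ δ ≤ f ((st w k).hi g))
    (hnew : ∀ b y u, (u = ((st w k).move g b y).ppt ∨ ∃ j, u = ((st w k).move g b y).rpt j) →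
      δ ≤ f u) :
    δ / 3 ^ M ≤ f v ∨ f (kap σ M w v) = 0 := by
  obtain ⟨n, hn, hw, b, y, hd⟩ := exists_move_of_gap hv h1 h2
  have hs := st_succ_some hd
  rw [st_waits hn hw] at hs
  obtain ⟨d, hd'⟩ := Nat.exists_eq_add_of_le (show (st w k).m + 1 ≤ M from hk)
  refine (le_or_kap_eq_zero (σ := σ) hf hv hM d (n + 1) δ hδ (by rw [hs, St.m_move]; omega)
    ?_ ?_ ?_).imp (fun h => le_trans ?_ h) id
  · rw [hs]; exact hl
  · rw [hs]; exact hh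
  · rw [hs]; exact hnew b y
  · exact div_le_div_of_nonneg_left hδ.le (by positivity)
      (pow_le_pow_right₀ (by norm_num) (by omega))

end

theorem st_Icc_subset_of_m_le {w : ℕ → ℕ} {i k : ℕ} (h : (st w k).m ≤ (st w i).m) :
    Icc (st w i).a (st w i).b ⊆ Icc (st w k).a (st w k).b := by
  rcases le_total k i with hki | hki
  · exact st_Icc_subset w hki
  · rw [st_eq_of_m_eq (le_antisymm (m_mono w hki) h)]

section
variable {σ : List ℕ → ℕ} {M : ℕ} {S : St}

theorem St.Inv.near_lo (hS : S.Inv) (hM : S.m < M) (g : ℕ) :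
    ∃ η > 0, ∀ (w : ℕ → ℕ) (v : ℝ × ℝ) (k : ℕ), st w k = S → v ∈ Fib w → (S.lo g).1 < v.1 →
      v.1 < (S.lo g).1 + η → kap σ M w v = S.lo g ∨ kap σ M w v = v := by
  have hl := hS.lo_lt_hi g
  have h3 : (1 : ℝ) ≤ 3 ^ M := one_le_pow₀ (by norm_num)
  have hη : ((S.hi g).1 - (S.lo g).1) / 3 / 3 ^ M ≤ ((S.hi g).1 - (S.lo g).1) / 3 :=
    div_le_self (by linarith) h3
  refine ⟨((S.hi g).1 - (S.lo g).1) / 3 / 3 ^ M, div_pos (by linarith) (by positivity),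
    fun w v k hk hv h1 h2 => ?_⟩
  by_cases hmid : Mid M w v
  · subst hk
    left
    rcases le_or_kap_eq_zero_of_gap (σ := σ) (adm_sub (((st w k).lo g).1)) hv hmid
      (δ := (((st w k).hi g).1 - ((st w k).lo g).1) / 3) (by linarith) hM h1 (by linarith)
      (Or.inl (sub_self _)) (Or.inr (by linarith)) (fun b y u hu => by
        have := (adm_sub (((st w k).lo g).1)).cvx _ hS g b y u hu 0
          (((st w k).hi g).1 - ((st w k).lo g).1) (by linarith)
          (by simp only [St.apt_move]; linarith) (by simp only [St.bpt_move]; linarith)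
          (Or.inr (by simp only [St.bpt_move]; linarith))
        simp only at this
        linarith) with h | h
    · linarith
    · exact fib_unique (kap_mem_fib hv) (St.lo_mem _ g) (sub_eq_zero.1 h)
  · exact Or.inr (kap_of_not_mid hmid)

theorem St.Inv.near_hi (hS : S.Inv) (hM : S.m < M) (g : ℕ) :
    ∃ η > 0, ∀ (w : ℕ → ℕ) (v : ℝ × ℝ) (k : ℕ), st w k = S → v ∈ Fib w → v.1 < (S.hi g).1 →
      (S.hi g).1 - η < v.1 → kap σ M w v = S.hi g ∨ kap σ M w v = v := by
  have hl := hS.lo_lt_hi g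
  have h3 : (1 : ℝ) ≤ 3 ^ M := one_le_pow₀ (by norm_num)
  have hη : ((S.hi g).1 - (S.lo g).1) / 3 / 3 ^ M ≤ ((S.hi g).1 - (S.lo g).1) / 3 :=
    div_le_self (by linarith) h3
  refine ⟨((S.hi g).1 - (S.lo g).1) / 3 / 3 ^ M, div_pos (by linarith) (by positivity),
    fun w v k hk hv h1 h2 => ?_⟩
  by_cases hmid : Mid M w v
  · subst hk
    left
    rcases le_or_kap_eq_zero_of_gap (σ := σ) (adm_sub' (((st w k).hi g).1)) hv hmid
      (δ := (((st w k).hi g).1 - ((st w k).lo g).1) / 3) (by linarith) hM (by linarith) h1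
      (Or.inr (by linarith)) (Or.inl (sub_self _)) (fun b y u hu => by
        have := (adm_sub' (((st w k).hi g).1)).cvx _ hS g b y u hu 0
          (((st w k).hi g).1 - ((st w k).lo g).1) (by linarith)
          (by simp only [St.apt_move]; linarith) (by simp only [St.bpt_move]; linarith)
          (Or.inl (by simp only [St.apt_move]; linarith))
        simp only at this
        linarith) with h | h
    · linarith
    · exact fib_unique (kap_mem_fib hv) (St.hi_mem _ g) (sub_eq_zero.1 h).symm
  · exact Or.inr (kap_of_not_mid hmid)

theorem St.Inv.near_ppt (hS : S.Inv) (hM : S.m < M) :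
    ∃ η > 0, ∀ (w : ℕ → ℕ) (v : ℝ × ℝ) (k : ℕ), st w k = S → v ∈ Fib w → S.p < v.1 →
      v.1 < S.p + η → v.2 < S.h + η → kap σ M w v = v ∨
        dist (kap σ M w v) S.ppt ≤ 2 * (v.1 - S.p) := by
  have hab := hS.lt
  have hrho := S.rho_pos
  have hr0 := S.r_zero
  refine ⟨min ((S.b - S.a) / 3) (S.rho / 2 / 3 ^ M), lt_min (by linarith) (by positivity),
    fun w v k hk hv h1 h2 h2' => ?_⟩
  by_cases hmid : Mid M w v
  swap
  · exact Or.inl (kap_of_not_mid hmid)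
  subst hk
  have hp : (st w k).p = (st w k).a + ((st w k).b - (st w k).a) / 3 := rfl
  have h3 := min_le_left (((st w k).b - (st w k).a) / 3) ((st w k).rho / 2 / 3 ^ M)
  have h4 := min_le_right (((st w k).b - (st w k).a) / 3) ((st w k).rho / 2 / 3 ^ M)
  rcases St.exists_gap (S := st w k) (x := v.1) (by linarith) (by linarith)
    with ⟨u, hu, hux⟩ | ⟨g, g1, g2⟩
  · obtain rfl : v = u := fib_unique hv hu hux.symm
    exact absurd hmid (not_mid_of_pts hM hu)
  match g with
  | 0 => exact absurd g2 (not_lt.2 h1.le)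
  | 1 =>
    change (st w k).r 0 < v.1 at g1
    linarith
  | j + 2 =>
    right
    have hcase := le_or_kap_eq_zero_of_gap (σ := σ) (adm_snd (st w k).h) hv hmid
      (δ := (st w k).rho / 2) (by linarith) hM g1 g2
      (Or.inl (sub_self _)) (Or.inl (sub_self _)) (fun b y u hu => by
        rcases hu with rfl | ⟨i, rfl⟩ <;>
        simp only [St.ppt_snd, St.rpt_snd, St.h_move_main] <;> linarith)
    rcases hcase with h | h
    · linarith
    obtain ⟨n, hn, hw, b, y, hd⟩ := exists_move_of_gap hv g1 g2
    have hs := st_succ_some hd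
    rw [st_waits hn hw] at hs
    obtain ⟨i, hi, hpi, -⟩ := kap_mem_of_mid (σ := σ) hmid
    have hIcc := st_Icc_subset_of_m_le (w := w) (k := n + 1) (i := i)
      (by rw [hs, St.m_move]; omega) ((st_inv w i).mem_Icc hpi)
    rw [hs] at hIcc
    obtain ⟨e1, e2⟩ := hIcc
    change (st w k).r (j + 1) ≤ _ at e1
    change _ ≤ (st w k).r j at e2
    change (st w k).r (j + 1) < _ at g1
    have e3 := (st w k).r_sub_p j
    have e4 := (st_inv w k).p_lt_r (j + 1)
    rw [Prod.dist_eq, Real.dist_eq, Real.dist_eq]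
    refine max_le ?_ ?_
    · rw [St.ppt_fst, abs_le]; constructor <;> linarith
    · rw [St.ppt_snd, h, abs_zero]; linarith

theorem dist_fst_lt {v v' : ℝ × ℝ} {η : ℝ} (h : dist v' v < η) :
    v'.1 < v.1 + η ∧ v.1 - η < v'.1 ∧ v'.2 < v.2 + η := by
  rw [Prod.dist_eq, max_lt_iff, Real.dist_eq, Real.dist_eq, abs_lt, abs_lt] at h
  obtain ⟨⟨h1, h2⟩, h3, h4⟩ := h
  exact ⟨by linarith, by linarith, by linarith⟩

theorem St.Inv.near_right (hS : S.Inv) (hM : S.m < M) {u : ℝ × ℝ} (hu : u ∈ S.Pts) {ε : ℝ}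
    (hε : 0 < ε) : ∃ η > 0, ∀ (w : ℕ → ℕ) (v : ℝ × ℝ) (k : ℕ), st w k = S → v ∈ Fib w →
      u.1 < v.1 → dist v u < η → dist (kap σ M w v) u < ε := by
  have key : ∀ g, ∃ η > 0, ∀ (w : ℕ → ℕ) (v : ℝ × ℝ) (k : ℕ), st w k = S → v ∈ Fib w →
      (S.lo g).1 < v.1 → dist v (S.lo g) < η → dist (kap σ M w v) (S.lo g) < ε := by
    intro g
    obtain ⟨η, hη, h⟩ := hS.near_lo (σ := σ) hM g
    refine ⟨min η ε, lt_min hη hε, fun w v k hk hv h1 h2 => ?_⟩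
    obtain ⟨h3, h4⟩ := lt_min_iff.1 h2
    rcases h w v k hk hv h1 (dist_fst_lt h3).1 with h | h <;> rw [h]
    · rwa [dist_self]
    · exact h4
  rcases hu with rfl | rfl | rfl | ⟨j, rfl⟩
  · exact key 0
  · refine ⟨ε, hε, fun w v k hk hv h1 h2 => ?_⟩
    subst hk
    rwa [kap_of_not_mid (not_mid_of_not_mem hM.le fun h => lt_asymm h1 h.2)]
  · obtain ⟨η, hη, h⟩ := hS.near_ppt (σ := σ) hM
    refine ⟨min η (ε / 2), lt_min hη (by linarith), fun w v k hk hv h1 h2 => ?_⟩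
    obtain ⟨h3, h4⟩ := lt_min_iff.1 h2
    rcases h w v k hk hv h1 (dist_fst_lt h3).1 (dist_fst_lt h3).2.2 with h | h
    · rw [h]; linarith
    · have := (dist_fst_lt h4).1
      rw [St.ppt_fst] at this
      linarith
  · match j with
    | 0 => exact key 1
    | j + 1 => exact key (j + 2)

theorem St.Inv.near_left (hS : S.Inv) (hM : S.m < M) {u : ℝ × ℝ} (hu : u ∈ S.Pts) {ε : ℝ}
    (hε : 0 < ε) : ∃ η > 0, ∀ (w : ℕ → ℕ) (v : ℝ × ℝ) (k : ℕ), st w k = S → v ∈ Fib w →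
      v.1 < u.1 → dist v u < η → dist (kap σ M w v) u < ε := by
  have key : ∀ g, ∃ η > 0, ∀ (w : ℕ → ℕ) (v : ℝ × ℝ) (k : ℕ), st w k = S → v ∈ Fib w →
      v.1 < (S.hi g).1 → dist v (S.hi g) < η → dist (kap σ M w v) (S.hi g) < ε := by
    intro g
    obtain ⟨η, hη, h⟩ := hS.near_hi (σ := σ) hM g
    refine ⟨min η ε, lt_min hη hε, fun w v k hk hv h1 h2 => ?_⟩
    obtain ⟨h3, h4⟩ := lt_min_iff.1 h2
    rcases h w v k hk hv h1 (dist_fst_lt h3).2.1 with h | h <;> rw [h]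
    · rwa [dist_self]
    · exact h4
  rcases hu with rfl | rfl | rfl | ⟨j, rfl⟩
  · refine ⟨ε, hε, fun w v k hk hv h1 h2 => ?_⟩
    subst hk
    rwa [kap_of_not_mid (not_mid_of_not_mem hM.le fun h => lt_asymm h1 h.1)]
  · exact key 1
  · exact key 0
  · exact key (j + 2)

end

section
variable {σ : List ℕ → ℕ} {x : ℕ → Bool}

theorem continuousAt_kap (hσ : ∀ β, UWin x (run σ β)) {q : Y0} (hc : Compat x q.1.1) (M : ℕ) :
    ContinuousAt (fun q' : Y0 => kap σ M q'.1.1 q'.1.2) q := by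
  have hcont : Continuous fun q' : Y0 => q'.1.2 := by fun_prop
  have hfst : Continuous fun q' : Y0 => q'.1.2.1 := by fun_prop
  have hnear : ∀ ε > 0, ∀ᶠ q' : Y0 in 𝓝 q, dist q'.1.2 q.1.2 < ε := fun ε hε =>
    Metric.tendsto_nhds.1 hcont.continuousAt ε hε
  refine Metric.tendsto_nhds.2 fun ε hε => ?_
  change ∀ᶠ q' : Y0 in 𝓝 q, dist (kap σ M q'.1.1 q'.1.2) (kap σ M q.1.1 q.1.2) < ε
  by_cases hk : ∃ k, (st q.1.1 k).m = M
  · obtain ⟨k, hk⟩ := hk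
    by_cases hx : q.1.2.1 ∈ Ioo (st q.1.1 k).a (st q.1.1 k).b
    · have hev : ∀ᶠ q' : Y0 in 𝓝 q, q'.1.2.1 ∈ Ioo (st q.1.1 k).a (st q.1.1 k).b :=
        hfst.continuousAt.eventually_mem (isOpen_Ioo.mem_nhds hx)
      rcases leftOf_or_rightOf hσ hc q.2 hk with hl | hr
      · filter_upwards [hev, cyl_mem_nhds_Y0 q k, eventually_leftOf hl] with q' h1 h2 h3
        have hst : st q'.1.1 k = st q.1.1 k := st_congr h2
        rw [kap_of_left hk hx hl, kap_of_left (hst ▸ hk) (hst ▸ h1) h3, hst, dist_self]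
        exact hε
      · filter_upwards [hev, cyl_mem_nhds_Y0 q k, eventually_rightOf hr] with q' h1 h2 h3
        have hst : st q'.1.1 k = st q.1.1 k := st_congr h2
        rw [kap_of_not_left hk hx hr.not_leftOf, kap_of_not_left (hst ▸ hk) (hst ▸ h1)
          h3.not_leftOf, hst, dist_self]
        exact hε
    · rw [kap_of_not_mid (not_mid_of_not_mem hk.le hx)]
      have hI := st_inv q.1.1 k
      have hfar : (∀ᶠ q' : Y0 in 𝓝 q, q'.1.2.1 ∉ Ioo (st q.1.1 k).a (st q.1.1 k).b) →
          ∀ᶠ q' : Y0 in 𝓝 q, dist (kap σ M q'.1.1 q'.1.2) q.1.2 < ε := by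
        intro h
        filter_upwards [h, cyl_mem_nhds_Y0 q k, hnear ε hε] with q' h1 h2 h3
        have hst : st q'.1.1 k = st q.1.1 k := st_congr h2
        rwa [kap_of_not_mid (not_mid_of_not_mem (k := k) (hst ▸ hk.le) (hst ▸ h1))]
      rcases lt_trichotomy q.1.2.1 (st q.1.1 k).a with ha | ha | ha
      · exact hfar ((hfst.continuousAt.eventually_lt continuousAt_const ha).mono
          fun q' h h' => lt_asymm h h'.1)
      · have hv : q.1.2 = (st q.1.1 k).apt := fib_unique q.2 (St.apt_mem _) ha
        filter_upwards [hfst.continuousAt.eventually_lt continuousAt_const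
          (ha.trans_lt hI.a_lt_p), cyl_mem_nhds_Y0 q k, hnear ε hε] with q' h1 h2 h3
        have hst : st q'.1.1 k = st q.1.1 k := st_congr h2
        by_cases hq' : q'.1.2.1 ∈ Ioo (st q'.1.1 k).a (st q'.1.1 k).b
        · rw [kap_of_lt_p (hst ▸ hk) hq' (hst ▸ h1), hst, ← hv, dist_self]
          exact hε
        · rwa [kap_of_not_mid (not_mid_of_not_mem (k := k) (hst ▸ hk.le) hq')]
      rcases lt_trichotomy q.1.2.1 (st q.1.1 k).b with hb | hb | hb
      · exact absurd ⟨ha, hb⟩ hx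
      · have hv : q.1.2 = (st q.1.1 k).bpt := fib_unique q.2 (St.bpt_mem _) hb
        filter_upwards [continuousAt_const.eventually_lt hfst.continuousAt
          ((hI.r_lt_b 0).trans_eq hb.symm), cyl_mem_nhds_Y0 q k, hnear ε hε] with q' h1 h2 h3
        have hst : st q'.1.1 k = st q.1.1 k := st_congr h2
        by_cases hq' : q'.1.2.1 ∈ Ioo (st q'.1.1 k).a (st q'.1.1 k).b
        · rw [kap_of_r_lt (hst ▸ hk) hq' (hst ▸ h1), hst, ← hv, dist_self]
          exact hε
        · rwa [kap_of_not_mid (not_mid_of_not_mem (k := k) (hst ▸ hk.le) hq')]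
      · exact hfar ((continuousAt_const.eventually_lt hfst.continuousAt hb).mono
          fun q' h h' => lt_asymm h h'.2)
  · have hlt : ∀ k, (st q.1.1 k).m < M := fun k => lt_of_not_ge fun h => hk (exists_stage h)
    have hmid : ¬ Mid M q.1.1 q.1.2 := fun ⟨k, h, _⟩ => hk ⟨k, h⟩
    rw [kap_of_not_mid hmid]
    have hfin : ¬ ∀ k, ∃ i ≥ k, dec (q.1.1 i) ≠ none := fun h => by
      obtain ⟨k, hk⟩ := m_unbounded h M
      exact absurd (hlt k) (not_lt.2 hk)
    push Not at hfin
    obtain ⟨k, hwait⟩ := hfin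
    have hI := st_inv q.1.1 k
    have hpt : q.1.2 ∈ (st q.1.1 k).Pts ∨ q.1.2.1 ∉ Icc (st q.1.1 k).a (st q.1.1 k).b := by
      rcases q.2 with ⟨i, hi⟩ | ⟨h, -, -⟩
      · rcases le_total i k with h | h
        · exact pts_later h hi
        · rw [st_waits h fun j hj _ => hwait j hj] at hi
          exact Or.inl hi
      · obtain ⟨i, hi, hd⟩ := h k
        exact absurd (hwait i hi) hd
    rcases hpt with hpt | hout
    · obtain ⟨η₁, hη₁, h₁⟩ := hI.near_right (σ := σ) (hlt k) hpt hε
      obtain ⟨η₂, hη₂, h₂⟩ := hI.near_left (σ := σ) (hlt k) hpt hε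
      filter_upwards [cyl_mem_nhds_Y0 q k, hnear η₁ hη₁, hnear η₂ hη₂] with q' h2 h3 h4
      have hst : st q'.1.1 k = st q.1.1 k := st_congr h2
      rcases lt_trichotomy q'.1.2.1 q.1.2.1 with h | h | h
      · exact h₂ _ _ k hst q'.2 h h4
      · have hv : q'.1.2 = q.1.2 := fib_unique q'.2 (hst ▸ hpt) h
        rw [kap_of_not_mid (not_mid_of_pts (k := k) (hst ▸ hlt k) (by rw [hv, hst]; exact hpt)),
          hv, dist_self]
        exact hε
      · exact h₁ _ _ k hst q'.2 h h3
    · filter_upwards [cyl_mem_nhds_Y0 q k, hnear ε hε,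
        hfst.continuousAt.eventually_mem (isClosed_Icc.isOpen_compl.mem_nhds hout)] with q' h2 h3 h4
      have hst : st q'.1.1 k = st q.1.1 k := st_congr h2
      rwa [kap_of_not_mid (not_mid_of_not_mem (k := k) (hst ▸ (hlt k).le)
        (hst ▸ fun h => h4 (Ioo_subset_Icc_self h)))]

theorem exists_cyl_subset {f : ℕ → ℕ} {u : Set (ℕ → ℕ)} (hu : u ∈ 𝓝 f) :
    ∃ k, {g | ∀ i < k, g i = f i} ⊆ u := by
  by_contra! hcon
  choose g hg hgu using fun k => not_subset.1 (hcon k)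
  have : Tendsto g atTop (𝓝 f) := tendsto_pi_nhds.2 fun i =>
    tendsto_const_nhds.congr' ((eventually_gt_atTop i).mono fun k hk => (hg k i hk).symm)
  obtain ⟨k, hk⟩ := (this.eventually hu).exists
  exact hgu k hk

theorem countable_range_kap (M : ℕ) :
    (range fun q : Y0 => kap σ M q.1.1 q.1.2).Countable := by
  refine (countable_iUnion fun s : List ℕ => St.countable_pts (st (wt s) s.length)).mono ?_
  rintro _ ⟨q, rfl⟩
  obtain ⟨k, hk⟩ := kap_mem_pts (σ := σ) (M := M) q.2
  refine mem_iUnion.2 ⟨pre q.1.1 k, ?_⟩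
  rwa [length_pre, st_wt_pre _ le_rfl]

theorem IsNet.dimLE_FF {Net : List ℕ → Set Y0} (hN : IsNet Net)
    (hσ : ∀ β, UWin x (run σ β)) : DimLE (↥(FF Net x)) 0 := by
  refine dimLE_zero_of_clopen_basis fun t U hU htU => ?_
  have hcont : ∀ M, Continuous fun t : FF Net x => kap σ M t.1.1.1 t.1.1.2 := by
    intro M
    rw [continuous_iff_continuousAt]
    intro t
    by_cases hc : Compat x t.1.1.1
    · exact (continuousAt_kap hσ hc M).comp continuousAt_subtype_val
    · have : ∀ᶠ t' : FF Net x in 𝓝 t, t'.1 ∈ FF Net x → t'.1 = t.1 :=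
        continuous_subtype_val.continuousAt.eventually
          (f := (Subtype.val : FF Net x → Y0)) (hN.isolated hc)
      refine (continuousAt_const (y := kap σ M t.1.1.1 t.1.1.2)).congr_of_eventuallyEq ?_
      filter_upwards [this] with t' ht'
      rw [ht' t'.2]
  obtain ⟨k, ε, hε, hkU⟩ : ∃ k, ∃ ε > 0, ∀ t' : FF Net x, (∀ i < k, t'.1.1.1 i = t.1.1.1 i) →
      dist t'.1.1.2 t.1.1.2 < ε → t' ∈ U := by
    obtain ⟨V, hV, rfl⟩ := isOpen_induced_iff.1 hU
    obtain ⟨W, hW, rfl⟩ := isOpen_induced_iff.1 hV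
    obtain ⟨u, hu, v, hv, huv⟩ := mem_nhds_prod_iff.1 (hW.mem_nhds htU)
    obtain ⟨ε, hε, hεv⟩ := Metric.mem_nhds_iff.1 hv
    obtain ⟨k, hk⟩ := exists_cyl_subset hu
    exact ⟨k, ε, hε, fun t' h1 h2 => huv ⟨hk h1, hεv h2⟩⟩
  obtain ⟨M, hM⟩ := exists_pow_lt_of_lt_one (show 0 < ε / 4 by linarith)
    (show (1 / 2 : ℝ) < 1 by norm_num)
  let K : FF Net x → ℝ × ℝ := fun t => kap σ M t.1.1.1 t.1.1.2
  have hcount : ((fun z => dist z (K t)) '' range K).Countable := by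
    refine Countable.image ((countable_range_kap (σ := σ) M).mono ?_) _
    rintro _ ⟨t', rfl⟩
    exact ⟨t'.1, rfl⟩
  obtain ⟨δ, hδ, hδ'⟩ : ∃ δ ∈ Ioo 0 (ε / 2), δ ∉ (fun z => dist z (K t)) '' range K := by
    by_contra! hcon
    have := Cardinal.Real.Ioo_countable_iff.1 (hcount.mono hcon)
    linarith
  refine ⟨{t' | ∀ i < k, t'.1.1.1 i = t.1.1.1 i} ∩ K ⁻¹' Metric.ball (K t) δ,
    IsClopen.inter ?_ ⟨?_, Metric.isOpen_ball.preimage (hcont M)⟩,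
    ⟨fun _ _ => rfl, Metric.mem_ball_self hδ.1⟩, fun t' ht' => hkU t' ht'.1 ?_⟩
  · exact (isClopen_of_pre (P := fun g => ∀ i < k, g i = t.1.1.1 i) k
      fun f g h hf i hi => (h i hi).symm.trans (hf i hi)).preimage
        (continuous_word.comp continuous_subtype_val)
  · have : K ⁻¹' Metric.ball (K t) δ = K ⁻¹' Metric.closedBall (K t) δ := by
      ext t'
      refine ⟨fun h => Metric.ball_subset_closedBall h, fun h => ?_⟩
      exact lt_of_le_of_ne h fun he => hδ' ⟨K t', ⟨t', rfl⟩, he⟩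
    rw [this]
    exact Metric.isClosed_closedBall.preimage (hcont M)
  · have h1 : dist (K t') (K t) < δ := ht'.2
    have h2 : dist (K t') t'.1.1.2 ≤ _ := dist_kap_le t'.1.2
    have h3 : dist (K t) t.1.1.2 ≤ _ := dist_kap_le t.1.2
    have h4 := dist_triangle4 t'.1.1.2 (K t') (K t) t.1.1.2
    rw [dist_comm t'.1.1.2 (K t')] at h4
    linarith [hδ.2]

end

/-- A separation of the points `(0, 0)` and `(1, 0)` in the fibres over the words compatible
with `x`. -/
structure Sep (x : ℕ → Bool) (C : Set ((ℕ → ℕ) × (ℝ × ℝ))) : Prop where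
  loc : ∀ w v, v ∈ Fib w → Compat x w → ∃ k, ∃ η > 0, ∀ w' v', v' ∈ Fib w' → Compat x w' →
    (∀ i < k, w' i = w i) → dist v' v < η → ((w', v') ∈ C ↔ (w, v) ∈ C)
  left : ∀ w, Compat x w → (w, start.apt) ∈ C
  right : ∀ w, Compat x w → (w, start.bpt) ∉ C

/-- The stage reached by a finite word. -/
noncomputable def stage (s : List ℕ) : St := st (wt s) s.length

theorem stage_pre (w : ℕ → ℕ) (k : ℕ) : stage (pre w k) = st w k := by
  rw [stage, length_pre, st_wt_pre _ le_rfl]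

theorem st_of_pre_eq {w : ℕ → ℕ} {s : List ℕ} (h : pre w s.length = s) :
    st w s.length = stage s := by
  rw [← stage_pre, h]

theorem pre_wt (s : List ℕ) : pre (wt s) s.length = s := pre_app_length _ _

/-- The position `s` is compatible with `x` and its interval has endpoints separated by `C`. -/
def Pos (x : ℕ → Bool) (C : Set ((ℕ → ℕ) × (ℝ × ℝ))) (s : List ℕ) : Prop :=
  (stage s).Cmp x ∧ ∀ w, Compat x w → pre w s.length = s →
    (w, (stage s).apt) ∈ C ∧ (w, (stage s).bpt) ∉ C

/-- `s'` arises from `s` by waiting and then making the move `(g, b)` with a bit of `x`. -/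
def Nxt (x : ℕ → Bool) (s : List ℕ) (g b : ℕ) (s' : List ℕ) : Prop :=
  ∃ n, s' = pre (wt s) (s.length + n) ++ [enc (g, b, x (stage s).m)]

section Nxt
variable {x : ℕ → Bool} {s s' : List ℕ} {g b : ℕ}

theorem Nxt.lt (h : Nxt x s g b s') : s.length < s'.length := by
  obtain ⟨n, rfl⟩ := h
  simp only [List.length_append, length_pre, List.length_singleton]
  omega

theorem Nxt.prefix (h : Nxt x s g b s') : s <+: s' := by
  obtain ⟨n, rfl⟩ := h
  refine List.IsPrefix.trans ?_ (List.prefix_append _ _)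
  rw [wt, pre_app_add]
  exact List.prefix_append _ _

theorem Nxt.exists_dec (h : Nxt x s g b s') {w : ℕ → ℕ} (hw : pre w s'.length = s') :
    ∃ n ≥ s.length, dec (w n) = some (g, b, x (stage s).m) := by
  obtain ⟨n, rfl⟩ := h
  refine ⟨s.length + n, Nat.le_add_right _ _, ?_⟩
  obtain ⟨-, h⟩ := eq_pre_iff.1 hw.symm
  rw [← h (s.length + n) (by simp)]
  simp

theorem Nxt.stage_eq (h : Nxt x s g b s') :
    stage s' = (stage s).move g b (x (stage s).m) := by
  obtain ⟨n, rfl⟩ := h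
  let w := app (pre (wt s) (s.length + n)) fun _ => enc (g, b, x (stage s).m)
  have h1 : ∀ i < s.length + n, w i = wt s i := fun i hi => by
    simp only [w, app_lt _ _ (show i < (pre (wt s) (s.length + n)).length by simpa using hi),
      getElem_pre]
  have h2 : w (s.length + n) = enc (g, b, x (stage s).m) := by
    simpa using app_add' (pre (wt s) (s.length + n)) (fun _ => enc (g, b, x (stage s).m)) 0
      (s.length + n) (by simp)
  have h3 : pre (wt s) (s.length + n) ++ [enc (g, b, x (stage s).m)] =
      pre w (s.length + n + 1) := by
    rw [pre_succ, h2, pre_eq_iff.2 h1]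
  have h4 : stage s = st w (s.length + n) := by
    rw [st_congr h1, st_wt_ge (Nat.le_add_right _ _)]; rfl
  have h5 : dec (w (s.length + n)) = some (g, b, x (stage s).m) := by rw [h2, dec_enc]
  rw [h3, stage_pre, st_succ_some h5, h4]

end Nxt

section Sep
variable {x : ℕ → Bool} {C : Set ((ℕ → ℕ) × (ℝ × ℝ))} {s : List ℕ}

theorem compat_wt (h : (stage s).Cmp x) : Compat x (wt s) := by
  intro k
  rcases le_total k s.length with hk | hk
  · exact cmp_of_le hk h
  · rw [st_wt_ge hk]; exact h

theorem Sep.exists_gap (hC : Sep x C) (hs : Pos x C s) :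
    ∃ g, (wt s, (stage s).lo g) ∈ C ∧ (wt s, (stage s).hi g) ∉ C := by
  have hc := compat_wt hs.1
  have hfib : ∀ v ∈ (stage s).Pts, v ∈ Fib (wt s) := fun v hv => Or.inl ⟨_, hv⟩
  obtain ⟨ha, hb⟩ := hs.2 _ hc (pre_wt s)
  by_contra! hcon
  have hp := hcon 0 ha
  obtain ⟨k, η, hη, h⟩ := hC.loc _ _ (hfib _ (stage s).ppt_mem) hc
  have hr : Tendsto (stage s).rpt atTop (𝓝 (stage s).ppt) :=
    (stage s).tendsto_r.prodMk_nhds tendsto_const_nhds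
  obtain ⟨j, hj⟩ := (Metric.tendsto_nhds.1 hr η hη).exists
  have hj' : (wt s, (stage s).rpt j) ∈ C :=
    (h _ _ (hfib _ ((stage s).rpt_mem j)) hc (fun _ _ => rfl) hj).2 hp
  have hall : ∀ j, (wt s, (stage s).rpt j) ∈ C → (wt s, (stage s).rpt 0) ∈ C := by
    intro j
    induction j with
    | zero => exact id
    | succ j ih => exact fun h => ih (hcon (j + 2) h)
  exact hb (hcon 1 (hall j hj'))

theorem Sep.exists_next (hC : Sep x C) (hs : Pos x C s) :
    ∃ g, ∀ b, ∃ s', Nxt x s g b s' ∧ Pos x C s' := by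
  obtain ⟨g, hlo, hhi⟩ := hC.exists_gap hs
  have hc := compat_wt hs.1
  have hfib : ∀ v ∈ (stage s).Pts, v ∈ Fib (wt s) := fun v hv => Or.inl ⟨_, hv⟩
  obtain ⟨k₁, η₁, hη₁, h₁⟩ := hC.loc _ _ (hfib _ ((stage s).lo_mem g)) hc
  obtain ⟨k₂, η₂, hη₂, h₂⟩ := hC.loc _ _ (hfib _ ((stage s).hi_mem g)) hc
  refine ⟨g, fun b => ⟨_, ⟨max k₁ k₂, rfl⟩, ?_⟩⟩
  set s' := pre (wt s) (s.length + max k₁ k₂) ++ [enc (g, b, x (stage s).m)] with hs'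
  have hst : stage s' = (stage s).move g b (x (stage s).m) := Nxt.stage_eq ⟨max k₁ k₂, rfl⟩
  have hcmp : (stage s).ys = pre x (stage s).m := hs.1
  refine ⟨?_, fun w hw hpre => ?_⟩
  · rw [St.Cmp, hst, St.m_move, pre_succ, ← hcmp]
    rfl
  · have hagree : ∀ i < max k₁ k₂, w i = wt s i := fun i hi => by
      obtain ⟨-, h⟩ := eq_pre_iff.1 hpre.symm
      have hi' : i < (pre (wt s) (s.length + max k₁ k₂)).length := by
        rw [length_pre]; omega
      rw [← h i (by rw [hs', List.length_append]; omega)]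
      simp only [hs', List.getElem_append_left hi', getElem_pre]
    have hwst := st_of_pre_eq hpre
    have hA : (stage s').apt ∈ Fib w := Or.inl ⟨s'.length, hwst ▸ St.apt_mem _⟩
    have hB : (stage s').bpt ∈ Fib w := Or.inl ⟨s'.length, hwst ▸ St.bpt_mem _⟩
    rw [hst, St.apt_move] at hA
    rw [hst, St.bpt_move] at hB
    rw [hst, St.apt_move, St.bpt_move]
    exact ⟨(h₁ _ _ hA hw (fun i hi => hagree i (lt_max_of_lt_left hi))
      (by rwa [dist_self])).2 hlo, fun h => hhi ((h₂ _ _ hB hw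
      (fun i hi => hagree i (lt_max_of_lt_right hi)) (by rwa [dist_self])).1 h)⟩

theorem Sep.pos_nil (hC : Sep x C) : Pos x C [] :=
  ⟨rfl, fun w hw _ => ⟨hC.left w hw, hC.right w hw⟩⟩

theorem exists_mem_boxes (w : ℕ → ℕ) : ∃ v, ∀ k, v ∈ (st w k).Box := by
  have h := IsCompact.nonempty_iInter_of_sequence_nonempty_isCompact_isClosed
    (fun k => (st w k).Box) (fun k => st_box_anti w k.le_succ)
    (fun k => ⟨_, (st_inv w k).pts_subset_box (St.apt_mem _)⟩) (St.isCompact_box _)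
    fun k => St.isClosed_box _
  obtain ⟨v, hv⟩ := h
  exact ⟨v, mem_iInter.1 hv⟩

/-- Along an infinite branch of positions the play is eventually won. -/
theorem Sep.good (hC : Sep x C) {l : ℕ → List ℕ} {g b : ℕ → ℕ} (hl : ∀ k, Pos x C (l k))
    (hn : ∀ k, Nxt x (l k) (g k) (b k) (l (k + 1))) :
    ∃ w, (∀ k, pre w (l k).length = l k) ∧ Good w := by
  have hpre : ∀ i j, i ≤ j → l i <+: l j := fun i j hij => by
    induction j, hij using Nat.le_induction with
    | base => exact List.prefix_rfl
    | succ j _ ih => exact ih.trans (hn j).prefix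
  obtain ⟨w, hw⟩ := exists_limit hpre
  have hw' : ∀ k, pre w (l k).length = l k := fun k => (hw k).symm
  have hlen : ∀ k, k ≤ (l k).length := fun k => by
    induction k with
    | zero => exact Nat.zero_le _
    | succ k ih => have := (hn k).lt; omega
  refine ⟨w, hw', ?_⟩
  by_contra hgood
  have hc : Compat x w := fun k => by
    refine cmp_of_le (hlen k) ?_
    rw [st_of_pre_eq (hw' k)]
    exact (hl k).1
  have hinf : ∀ k, ∃ i ≥ k, dec (w i) ≠ none := fun k => by
    obtain ⟨n, hn, hd⟩ := (hn k).exists_dec (hw' (k + 1))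
    exact ⟨n, (hlen k).trans hn, by simp [hd]⟩
  obtain ⟨v, hv⟩ := exists_mem_boxes w
  have hfib : v ∈ Fib w := Or.inr ⟨hinf, hgood, hv⟩
  obtain ⟨_, η, hη, h⟩ := hC.loc w v hfib hc
  obtain ⟨M, hM⟩ := exists_pow_lt_of_lt_one hη (show (1 / 2 : ℝ) < 1 by norm_num)
  obtain ⟨k, hk⟩ := m_unbounded hinf M
  have hm : M ≤ (st w (l k).length).m := hk.trans (m_mono w (hlen k))
  have hst := st_of_pre_eq (hw' k)
  have hd : ∀ u ∈ (st w (l k).length).Pts, dist u v < η := fun u hu =>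
    ((st_inv w _).dist_box ((st_inv w _).pts_subset_box hu) (hv _)).trans_lt
      ((pow_le_pow_of_le_one (by norm_num) (by norm_num) hm).trans_lt hM)
  have h1 := h w _ (Or.inl ⟨_, St.apt_mem _⟩) hc (fun _ _ => rfl) (hd _ (St.apt_mem _))
  have h2 := h w _ (Or.inl ⟨_, St.bpt_mem _⟩) hc (fun _ _ => rfl) (hd _ (St.bpt_mem _))
  obtain ⟨h3, h4⟩ := (hl k).2 w hc (hw' k)
  rw [← hst] at h3 h4
  exact h4 (h2.2 (h1.1 h3))

theorem Sep.mem_univGame (hC : Sep x C) : x ∈ univGame := by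
  have hnext : ∀ r : {s // Pos x C s}, ∃ g, ∀ b, ∃ r' : {s // Pos x C s}, Nxt x r.1 g b r'.1 :=
    fun r => (hC.exists_next r.2).imp fun g h b => (h b).elim fun s' h' => ⟨⟨s', h'.2⟩, h'.1⟩
  choose gp nx hnx using hnext
  let root : {s // Pos x C s} := ⟨[], hC.pos_nil⟩
  have hfold : ∀ r β k, Nxt x (List.foldl nx r (pre β k)).1 (gp (List.foldl nx r (pre β k))) (β k)
      (List.foldl nx r (pre β (k + 1))).1 := by
    intro r β k
    rw [pre_succ, List.foldl_append]
    exact hnx _ _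
  have hlen : ∀ r β k, k ≤ (List.foldl nx r (pre β k)).1.length := fun r β k => by
    induction k with
    | zero => exact Nat.zero_le _
    | succ k ih => have := (hfold r β k).lt; omega
  have hgood : ∀ r β, ∃ w, (∀ k, pre w (List.foldl nx r (pre β k)).1.length =
      (List.foldl nx r (pre β k)).1) ∧ Good w := fun r β =>
    hC.good (fun k => (List.foldl nx r (pre β k)).2) (hfold r β)
  obtain ⟨r, hr, hsafe⟩ : ∃ r : {s // Pos x C s}, (stage r.1).pl = [] ∧
      ∀ bs, 3 ≤ gp (List.foldl nx r bs) := by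
    by_contra! hcon
    choose bs hbs using hcon
    have hrest : ∀ r (h : (stage r.1).pl = []),
        (stage (List.foldl nx r (bs r h ++ [0])).1).pl = [] := by
      intro r h
      rw [List.foldl_append]
      change (stage (nx _ 0).1).pl = []
      rw [(hnx _ 0).stage_eq, St.move]
      exact if_neg (not_le.2 (hbs r h))
    let L : ℕ → {l : List ℕ // (stage (List.foldl nx root l).1).pl = []} := fun k =>
      Nat.rec ⟨[], rfl⟩ (fun _ l => ⟨l.1 ++ (bs _ l.2 ++ [0]), by
        rw [List.foldl_append]; exact hrest _ l.2⟩) k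
    have hL : ∀ k, (L (k + 1)).1 = (L k).1 ++ (bs _ (L k).2 ++ [0]) := fun k => rfl
    have hpre : ∀ i j, i ≤ j → (L i).1 <+: (L j).1 := fun i j hij => by
      induction j, hij using Nat.le_induction with
      | base => exact List.prefix_rfl
      | succ j _ ih => exact ih.trans (hL j ▸ List.prefix_append _ _)
    have hLlen : ∀ k, k ≤ (L k).1.length := fun k => by
      induction k with
      | zero => exact Nat.zero_le _
      | succ k ih => rw [hL]; simp only [List.length_append, List.length_singleton]; omega
    obtain ⟨β, hβ⟩ := exists_limit hpre
    obtain ⟨w, hw, k₀, n, hG⟩ := hgood root β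
    let N := (L k₀).1.length + (bs _ (L k₀).2).length
    have hN : pre β N = (L k₀).1 ++ bs _ (L k₀).2 := by
      have h1 := hβ (k₀ + 1)
      have h2 : (L (k₀ + 1)).1.length = N + 1 := by
        rw [hL]; simp only [List.length_append, List.length_singleton, N]; omega
      rw [h2, hL, pre_succ, ← List.append_assoc] at h1
      exact (List.append_inj_left' h1 rfl).symm
    obtain ⟨i, hi, hd⟩ := (hfold root β N).exists_dec (hw (N + 1))
    have hge := (hG i ((hLlen k₀).trans
      ((Nat.le_add_right _ _).trans ((hlen root β N).trans hi)))).1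
      _ _ _ hd
    rw [hN, List.foldl_append] at hge
    exact absurd (hbs _ (L k₀).2) (not_lt.2 hge)
  refine ⟨fun l => gp (List.foldl nx r l) - 3, fun β => ?_⟩
  obtain ⟨w, hw, k₀, n, hG⟩ := hgood r β
  have hpl : ∀ k, (stage (List.foldl nx r (pre β k)).1).pl =
      pre (run (fun l => gp (List.foldl nx r l) - 3) β) k := by
    intro k
    induction k with
    | zero => exact hr
    | succ k ih =>
      rw [(hfold r β k).stage_eq, pre_succ, ← ih]
      exact if_pos (hsafe _)
  have hm : ∀ k, k ≤ (stage (List.foldl nx r (pre β k)).1).m := fun k => by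
    induction k with
    | zero => exact Nat.zero_le _
    | succ k ih => rw [(hfold r β k).stage_eq, St.m_move]; omega
  refine ⟨n, fun k => ?_⟩
  set e := Encodable.encode (n, pre (run (fun l => gp (List.foldl nx r l) - 3) β) k) with he
  let K := max (max k k₀) (e + 1)
  have hK₁ : k ≤ K := (le_max_left k k₀).trans (le_max_left _ _)
  have hK₂ : k₀ ≤ K := (le_max_right k k₀).trans (le_max_left _ _)
  have hK₃ : e < K := e.lt_succ_self.trans_le (le_max_right _ _)
  have hOk := (hG _ (hK₂.trans (hlen r β K))).2
  rw [st_of_pre_eq (hw K)] at hOk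
  have hys : (stage (List.foldl nx r (pre β K)).1).ys = _ := (List.foldl nx r (pre β K)).2.1
  have := hOk (pre (run (fun l => gp (List.foldl nx r l) - 3) β) k)
    (by rw [hpl, ← take_pre _ hK₁]; exact List.take_prefix _ _)
  rw [hys, ← he, getElem?_pre _ (hK₃.trans_le (hm K))] at this
  simpa using this

end Sep

section
variable {x : ℕ → Bool}

theorem mem_FF {Net : List ℕ → Set Y0} {w : ℕ → ℕ} {v : ℝ × ℝ} (hv : v ∈ Fib w)
    (hw : Compat x w) : (⟨(w, v), hv⟩ : Y0) ∈ FF Net x := Or.inl hw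

theorem mem_univGame_of_dimLE {Net : List ℕ → Set Y0} (h : DimLE (↥(FF Net x)) 0) :
    x ∈ univGame := by
  have hcont : Continuous fun t : FF Net x => t.1.1.2 :=
    (continuous_snd.comp continuous_subtype_val).comp continuous_subtype_val
  have hA : IsClosed {t : FF Net x | t.1.1.2 = start.apt} := isClosed_singleton.preimage hcont
  have hB : IsClosed {t : FF Net x | t.1.1.2 = start.bpt} := isClosed_singleton.preimage hcont
  have hne : start.apt ≠ start.bpt := fun h => by simp [start, St.apt, St.bpt] at h
  obtain ⟨C, hC, hAC, hCB⟩ := h.exists_isClopen hA hB <| disjoint_left.2 fun t h1 h2 =>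
    hne (h1.symm.trans h2)
  have hmem : ∀ {w v} (hv : v ∈ Fib w) (hw : Compat x w),
      (w, v) ∈ (fun t : FF Net x => t.1.1) '' C ↔
        (⟨⟨(w, v), hv⟩, mem_FF hv hw⟩ : FF Net x) ∈ C := by
    intro w v hv hw
    refine ⟨?_, fun h => ⟨_, h, rfl⟩⟩
    rintro ⟨⟨⟨q, hq⟩, ht⟩, hqC, rfl⟩
    exact hqC
  have hstart : ∀ w, start.apt ∈ Fib w ∧ start.bpt ∈ Fib w := fun w =>
    ⟨Or.inl ⟨0, St.apt_mem _⟩, Or.inl ⟨0, St.bpt_mem _⟩⟩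
  refine Sep.mem_univGame (C := (fun t : FF Net x => t.1.1) '' C) ⟨fun w v hv hw => ?_,
    fun w hw => (hmem (hstart w).1 hw).2 (hAC rfl),
    fun w hw h => disjoint_left.1 hCB ((hmem (hstart w).2 hw).1 h) rfl⟩
  have hloc : ∃ U : Set ((ℕ → ℕ) × (ℝ × ℝ)), U ∈ 𝓝 (w, v) ∧ ∀ t : FF Net x, t.1.1 ∈ U →
      (t ∈ C ↔ (⟨⟨(w, v), hv⟩, mem_FF hv hw⟩ : FF Net x) ∈ C) := by
    have key : ∀ D : Set (FF Net x), IsOpen D → (⟨⟨(w, v), hv⟩, mem_FF hv hw⟩ : FF Net x) ∈ D →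
        ∃ U : Set ((ℕ → ℕ) × (ℝ × ℝ)), U ∈ 𝓝 (w, v) ∧ ∀ t : FF Net x, t.1.1 ∈ U → t ∈ D := by
      intro D hD hmD
      obtain ⟨V, hV, rfl⟩ := isOpen_induced_iff.1 hD
      obtain ⟨W, hW, rfl⟩ := isOpen_induced_iff.1 hV
      exact ⟨W, hW.mem_nhds hmD, fun t ht => ht⟩
    by_cases hm : (⟨⟨(w, v), hv⟩, mem_FF hv hw⟩ : FF Net x) ∈ C
    · obtain ⟨U, hU, h⟩ := key C hC.isOpen hm
      exact ⟨U, hU, fun t ht => iff_of_true (h t ht) hm⟩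
    · obtain ⟨U, hU, h⟩ := key Cᶜ hC.compl.isOpen hm
      exact ⟨U, hU, fun t ht => iff_of_false (h t ht) hm⟩
  obtain ⟨U, hU, hUC⟩ := hloc
  obtain ⟨u, hu, z, hz, huz⟩ := mem_nhds_prod_iff.1 hU
  obtain ⟨η, hη, hηz⟩ := Metric.mem_nhds_iff.1 hz
  obtain ⟨k, hk⟩ := exists_cyl_subset hu
  refine ⟨k, η, hη, fun w' v' hv' hw' h1 h2 => ?_⟩
  rw [hmem hv' hw', hmem hv hw]
  exact hUC _ (huz ⟨hk h1, hηz h2⟩)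

end

/-- The graph embedding of the Baire space into the Cantor space. -/
def graph (w : ℕ → ℕ) : ℕ → Bool := fun n => decide (w n.unpair.1 = n.unpair.2)

theorem graph_pair (w : ℕ → ℕ) (i m : ℕ) : graph w (Nat.pair i m) = true ↔ w i = m := by
  simp [graph]

theorem isEmbedding_graph : IsEmbedding graph := by
  have hcont : Continuous graph := continuous_pi fun n =>
    (continuous_of_discreteTopology (f := fun k : ℕ => decide (k = n.unpair.2))).comp
      (continuous_apply n.unpair.1)
  refine ⟨⟨le_antisymm hcont.le_induced ?_⟩, fun w w' h => funext fun i => ?_⟩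
  · refine le_iInf fun i => ?_
    rw [← continuous_iff_le_induced]
    refine @continuous_discrete_rng _ _ (induced graph inferInstance) _ _ _ |>.2 fun m => ?_
    have happ : Continuous fun f : ℕ → Bool => f (Nat.pair i m) := continuous_apply _
    refine ⟨{f | f (Nat.pair i m) = true}, (isOpen_discrete {true}).preimage happ, ?_⟩
    ext w
    exact graph_pair w i m
  · have := (graph_pair w i (w i)).2 rfl
    rw [h] at this
    exact ((graph_pair w' i (w i)).1 this).symm

theorem fib_subset_box {w : ℕ → ℕ} {v : ℝ × ℝ} (hv : v ∈ Fib w) : v ∈ start.Box := by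
  rcases hv with ⟨k, hk⟩ | ⟨-, -, h⟩
  · exact st_box_anti w (Nat.zero_le k) ((st_inv w k).pts_subset_box hk)
  · exact h 0

theorem box_start_subset : start.Box ⊆ Icc 0 1 ×ˢ Icc 0 1 := by
  rintro v ⟨h1, h2, h3⟩
  have h4 : start.rho = 1 / 2 := by simp [start, St.rho, St.m]
  have h5 : start.h = 1 / 2 := rfl
  rw [h4, h5] at h2 h3
  exact ⟨h1, by linarith, by linarith⟩

/-- The embedding of the space into the product of the Cantor space with the unit square. -/
def toCube (q : Y0) : (ℕ → Bool) × (Icc (0 : ℝ) 1 × Icc (0 : ℝ) 1) :=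
  (graph q.1.1, ⟨q.1.2.1, (box_start_subset (fib_subset_box q.2)).1⟩,
    ⟨q.1.2.2, (box_start_subset (fib_subset_box q.2)).2⟩)

theorem isEmbedding_toCube : IsEmbedding toCube := by
  have h1 : IsEmbedding fun q : Y0 => (graph q.1.1, q.1.2) :=
    (isEmbedding_graph.prodMap .id).comp .subtypeVal
  have h2 : Continuous toCube := by
    have hg := isEmbedding_graph.continuous
    unfold toCube
    fun_prop
  have h3 : Continuous fun z : (ℕ → Bool) × (Icc (0 : ℝ) 1 × Icc (0 : ℝ) 1) =>
      (z.1, ((z.2.1 : ℝ), (z.2.2 : ℝ))) := by fun_prop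
  exact h1.of_comp h2 h3

end GapGame

/-- There exists a Polish space `Y ⊆ 2^ω × [0,1]²` such that `F₀(Y)` is `Game Σ⁰₂`-hard;
in particular `F₀(Y)` is not in the smallest nontrivial pointclass closed under
complementation and the Souslin operation `A`. -/
theorem exists_polish_subspace_F0_gameSigma2_hard :
    ∃ Y : Set ((ℕ → Bool) × (Set.Icc (0:ℝ) 1 × Set.Icc (0:ℝ) 1)),
      PolishSpace ↥Y ∧
      ∀ τ : TopologicalSpace (Cl ↥Y), IsAdmissible (↥Y) τ →
        @GameSigmaHard 2 _ τ (F0 ↥Y) ∧ ¬ @CSet _ τ (F0 ↥Y) := by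
  let H : GapGame.Y0 ≃ₜ range GapGame.toCube := GapGame.isEmbedding_toCube.toHomeomorph
  refine ⟨range GapGame.toCube, ?_, ?_⟩
  · have := GapGame.isGδ_Y0.polishSpace_coe
    exact H.symm.isClosedEmbedding.polishSpace
  · rintro τ ⟨Z, tZ, _, _, e, -, hτ⟩
    let := metrizableSpaceMetric Z
    obtain ⟨Net, hN, hnet⟩ := GapGame.exists_net (e ∘ H)
    let φ : (ℕ → Bool) → Cl (range GapGame.toCube) := fun x =>
      ⟨H '' GapGame.FF Net x, H.isClosed_image.2 hN.isClosed_FF⟩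
    have hφ : @Continuous _ _ _ τ φ := by
      rw [hτ]
      refine continuous_induced_rng.2 ?_
      have := GapGame.continuous_FF hN hnet
      simp only [image_comp] at this
      exact this
    refine GapGame.hard_of_univGame hφ fun x => ?_
    constructor
    · exact fun h => GapGame.mem_univGame_of_dimLE
        (DimLE.of_homeomorph (H.image (GapGame.FF Net x)).symm h)
    · rintro ⟨σ, hσ⟩
      exact DimLE.of_homeomorph (H.image (GapGame.FF Net x)) (hN.dimLE_FF hσ)
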